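/- Let (u, ρ) be a smooth global solution on [0, ∞) of the prescribed curvature flow for smooth positive data f (on the closed unit disc) and j (on the unit circle), with K = e^{−2u}(−Δu) in B and k = e^{−u}(∂u/∂ν₀ + 1) on ∂B. Define F(t) = ∫_B (α(t) f − K(·,t))² e^{2u(·,t)} dz + ∫_{∂B} (β(t) j − k(·,t))² e^{u(·,t)} ds₀ + ρ'(t)². Then F(t) → 0 as t → ∞. -/

import Mathlib

open MeasureTheory Metric Set Filter
open scoped Real Topology ENNReal

noncomputable section

/-- The closed unit disc in `ℂ ≅ ℝ²`. -/
def cdisc : Set ℂ := Metric.closedBall 0 1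

/-- The open unit disc `B`. -/
def odisc : Set ℂ := Metric.ball 0 1

/-- The unit circle `∂B`. -/
def bdry : Set ℂ := Metric.sphere 0 1

/-- The boundary point with angle `θ`. -/
def bpt (θ : ℝ) : ℂ := Complex.exp ((θ : ℂ) * Complex.I)

/-- Boundary integral with respect to arclength `ds₀`. -/
def circInt (φ : ℂ → ℝ) : ℝ := ∫ θ in (0:ℝ)..(2 * Real.pi), φ (bpt θ)

/-- Integral over the open unit disc with respect to Lebesgue measure. -/
def ballInt (φ : ℂ → ℝ) : ℝ := ∫ z in odisc, φ z

/-- Outward normal derivative `∂w/∂ν₀(z) = z·∇w(z)` for `z ∈ ∂B`. -/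
def nder (w : ℂ → ℝ) (z : ℂ) : ℝ := fderivWithin ℝ w cdisc z z

/-- The Euclidean Laplacian, computed with derivatives within the closed disc. -/
def lapW (w : ℂ → ℝ) (z : ℂ) : ℝ :=
  fderivWithin ℝ (fun x => fderivWithin ℝ w cdisc x 1) cdisc z 1 +
  fderivWithin ℝ (fun x => fderivWithin ℝ w cdisc x Complex.I) cdisc z Complex.I

/-- The coefficient `α(t) = 2ρ(t)/∫_B f e^{2u(·,t)} dz`. -/
def alphaC (f : ℂ → ℝ) (u : ℂ → ℝ → ℝ) (ρ : ℝ → ℝ) (t : ℝ) : ℝ :=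
  2 * ρ t / ballInt fun z => f z * Real.exp (2 * u z t)

/-- The coefficient `β(t) = 2(π − ρ(t))/∫_{∂B} j e^{u(·,t)} ds₀`. -/
def betaC (j : ℂ → ℝ) (u : ℂ → ℝ → ℝ) (ρ : ℝ → ℝ) (t : ℝ) : ℝ :=
  2 * (Real.pi - ρ t) / circInt fun z => j z * Real.exp (u z t)

/-- The time domain `[0, T)` (with `T ∈ (0, ∞]`). -/
def flowDom (T : ℝ≥0∞) : Set ℝ := {t : ℝ | 0 ≤ t ∧ ENNReal.ofReal t < T}

/-- `(u, ρ)` is a smooth solution of the prescribed curvature flow on `[0, T)`: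
`∂u/∂t = α f + e^{−2u} Δu` in `B`, `∂u/∂t = β j − e^{−u}(∂u/∂ν₀ + 1)` on `∂B`,
and `dρ/dt = log (β²/α)`, with `u` smooth on `closure B × [0,T)` and `ρ` C¹ with
values in `(0, π)`. -/
def IsFlow (f j : ℂ → ℝ) (T : ℝ≥0∞) (u : ℂ → ℝ → ℝ) (ρ : ℝ → ℝ) : Prop :=
  ContDiffOn ℝ (⊤ : ℕ∞) (fun p : ℂ × ℝ => u p.1 p.2) (cdisc ×ˢ flowDom T) ∧
  ContDiffOn ℝ 1 ρ (flowDom T) ∧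
  (∀ t ∈ flowDom T, ρ t ∈ Set.Ioo 0 Real.pi) ∧
  (∀ t ∈ flowDom T, 0 < t → ∀ z ∈ odisc,
    deriv (u z) t = alphaC f u ρ t * f z + Real.exp (-(2 * u z t)) * lapW (fun w => u w t) z) ∧
  (∀ t ∈ flowDom T, 0 < t → ∀ z ∈ bdry,
    deriv (u z) t = betaC j u ρ t * j z - Real.exp (-(u z t)) * (nder (fun w => u w t) z + 1)) ∧
  (∀ t ∈ flowDom T, 0 < t →
    deriv ρ t = Real.log (betaC j u ρ t ^ 2 / alphaC f u ρ t))

/-- Gauss curvature `K = e^{−2u}(−Δu)` of the evolving metric. -/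
def Kcur (u : ℂ → ℝ → ℝ) (t : ℝ) (z : ℂ) : ℝ :=
  Real.exp (-(2 * u z t)) * (- lapW (fun w => u w t) z)

/-- Boundary geodesic curvature `k = e^{−u}(∂u/∂ν₀ + 1)` of the evolving metric. -/
def kcur (u : ℂ → ℝ → ℝ) (t : ℝ) (z : ℂ) : ℝ :=
  Real.exp (-(u z t)) * (nder (fun w => u w t) z + 1)

/-! ### Polar coordinates and singular kernels -/

theorem continuous_bpt : Continuous bpt := by
  unfold bpt; fun_prop

theorem bpt_eq_cos_sin (θ : ℝ) : bpt θ = Real.cos θ + Real.sin θ * Complex.I := by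
  simp [bpt, Complex.exp_mul_I]

@[simp] theorem norm_bpt (θ : ℝ) : ‖bpt θ‖ = 1 := by
  simp [bpt, Complex.norm_exp_ofReal_mul_I]

theorem bpt_add_two_pi (θ : ℝ) : bpt (θ + 2 * π) = bpt θ := by
  simp [bpt, add_mul, Complex.exp_add, Complex.exp_two_pi_mul_I]

theorem bpt_add (s t : ℝ) : bpt (s + t) = bpt s * bpt t := by
  simp [bpt, add_mul, Complex.exp_add]

theorem bpt_mem_cdisc (θ : ℝ) : bpt θ ∈ cdisc := by simp [cdisc]

theorem bpt_mem_bdry (θ : ℝ) : bpt θ ∈ bdry := by simp [bdry]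

theorem lintegral_Ioc_periodic {h : ℝ → ℝ≥0∞} (hp : Function.Periodic h (2 * π)) (a b : ℝ) :
    ∫⁻ θ in Ioc a (a + 2 * π), h θ = ∫⁻ θ in Ioc b (b + 2 * π), h θ := by
  have : Fact (0 < 2 * π) := ⟨Real.two_pi_pos⟩
  have e : ∀ t : ℝ, ∫⁻ θ in Ioc t (t + 2 * π), h θ = ∫⁻ y : AddCircle (2 * π), hp.lift y := by
    intro t
    rw [← AddCircle.lintegral_preimage (2 * π) t hp.lift]
    rfl
  rw [e a, e b]

theorem lintegral_polar {F : ℂ → ℝ≥0∞} (hF : Measurable F) :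
    ∫⁻ z, F z = ∫⁻ θ in Ioc 0 (2 * π), ∫⁻ r in Ioi (0 : ℝ), ENNReal.ofReal r * F (r * bpt θ) := by
  rw [← Complex.lintegral_comp_polarCoord_symm, polarCoord_target]
  have hm : Measurable (fun p : ℝ × ℝ => ENNReal.ofReal p.1 * F (p.1 * bpt p.2)) := by
    have := continuous_bpt.measurable
    fun_prop
  have h1 : ∀ p : ℝ × ℝ, ENNReal.ofReal p.1 • F (Complex.polarCoord.symm p) =
      ENNReal.ofReal p.1 * F (p.1 * bpt p.2) := by
    intro p; rw [Complex.polarCoord_symm_apply, bpt_eq_cos_sin]; rfl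
  simp_rw [h1]
  rw [Measure.volume_eq_prod, ← Measure.prod_restrict, lintegral_prod_symm _ hm.aemeasurable,
    Measure.restrict_congr_set Ioo_ae_eq_Ioc]
  have h2 := lintegral_Ioc_periodic (h := fun θ => ∫⁻ r in Ioi (0 : ℝ), ENNReal.ofReal r * F (r * bpt θ))
    (fun θ => by simp only [bpt_add_two_pi]) (-π) 0
  rw [show -π + 2 * π = π by ring, zero_add] at h2
  exact h2

theorem lintegral_radial {F : ℝ → ℝ≥0∞} (hF : Measurable F) (x : ℂ) :
    ∫⁻ y, F ‖x - y‖ = ENNReal.ofReal (2 * π) * ∫⁻ r in Ioi (0 : ℝ), ENNReal.ofReal r * F r := by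
  have h1 : ∫⁻ y, F ‖x - y‖ = ∫⁻ y : ℂ, F ‖y‖ :=
    lintegral_sub_left_eq_self (fun y : ℂ => F ‖y‖) x
  rw [h1, lintegral_polar (by fun_prop)]
  have h2 : ∀ θ : ℝ, ∫⁻ r in Ioi (0 : ℝ), ENNReal.ofReal r * F ‖(r : ℂ) * bpt θ‖ =
      ∫⁻ r in Ioi (0 : ℝ), ENNReal.ofReal r * F r := by
    intro θ
    refine setLIntegral_congr_fun measurableSet_Ioi fun r hr => ?_
    have : |r| = r := abs_of_pos hr
    simp [this]
  simp_rw [h2]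
  rw [lintegral_const, mul_comm]
  simp

theorem lintegral_radial_le {F : ℝ → ℝ≥0∞} (hF : Measurable F) (x : ℂ) {s : Set ℂ}
    (hsm : MeasurableSet s) {a b : ℝ} (h : ℝ → ℝ) (hab : a ≤ b)
    (hs : ∀ y ∈ s, ‖x - y‖ ∈ Ioc a b)
    (hh : ∀ r ∈ Ioc a b, ENNReal.ofReal r * F r ≤ ENNReal.ofReal (h r))
    (hi : IntervalIntegrable h volume a b) (h0 : ∀ r ∈ Ioc a b, 0 ≤ h r) :
    ∫⁻ y in s, F ‖x - y‖ ≤ ENNReal.ofReal (2 * π * ∫ r in a..b, h r) := by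
  calc ∫⁻ y in s, F ‖x - y‖ ≤ ∫⁻ y in s, (Ioc a b).indicator F ‖x - y‖ := by
        refine setLIntegral_mono' hsm fun y hy => ?_
        rw [indicator_of_mem (hs y hy)]
    _ ≤ ∫⁻ y, (Ioc a b).indicator F ‖x - y‖ := lintegral_mono' Measure.restrict_le_self le_rfl
    _ = ENNReal.ofReal (2 * π) * ∫⁻ r in Ioi (0 : ℝ), ENNReal.ofReal r * (Ioc a b).indicator F r :=
        lintegral_radial (hF.indicator measurableSet_Ioc) x
    _ ≤ ENNReal.ofReal (2 * π) * ∫⁻ r in Ioc a b, ENNReal.ofReal (h r) := by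
        refine mul_le_mul' le_rfl ?_
        rw [← lintegral_indicator measurableSet_Ioc]
        refine (lintegral_mono' Measure.restrict_le_self fun r => ?_)
        by_cases hr : r ∈ Ioc a b
        · simpa [hr] using hh r hr
        · simp [hr]
    _ = ENNReal.ofReal (2 * π * ∫ r in a..b, h r) := by
        rw [intervalIntegral.integral_of_le hab, ENNReal.ofReal_mul Real.two_pi_pos.le,
          ofReal_integral_eq_lintegral_ofReal]
        · exact (intervalIntegrable_iff_integrableOn_Ioc_of_le hab).1 hi
        · exact (ae_restrict_iff' measurableSet_Ioc).2 (Eventually.of_forall h0)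

/-- The reciprocal distance, with value `∞` on the diagonal. -/
def rdist (x y : ℂ) : ℝ≥0∞ := (ENNReal.ofReal ‖x - y‖)⁻¹

theorem measurable_rdist : Measurable (fun p : ℂ × ℂ => rdist p.1 p.2) := by
  unfold rdist; fun_prop

theorem rdist_comm (x y : ℂ) : rdist x y = rdist y x := by
  unfold rdist; rw [norm_sub_rev]

theorem rdist_rpow_lintegral_le (x : ℂ) {s : Set ℂ} (hsm : MeasurableSet s) {p b : ℝ}
    (hp0 : 0 ≤ p) (hp : p < 2) (hb : 0 ≤ b) (hs : ∀ y ∈ s, ‖x - y‖ ≤ b) :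
    ∫⁻ y in s, rdist x y ^ p ≤ ENNReal.ofReal (2 * π * (b ^ (2 - p) / (2 - p))) := by
  have h1 : ∫⁻ y in s, rdist x y ^ p = ∫⁻ y in s \ {x}, rdist x y ^ p :=
    setLIntegral_congr (sdiff_null_ae_eq_self (by simp)).symm
  have h2 := lintegral_radial_le (F := fun r => (ENNReal.ofReal r)⁻¹ ^ p) (by fun_prop) x
    (hsm.diff (measurableSet_singleton x)) (a := 0) (b := b) (fun r => r ^ (1 - p)) hb ?_ ?_ ?_ ?_
  · rw [h1]
    refine h2.trans (le_of_eq ?_)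
    rw [integral_rpow (Or.inl (by linarith)), Real.zero_rpow (by linarith)]
    ring_nf
  · rintro y ⟨hy, hyx⟩
    refine ⟨?_, hs y hy⟩
    rw [norm_pos_iff, sub_ne_zero]
    exact fun h => hyx (by simp [h])
  · intro r hr
    rw [← ENNReal.ofReal_inv_of_pos hr.1, ENNReal.ofReal_rpow_of_nonneg (by simpa using hr.1.le) hp0,
      ← ENNReal.ofReal_mul hr.1.le, Real.inv_rpow hr.1.le, Real.rpow_sub hr.1, Real.rpow_one,
      div_eq_mul_inv]
  · exact intervalIntegral.intervalIntegrable_rpow' (by linarith)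
  · intro r hr; exact Real.rpow_nonneg hr.1.le _

/-- Arclength on the unit circle as a measure on the plane. -/
def circM : Measure ℂ := Measure.map bpt (volume.restrict (Ioc 0 (2 * π)))

theorem lintegral_circM {F : ℂ → ℝ≥0∞} (hF : Measurable F) :
    ∫⁻ z, F z ∂circM = ∫⁻ θ in Ioc 0 (2 * π), F (bpt θ) :=
  lintegral_map hF continuous_bpt.measurable

theorem abs_sin_le_norm_sub_bpt (x : ℂ) (θ : ℝ) : |Real.sin (θ - x.arg)| ≤ ‖x - bpt θ‖ := by
  have hx := Complex.norm_mul_exp_arg_mul_I x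
  have h1 : ‖x - bpt θ‖ = ‖(‖x‖ : ℂ) - bpt (θ - x.arg)‖ := by
    have : x - bpt θ = bpt x.arg * ((‖x‖ : ℂ) - bpt (θ - x.arg)) := by
      rw [mul_sub, ← bpt_add]
      conv_lhs => rw [← hx]
      unfold bpt
      ring_nf
    rw [this, norm_mul]; simp
  rw [h1]
  refine le_trans (le_of_eq ?_) (Complex.abs_im_le_norm _)
  rw [bpt_eq_cos_sin, Complex.sub_im, Complex.add_im, Complex.mul_im, Complex.ofReal_im,
    Complex.ofReal_im, Complex.ofReal_im, Complex.ofReal_re, Complex.I_im, Complex.I_re]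
  simp

theorem lintegral_inv_abs_rpow_lt_top {p : ℝ} (hp0 : 0 ≤ p) (hp : p < 1) (c a b : ℝ) :
    ∫⁻ θ in Ioc a b, (ENNReal.ofReal |θ - c|)⁻¹ ^ p < ∞ := by
  rcases lt_or_ge b a with hab | hab
  · simp [Ioc_eq_empty (not_lt.2 hab.le)]
  have h1 : IntervalIntegrable (fun θ : ℝ => |θ| ^ (-p)) volume (a - c) (b - c) := by
    refine intervalIntegrable_of_even (fun x => by simp) fun x hx => ?_
    refine (intervalIntegral.intervalIntegrable_rpow' (r := -p) (by linarith)).congr fun y hy => ?_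
    rw [uIoc_of_le hx.le] at hy
    simp [abs_of_pos hy.1]
  have h2 := h1.comp_sub_right c (by finiteness)
  simp only [sub_add_cancel] at h2
  rw [intervalIntegrable_iff_integrableOn_Ioc_of_le hab] at h2
  refine lt_of_le_of_lt (le_of_eq ?_) h2.2
  refine setLIntegral_congr_fun_ae measurableSet_Ioc ?_
  have : ∀ᵐ θ : ℝ, θ ≠ c := by simp [ae_iff]
  filter_upwards [this] with θ hθ _
  have hpos : 0 < |θ - c| := abs_pos.2 (sub_ne_zero.2 hθ)
  rw [← ENNReal.ofReal_inv_of_pos hpos, ENNReal.ofReal_rpow_of_nonneg (by positivity) hp0,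
    Real.enorm_eq_ofReal (by positivity), Real.inv_rpow hpos.le, Real.rpow_neg hpos.le]

theorem exists_mul_abs_sub_le_abs_sin {θ : ℝ} (h0 : 0 ≤ θ) (h2 : θ ≤ 2 * π) :
    2 / π * |θ - 0| ≤ |Real.sin θ| ∨ 2 / π * |θ - π| ≤ |Real.sin θ| ∨
      2 / π * |θ - 2 * π| ≤ |Real.sin θ| := by
  have hpi := Real.pi_pos
  have e1 : |Real.sin (θ - π)| = |Real.sin θ| := by rw [Real.sin_sub_pi, abs_neg]
  have e2 : |Real.sin (θ - 2 * π)| = |Real.sin θ| := by rw [Real.sin_sub_two_pi]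
  have key : ∀ x : ℝ, |x| ≤ π / 2 → 2 / π * |x| ≤ |Real.sin x| := fun x hx =>
    Real.mul_abs_le_abs_sin hx
  rcases le_total θ (π / 2) with h | h
  · left; simpa using key θ (by rw [abs_of_nonneg h0]; exact h)
  rcases le_total θ (3 * π / 2) with h' | h'
  · right; left
    rw [← e1]; exact key _ (by rw [abs_le]; constructor <;> linarith)
  · right; right
    rw [← e2]; exact key _ (by rw [abs_le]; constructor <;> linarith)

theorem exists_rdist_rpow_circM_le {p : ℝ} (hp0 : 0 ≤ p) (hp : p < 1) :
    ∃ C : ℝ, 0 ≤ C ∧ ∀ x, ∫⁻ y, rdist x y ^ p ∂circM ≤ ENNReal.ofReal C := by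
  set h : ℝ → ℝ≥0∞ := fun θ => (ENNReal.ofReal |Real.sin θ|)⁻¹ ^ p with hh
  have hper : Function.Periodic h (2 * π) := fun θ => by simp [hh]
  have hfin : ∫⁻ θ in Ioc 0 (2 * π), h θ < ∞ := by
    set k : ℝ → ℝ → ℝ≥0∞ := fun c θ => (ENNReal.ofReal (2 / π))⁻¹ ^ p *
      (ENNReal.ofReal |θ - c|)⁻¹ ^ p with hk
    have hkm : ∀ c, Measurable (k c) := fun c => by simp only [hk]; fun_prop
    have hc : 0 < 2 / π := by positivity
    have hkey : ∀ c θ, 2 / π * |θ - c| ≤ |Real.sin θ| → h θ ≤ k c θ := by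
      intro c θ hle
      simp only [hh, hk]
      rw [← ENNReal.mul_rpow_of_nonneg _ _ hp0, ← ENNReal.mul_inv (by simp) (by simp),
        ← ENNReal.ofReal_mul hc.le]
      gcongr
    have hkf : ∀ c, ∫⁻ θ in Ioc 0 (2 * π), k c θ < ∞ := by
      intro c
      simp only [hk]
      rw [lintegral_const_mul _ (by fun_prop)]
      refine ENNReal.mul_lt_top (ENNReal.rpow_lt_top_of_nonneg hp0 ?_) ?_
      · simpa using hc
      · exact lintegral_inv_abs_rpow_lt_top hp0 hp c _ _
    calc ∫⁻ θ in Ioc 0 (2 * π), h θ ≤ ∫⁻ θ in Ioc 0 (2 * π), (k 0 θ + k π θ + k (2 * π) θ) := by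
          refine setLIntegral_mono' measurableSet_Ioc fun θ hθ => ?_
          rcases exists_mul_abs_sub_le_abs_sin hθ.1.le hθ.2 with h1 | h1 | h1
          · exact (hkey _ _ h1).trans (le_trans le_self_add le_self_add)
          · exact (hkey _ _ h1).trans (le_trans le_add_self le_self_add)
          · exact (hkey _ _ h1).trans le_add_self
      _ < ∞ := by
          rw [lintegral_add_right _ (hkm _), lintegral_add_right _ (hkm _)]
          exact ENNReal.add_lt_top.2 ⟨ENNReal.add_lt_top.2 ⟨hkf _, hkf _⟩, hkf _⟩
  refine ⟨(∫⁻ θ in Ioc 0 (2 * π), h θ).toReal, ENNReal.toReal_nonneg, fun x => ?_⟩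
  rw [ENNReal.ofReal_toReal hfin.ne]
  have hm : Measurable (fun y => rdist x y ^ p) := by unfold rdist; fun_prop
  rw [lintegral_circM hm]
  have hle : ∀ θ, rdist x (bpt θ) ^ p ≤ h (θ - x.arg) := by
    intro θ
    unfold rdist
    simp only [hh]
    gcongr
    exact abs_sin_le_norm_sub_bpt x θ
  refine (lintegral_mono hle).trans ?_
  have e1 : ∫⁻ θ in Ioc 0 (2 * π), h (θ - x.arg) = ∫⁻ θ in Ioc 0 (2 * π), h θ := by
    have := lintegral_Ioc_periodic hper (-x.arg) 0
    rw [zero_add] at this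
    rw [← this]
    have hmp := measurePreserving_sub_right (volume : Measure ℝ) x.arg
    have h3 := hmp.setLIntegral_comp_preimage_emb (MeasurableEquiv.subRight x.arg).measurableEmbedding h
      (Ioc (-x.arg) (-x.arg + 2 * π))
    rw [← h3]
    congr 2
    ext θ; simp only [mem_Ioc, mem_preimage]
    constructor <;> rintro ⟨a, b⟩ <;> constructor <;> linarith
  rw [e1]

theorem lintegral_far_le {x : ℂ} (hx : x ∈ cdisc) {r : ℝ} (hr : 0 < r) (hr5 : r ≤ 5) :
    ∫⁻ y in ball 0 4 ∩ {y | r < ‖x - y‖}, ENNReal.ofReal (1 / (2 * ‖x - y‖ ^ 2)) ≤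
      ENNReal.ofReal (π * Real.log (5 / r)) := by
  have hx1 : ‖x‖ ≤ 1 := by simpa [cdisc] using hx
  have hm : MeasurableSet (ball (0 : ℂ) 4 ∩ {y | r < ‖x - y‖}) :=
    measurableSet_ball.inter (measurableSet_lt (by fun_prop) (by fun_prop))
  have h := lintegral_radial_le (F := fun t => ENNReal.ofReal (1 / (2 * t ^ 2))) (by fun_prop) x hm
    (fun t => (1 / 2) * t⁻¹) hr5 ?_ ?_ ?_ ?_
  · refine h.trans (le_of_eq ?_)
    rw [intervalIntegral.integral_const_mul, integral_inv_of_pos hr (by norm_num)]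
    ring_nf
  · rintro y ⟨hy, hry⟩
    refine ⟨hry, ?_⟩
    have h4 : ‖y‖ < 4 := by simpa using hy
    linarith [norm_sub_le x y]
  · intro t ht
    have : 0 < t := hr.trans ht.1
    rw [← ENNReal.ofReal_mul this.le]
    refine le_of_eq (congrArg _ ?_)
    field_simp
  · refine ContinuousOn.intervalIntegrable ?_
    rw [uIcc_of_le hr5]
    exact continuousOn_const.mul (continuousOn_inv₀.mono fun t ht => (hr.trans_le ht.1).ne')
  · intro t ht
    have : 0 < t := hr.trans ht.1
    positivity

theorem lintegral_near_le (x : ℂ) {r : ℝ} (hr : 0 < r) :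
    ∫⁻ y in closedBall x (2 * r), rdist x y ≤ ENNReal.ofReal (4 * π * r) := by
  have h := rdist_rpow_lintegral_le x (s := closedBall x (2 * r)) measurableSet_closedBall
    (p := 1) (b := 2 * r) zero_le_one one_lt_two (by positivity)
    (fun y hy => by rwa [mem_closedBall, dist_comm, dist_eq_norm] at hy)
  simp only [ENNReal.rpow_one] at h
  refine h.trans (le_of_eq (congrArg _ ?_))
  norm_num
  ring

theorem rdist_eq_ofReal {x y : ℂ} (h : x ≠ y) : rdist x y = ENNReal.ofReal ‖x - y‖⁻¹ := by
  rw [rdist, ENNReal.ofReal_inv_of_pos (norm_pos_iff.2 (sub_ne_zero.2 h))]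

theorem rdist_le_ofReal {x y : ℂ} {r : ℝ} (hr : 0 < r) (h : r ≤ ‖x - y‖) :
    rdist x y ≤ ENNReal.ofReal r⁻¹ := by
  rw [rdist, ENNReal.ofReal_inv_of_pos hr]
  gcongr

/-- The kernel estimate behind the logarithmic energy: the convolution of two reciprocal
distances is at most `2π log (5 / |x - x'|) + 16π`. -/
theorem lintegral_rdist_mul_rdist_le {x x' : ℂ} (hx : x ∈ cdisc) (hx' : x' ∈ cdisc) (hne : x ≠ x') :
    ∫⁻ y in ball 0 4, rdist x y * rdist x' y ≤
      ENNReal.ofReal (2 * π * Real.log (5 / ‖x - x'‖) + 16 * π) := by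
  set r := ‖x - x'‖ with hrdef
  have hr : 0 < r := norm_pos_iff.2 (sub_ne_zero.2 hne)
  have hr2 : r ≤ 2 := by
    have h1 : ‖x‖ ≤ 1 := by simpa [cdisc] using hx
    have h2 : ‖x'‖ ≤ 1 := by simpa [cdisc] using hx'
    linarith [norm_sub_le x x']
  set far : ℂ → ℂ → ℝ≥0∞ := fun x => (ball 0 4 ∩ {y | r < ‖x - y‖}).indicator
    fun y => ENNReal.ofReal (1 / (2 * ‖x - y‖ ^ 2)) with hfar
  set near : ℂ → ℂ → ℝ≥0∞ := fun x => (closedBall x (2 * r)).indicator fun y => rdist x y with hnear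
  have hms : ∀ x : ℂ, MeasurableSet (ball (0 : ℂ) 4 ∩ {y | r < ‖x - y‖}) := fun x =>
    measurableSet_ball.inter (measurableSet_lt (by fun_prop) (by fun_prop))
  have hmf : ∀ x, Measurable (far x) := fun x => Measurable.indicator (by fun_prop) (hms x)
  have hmn : ∀ x, Measurable (near x) := fun x =>
    Measurable.indicator (by unfold rdist; fun_prop) measurableSet_closedBall
  have htri : ∀ y, r ≤ ‖x - y‖ + ‖x' - y‖ := by
    intro y
    have := norm_sub_le (x - y) (x' - y)
    rwa [sub_sub_sub_cancel_right] at this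
  have hpt : ∀ y ∈ ball (0 : ℂ) 4, rdist x y * rdist x' y ≤
      far x y + far x' y + ENNReal.ofReal (2 / r) * (near x y + near x' y) := by
    intro y hy
    have ht := htri y
    have ht1 : ‖x - y‖ ≤ r + ‖x' - y‖ := by
      have := norm_add_le (x - x') (x' - y); rwa [sub_add_sub_cancel] at this
    have ht2 : ‖x' - y‖ ≤ r + ‖x - y‖ := by
      have := norm_add_le (x' - x) (x - y)
      rwa [sub_add_sub_cancel, norm_sub_rev x' x] at this
    by_cases hc : r < ‖x - y‖ ∧ r < ‖x' - y‖
    · refine le_trans ?_ le_self_add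
      have ha := hr.trans hc.1
      have hb := hr.trans hc.2
      have e1 : far x y = ENNReal.ofReal (1 / (2 * ‖x - y‖ ^ 2)) := indicator_of_mem (show y ∈ ball (0 : ℂ) 4 ∩ {y | r < ‖x - y‖} from ⟨hy, hc.1⟩) _
      have e2 : far x' y = ENNReal.ofReal (1 / (2 * ‖x' - y‖ ^ 2)) := indicator_of_mem (show y ∈ ball (0 : ℂ) 4 ∩ {y | r < ‖x' - y‖} from ⟨hy, hc.2⟩) _
      rw [e1, e2, rdist, rdist, ← ENNReal.ofReal_inv_of_pos ha, ← ENNReal.ofReal_inv_of_pos hb,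
        ← ENNReal.ofReal_mul (by positivity), ← ENNReal.ofReal_add (by positivity) (by positivity)]
      refine ENNReal.ofReal_le_ofReal ?_
      have h3 := sq_nonneg (‖x - y‖⁻¹ - ‖x' - y‖⁻¹)
      have h4 : 1 / (2 * ‖x - y‖ ^ 2) = (‖x - y‖⁻¹) ^ 2 / 2 := by field_simp
      have h5 : 1 / (2 * ‖x' - y‖ ^ 2) = (‖x' - y‖⁻¹) ^ 2 / 2 := by field_simp
      rw [h4, h5]; nlinarith
    · refine le_trans ?_ le_add_self
      have hle : ‖x - y‖ ≤ 2 * r ∧ ‖x' - y‖ ≤ 2 * r := by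
        rcases not_and_or.1 hc with h | h <;> rw [not_lt] at h <;> constructor <;> linarith
      have e1 : near x y = rdist x y := indicator_of_mem (by
        rw [mem_closedBall, dist_comm, dist_eq_norm]; exact hle.1) _
      have e2 : near x' y = rdist x' y := indicator_of_mem (by
        rw [mem_closedBall, dist_comm, dist_eq_norm]; exact hle.2) _
      rw [e1, e2, mul_add]
      have h2r : 2 / r = (r / 2)⁻¹ := by rw [inv_div]
      rcases le_total (r / 2) ‖x - y‖ with h | h
      · refine le_trans ?_ le_add_self
        refine mul_le_mul' ?_ le_rfl
        rw [h2r]; exact rdist_le_ofReal (by positivity) h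
      · refine le_trans ?_ le_self_add
        rw [mul_comm]
        refine mul_le_mul' ?_ le_rfl
        rw [h2r]; exact rdist_le_ofReal (by positivity) (by linarith)
  have hF : ∀ x ∈ cdisc, ∫⁻ y, far x y ≤ ENNReal.ofReal (π * Real.log (5 / r)) := fun x hx => by
    rw [lintegral_indicator (hms x)]
    exact lintegral_far_le hx hr (by linarith)
  have hN : ∀ x, ∫⁻ y, near x y ≤ ENNReal.ofReal (4 * π * r) := fun x => by
    rw [lintegral_indicator measurableSet_closedBall]
    exact lintegral_near_le x hr
  have hlog : 0 ≤ Real.log (5 / r) := Real.log_nonneg (by rw [le_div_iff₀ hr]; linarith)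
  calc ∫⁻ y in ball 0 4, rdist x y * rdist x' y
      ≤ ∫⁻ y in ball 0 4, (far x y + far x' y + ENNReal.ofReal (2 / r) * (near x y + near x' y)) :=
        setLIntegral_mono' measurableSet_ball hpt
    _ ≤ ∫⁻ y, (far x y + far x' y + ENNReal.ofReal (2 / r) * (near x y + near x' y)) :=
        lintegral_mono' Measure.restrict_le_self le_rfl
    _ = (∫⁻ y, far x y) + (∫⁻ y, far x' y) +
        ENNReal.ofReal (2 / r) * ((∫⁻ y, near x y) + ∫⁻ y, near x' y) := by
        have := hmf x
        have := hmf x'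
        have := hmn x
        have := hmn x'
        rw [lintegral_add_left (by fun_prop), lintegral_add_left (by fun_prop),
          lintegral_const_mul _ (by fun_prop), lintegral_add_left (by fun_prop)]
    _ ≤ ENNReal.ofReal (π * Real.log (5 / r)) + ENNReal.ofReal (π * Real.log (5 / r)) +
        ENNReal.ofReal (2 / r) * (ENNReal.ofReal (4 * π * r) + ENNReal.ofReal (4 * π * r)) := by
        refine add_le_add (add_le_add (hF x hx) (hF x' hx')) (mul_le_mul' le_rfl (add_le_add (hN x) (hN x')))
    _ = ENNReal.ofReal (2 * π * Real.log (5 / ‖x - x'‖) + 16 * π) := by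
        rw [← ENNReal.ofReal_add (by positivity) (by positivity),
          ← ENNReal.ofReal_add (by positivity) (by positivity), ← ENNReal.ofReal_mul (by positivity),
          ← ENNReal.ofReal_add (by positivity) (by positivity)]
        congr 1
        field_simp
        ring

section

/-! ### Reflection across the unit circle and the integral representation -/

/-- The squared Euclidean length of a covector on the plane. -/
def gsq (L : ℂ →L[ℝ] ℝ) : ℝ := L 1 ^ 2 + L Complex.I ^ 2

theorem gsq_nonneg (L : ℂ →L[ℝ] ℝ) : 0 ≤ gsq L := by unfold gsq; positivity

theorem clm_apply_eq (L : ℂ →L[ℝ] ℝ) (h : ℂ) : L h = h.re * L 1 + h.im * L Complex.I := by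
  conv_lhs => rw [show h = h.re • (1 : ℂ) + h.im • Complex.I by
    simp [Complex.re_add_im]]
  simp only [map_add, map_smul, smul_eq_mul]

theorem continuous_gsq : Continuous gsq := by unfold gsq; fun_prop

theorem abs_clm_apply_le (L : ℂ →L[ℝ] ℝ) (h : ℂ) : |L h| ≤ √(gsq L) * ‖h‖ := by
  rw [← Real.sqrt_sq (norm_nonneg h), ← Real.sqrt_mul (gsq_nonneg L)]
  apply Real.abs_le_sqrt
  rw [clm_apply_eq L h, Complex.sq_norm, Complex.normSq_apply, gsq]
  nlinarith [sq_nonneg (h.re * L Complex.I - h.im * L 1)]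

/-- The length of the gradient, computed within the closed disc. -/
def gradN (u : ℂ → ℝ) (z : ℂ) : ℝ := √(gsq (fderivWithin ℝ u cdisc z))

/-- The Dirichlet integral over the disc. -/
def dirich (u : ℂ → ℝ) : ℝ := ballInt fun z => gsq (fderivWithin ℝ u cdisc z)

theorem dirich_nonneg (u : ℂ → ℝ) : 0 ≤ dirich u :=
  integral_nonneg fun _ => gsq_nonneg _

/-- The mean value over the unit circle. -/
def cmean (u : ℂ → ℝ) : ℝ := circInt u / (2 * π)

/-- The map that fixes the closed disc and inverts its exterior. -/
def crefl (y : ℂ) : ℂ := (max 1 (‖y‖ ^ 2))⁻¹ • y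

theorem continuous_crefl : Continuous crefl := by
  unfold crefl
  have h : Continuous fun y : ℂ => max 1 (‖y‖ ^ 2) := by fun_prop
  exact (h.inv₀ fun y => by positivity).smul continuous_id

theorem crefl_of_mem {y : ℂ} (h : y ∈ cdisc) : crefl y = y := by
  have h1 : ‖y‖ ≤ 1 := by simpa [cdisc] using h
  have : max 1 (‖y‖ ^ 2) = 1 := max_eq_left (by nlinarith [norm_nonneg y])
  simp [crefl, this]

theorem norm_crefl (y : ℂ) : ‖crefl y‖ = (max 1 (‖y‖ ^ 2))⁻¹ * ‖y‖ := by
  rw [crefl, norm_smul, Real.norm_of_nonneg (by positivity)]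

theorem crefl_mem (y : ℂ) : crefl y ∈ cdisc := by
  rw [cdisc, mem_closedBall_zero_iff, norm_crefl, inv_mul_le_iff₀ (by positivity), mul_one]
  rcases le_total ‖y‖ 1 with h | h
  · exact h.trans (le_max_left _ _)
  · exact le_trans (by nlinarith) (le_max_right _ _)

theorem crefl_of_one_lt {y : ℂ} (h : 1 < ‖y‖) : crefl y = ((starRingEnd ℂ) y)⁻¹ := by
  have h1 : max 1 (‖y‖ ^ 2) = ‖y‖ ^ 2 := max_eq_right (by nlinarith)
  have hy : y ≠ 0 := by rintro rfl; simp at h; linarith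
  rw [crefl, h1, Complex.inv_def, Complex.normSq_conj, Complex.conj_conj, Complex.normSq_eq_norm_sq,
    Complex.real_smul, mul_comm]

theorem cdisc_mem_nhds {z : ℂ} (hz : ‖z‖ < 1) : cdisc ∈ 𝓝 z :=
  Filter.mem_of_superset (isOpen_ball.mem_nhds (by simpa using hz : z ∈ ball (0 : ℂ) 1))
    ball_subset_closedBall

theorem uniqueDiffOn_cdisc : UniqueDiffOn ℝ cdisc :=
  uniqueDiffOn_convex (convex_closedBall 0 1) (by
    rw [cdisc, interior_closedBall _ one_ne_zero]; exact ⟨0, by simp⟩)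

theorem isCompact_cdisc : IsCompact cdisc := isCompact_closedBall 0 1

theorem odisc_subset_cdisc : odisc ⊆ cdisc := ball_subset_closedBall

/-- The length of the gradient of the reflected function. -/
def gext (u : ℂ → ℝ) (y : ℂ) : ℝ := (max 1 (‖y‖ ^ 2))⁻¹ * gradN u (crefl y)

theorem gext_nonneg (u : ℂ → ℝ) (y : ℂ) : 0 ≤ gext u y := by unfold gext gradN; positivity

variable {u : ℂ → ℝ}

theorem continuousOn_fderivWithin_cdisc (hu : ContDiffOn ℝ 1 u cdisc) :
    ContinuousOn (fderivWithin ℝ u cdisc) cdisc :=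
  hu.continuousOn_fderivWithin uniqueDiffOn_cdisc le_rfl

theorem continuousOn_gradN (hu : ContDiffOn ℝ 1 u cdisc) : ContinuousOn (gradN u) cdisc :=
  (continuous_gsq.comp_continuousOn (continuousOn_fderivWithin_cdisc hu)).sqrt

theorem continuous_gext (hu : ContDiffOn ℝ 1 u cdisc) : Continuous (gext u) := by
  unfold gext
  refine Continuous.mul (Continuous.inv₀ (by fun_prop) fun y => by positivity) ?_
  exact (continuousOn_gradN hu).comp_continuous continuous_crefl crefl_mem

theorem continuous_comp_crefl {w : ℂ → ℝ} (hu : ContinuousOn w cdisc) : Continuous (w ∘ crefl) :=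
  hu.comp_continuous continuous_crefl crefl_mem

theorem hasFDerivAt_of_norm_lt (hu : ContDiffOn ℝ 1 u cdisc) {z : ℂ} (hz : ‖z‖ < 1) :
    HasFDerivAt u (fderivWithin ℝ u cdisc z) z :=
  ((hu.differentiableOn one_ne_zero z (mem_of_mem_nhds (cdisc_mem_nhds hz))).hasFDerivWithinAt).hasFDerivAt
    (cdisc_mem_nhds hz)

theorem exists_hasDerivAt_reflected (hu : ContDiffOn ℝ 1 u cdisc) {γ : ℝ → ℂ} {e : ℂ} {t : ℝ}
    (hγ : HasDerivAt γ e t) (h1 : ‖γ t‖ ≠ 1) :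
    ∃ d, HasDerivAt (fun s => u (crefl (γ s))) d t ∧ |d| ≤ gext u (γ t) * ‖e‖ := by
  have hcont : ContinuousAt (fun s => ‖γ s‖) t := hγ.continuousAt.norm
  rcases lt_or_gt_of_ne h1 with h | h
  · have hev : (fun s => u (crefl (γ s))) =ᶠ[𝓝 t] fun s => u (γ s) := by
      filter_upwards [hcont.eventually_lt continuousAt_const h] with s hs
      rw [crefl_of_mem (by simpa [cdisc] using hs.le)]
    refine ⟨fderivWithin ℝ u cdisc (γ t) e, ?_, ?_⟩
    · exact ((hasFDerivAt_of_norm_lt hu h).comp_hasDerivAt t hγ).congr_of_eventuallyEq hev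
    · refine (abs_clm_apply_le _ _).trans (le_of_eq ?_)
      rw [gext, crefl_of_mem (by simpa [cdisc] using h.le), gradN,
        max_eq_left (by nlinarith [norm_nonneg (γ t)]), inv_one, one_mul]
  · have hne : γ t ≠ 0 := by intro h0; rw [h0] at h; simp at h; linarith
    have hcne : (starRingEnd ℂ) (γ t) ≠ 0 := by simpa using hne
    have hev : (fun s => u (crefl (γ s))) =ᶠ[𝓝 t] fun s => u (((starRingEnd ℂ) (γ s))⁻¹) := by
      filter_upwards [continuousAt_const.eventually_lt hcont h] with s hs
      rw [crefl_of_one_lt hs]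
    have hd : HasDerivAt (fun s => ((starRingEnd ℂ) (γ s))⁻¹)
        (-(starRingEnd ℂ) e / (starRingEnd ℂ) (γ t) ^ 2) t := by
      have hc : HasDerivAt (fun s => (starRingEnd ℂ) (γ s)) ((starRingEnd ℂ) e) t :=
        (Complex.conjCLE.toContinuousLinearMap.hasFDerivAt.comp_hasDerivAt t hγ)
      exact hc.fun_inv hcne
    have hn : ‖((starRingEnd ℂ) (γ t))⁻¹‖ < 1 := by
      rw [norm_inv, Complex.norm_conj]; exact inv_lt_one_of_one_lt₀ h
    refine ⟨_, ((hasFDerivAt_of_norm_lt hu hn).comp_hasDerivAt t hd).congr_of_eventuallyEq hev, ?_⟩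
    refine (abs_clm_apply_le _ _).trans (le_of_eq ?_)
    rw [gext, crefl_of_one_lt h, gradN, max_eq_right (by nlinarith), norm_div, norm_neg, norm_pow,
      Complex.norm_conj, Complex.norm_conj]
    ring

theorem abs_sub_le_integral_of_hasDerivAt_off_countable {f k : ℝ → ℝ} {a b : ℝ} (hab : a ≤ b)
    (hf : Continuous f) (hk : Continuous k) {S : Set ℝ} (hS : S.Countable)
    (hd : ∀ t ∈ Ioo a b \ S, ∃ d, HasDerivAt f d t ∧ |d| ≤ k t) :
    ENNReal.ofReal |f b - f a| ≤ ∫⁻ t in Ioo a b, ENNReal.ofReal (k t) := by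
  have hderiv : ∀ t ∈ Ioo a b \ S, HasDerivAt f (deriv f t) t ∧ |deriv f t| ≤ k t := by
    intro t ht
    obtain ⟨d, h1, h2⟩ := hd t ht
    rw [h1.deriv]; exact ⟨h1, h2⟩
  have hae : ∀ᵐ t ∂(volume.restrict (Ioc a b)), |deriv f t| ≤ k t := by
    rw [← Measure.restrict_congr_set Ioo_ae_eq_Ioc, ae_restrict_iff' measurableSet_Ioo]
    filter_upwards [hS.ae_notMem volume] with t ht1 ht2
    exact (hderiv t ⟨ht2, ht1⟩).2
  have h_int : IntervalIntegrable (deriv f) volume a b := by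
    rw [intervalIntegrable_iff_integrableOn_Ioc_of_le hab]
    exact Integrable.mono' ((hk.intervalIntegrable a b).1) (measurable_deriv f).aestronglyMeasurable hae
  have h := integral_eq_of_hasDerivAt_off_countable (f := f) (f' := deriv f) (a := a) (b := b) hS
    hf.continuousOn (by
      rw [min_eq_left hab, max_eq_right hab]
      exact fun t ht => (hderiv t ht).1) h_int
  rw [← h, intervalIntegral.integral_of_le hab, Measure.restrict_congr_set Ioo_ae_eq_Ioc,
    ← Real.enorm_eq_ofReal_abs]
  refine (enorm_integral_le_lintegral_enorm _).trans (lintegral_mono_ae ?_)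
  filter_upwards [hae] with t ht
  rw [Real.enorm_eq_ofReal_abs]
  exact ENNReal.ofReal_le_ofReal ht

theorem countable_norm_add_smul_eq_one (x : ℂ) (θ : ℝ) :
    {t : ℝ | ‖x + t * bpt θ‖ = 1}.Countable := by
  set p := x.re * (bpt θ).re + x.im * (bpt θ).im with hp
  set q := Complex.normSq x - 1 with hq
  have hb : (bpt θ).re ^ 2 + (bpt θ).im ^ 2 = 1 := by
    have := Complex.sq_norm (bpt θ)
    rw [norm_bpt, Complex.normSq_apply] at this; nlinarith
  refine Set.Countable.mono (s₂ := {-p + √(p ^ 2 - q), -p - √(p ^ 2 - q)}) ?_ (by simp)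
  intro t ht
  have h1 : ‖x + t * bpt θ‖ ^ 2 = 1 := by rw [show ‖x + t * bpt θ‖ = 1 from ht]; norm_num
  rw [Complex.sq_norm, Complex.normSq_apply] at h1
  simp only [Complex.add_re, Complex.add_im, Complex.mul_re, Complex.mul_im, Complex.ofReal_re,
    Complex.ofReal_im, zero_mul, sub_zero, add_zero] at h1
  have h2 : (t + p) ^ 2 = p ^ 2 - q := by
    rw [hq, Complex.normSq_apply, hp]; linear_combination h1 - t ^ 2 * hb
  have h3 : √(p ^ 2 - q) = |t + p| := by rw [← h2, Real.sqrt_sq_eq_abs]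
  rw [mem_insert_iff, mem_singleton_iff, h3]
  rcases abs_cases (t + p) with ⟨h, _⟩ | ⟨h, _⟩ <;> rw [h]
  · left; ring
  · right; ring

/-- The gradient length of the reflected function as an extended nonnegative number. -/
def gE (u : ℂ → ℝ) (y : ℂ) : ℝ≥0∞ := ENNReal.ofReal (gext u y)

theorem measurable_gE (hu : ContDiffOn ℝ 1 u cdisc) : Measurable (gE u) :=
  (continuous_gext hu).measurable.ennreal_ofReal

theorem abs_sub_bpt_le (hu : ContDiffOn ℝ 1 u cdisc) {x : ℂ} (hx : x ∈ cdisc) (θ : ℝ) {R : ℝ}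
    (hR : R ∈ Ioo (2 : ℝ) 3) :
    ENNReal.ofReal |u x - u (bpt θ)| ≤
      (∫⁻ r in Ioo (0 : ℝ) 3, gE u (x + r * bpt θ)) +
      (∫⁻ s in Ioo (0 : ℝ) 1, gE u (s * x + R * bpt θ)) +
      ∫⁻ r in Ioo (1 : ℝ) 3, gE u (r * bpt θ) := by
  have hx1 : ‖x‖ ≤ 1 := by simpa [cdisc] using hx
  have hc := continuous_comp_crefl hu.continuousOn
  have hg := continuous_gext hu
  have hray : ∀ (c : ℂ) (t : ℝ), HasDerivAt (fun t : ℝ => c + t * bpt θ) (bpt θ) t := by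
    intro c t
    have := ((Complex.ofRealCLM.hasDerivAt (x := t)).mul_const (bpt θ)).const_add c
    simpa using this
  set v : ℂ → ℝ := u ∘ crefl with hv
  have e1 : ENNReal.ofReal |v (x + R * bpt θ) - v x| ≤ ∫⁻ r in Ioo (0 : ℝ) 3, gE u (x + r * bpt θ) := by
    have := abs_sub_le_integral_of_hasDerivAt_off_countable (f := fun t : ℝ => v (x + t * bpt θ))
      (k := fun t : ℝ => gext u (x + t * bpt θ)) (a := 0) (b := R) (by linarith [hR.1])
      (by fun_prop) (by fun_prop) (countable_norm_add_smul_eq_one x θ) (fun t ht => by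
        obtain ⟨d, h1, h2⟩ := exists_hasDerivAt_reflected hu (hray x t) ht.2
        exact ⟨d, h1, by simpa using h2⟩)
    simp only [Complex.ofReal_zero, zero_mul, add_zero] at this
    refine this.trans (lintegral_mono_set (Ioo_subset_Ioo le_rfl hR.2.le))
  have e2 : ENNReal.ofReal |v (x + R * bpt θ) - v (R * bpt θ)| ≤
      ∫⁻ s in Ioo (0 : ℝ) 1, gE u (s * x + R * bpt θ) := by
    have := abs_sub_le_integral_of_hasDerivAt_off_countable
      (f := fun s : ℝ => v (s * x + R * bpt θ))
      (k := fun s : ℝ => gext u (s * x + R * bpt θ)) (a := 0) (b := 1) zero_le_one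
      (by fun_prop) (by fun_prop) (S := ∅) (by simp) (fun t ht => by
        have hd : HasDerivAt (fun s : ℝ => (s : ℂ) * x + R * bpt θ) x t := by
          have := ((Complex.ofRealCLM.hasDerivAt (x := t)).mul_const x).add_const (R * bpt θ)
          simpa using this
        have ht' := ht.1
        have hnorm : 1 < ‖(t : ℂ) * x + R * bpt θ‖ := by
          have h1 := norm_sub_norm_le (R * bpt θ) (-((t : ℂ) * x))
          have h2 : ‖-((t : ℂ) * x)‖ ≤ 1 := by
            rw [norm_neg, norm_mul, Complex.norm_real, Real.norm_of_nonneg ht'.1.le]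
            nlinarith [ht'.2, ht'.1, norm_nonneg x]
          have h3 : ‖(R : ℂ) * bpt θ‖ = R := by
            rw [norm_mul, norm_bpt, mul_one, Complex.norm_real, Real.norm_of_nonneg (by linarith [hR.1])]
          rw [h3, sub_neg_eq_add, add_comm (R * bpt θ)] at h1
          linarith [hR.1]
        obtain ⟨d, h1, h2⟩ := exists_hasDerivAt_reflected hu hd hnorm.ne'
        refine ⟨d, h1, h2.trans ?_⟩
        exact mul_le_of_le_one_right (gext_nonneg _ _) hx1)
    simpa [gE] using this
  have e3 : ENNReal.ofReal |v (R * bpt θ) - v (bpt θ)| ≤ ∫⁻ r in Ioo (1 : ℝ) 3, gE u (r * bpt θ) := by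
    have := abs_sub_le_integral_of_hasDerivAt_off_countable (f := fun t : ℝ => v (0 + t * bpt θ))
      (k := fun t : ℝ => gext u (0 + t * bpt θ)) (a := 1) (b := R) (by linarith [hR.1])
      (by fun_prop) (by fun_prop) (countable_norm_add_smul_eq_one 0 θ) (fun t ht => by
        obtain ⟨d, h1, h2⟩ := exists_hasDerivAt_reflected hu (hray 0 t) ht.2
        exact ⟨d, h1, by simpa using h2⟩)
    simp only [Complex.ofReal_one, one_mul, zero_add] at this
    refine this.trans (lintegral_mono_set (Ioo_subset_Ioo le_rfl hR.2.le))
  have hvx : v x = u x := by simp [hv, crefl_of_mem hx]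
  have hvb : v (bpt θ) = u (bpt θ) := by simp [hv, crefl_of_mem (bpt_mem_cdisc θ)]
  rw [← hvx, ← hvb]
  refine le_trans ?_ (add_le_add (add_le_add e1 e2) e3)
  rw [← ENNReal.ofReal_add (by positivity) (by positivity),
    ← ENNReal.ofReal_add (by positivity) (by positivity)]
  refine ENNReal.ofReal_le_ofReal ?_
  have h1 := abs_sub_le (v x) (v (x + R * bpt θ)) (v (bpt θ))
  have h2 := abs_sub_le (v (x + R * bpt θ)) (v (R * bpt θ)) (v (bpt θ))
  rw [abs_sub_comm (v x) (v (x + R * bpt θ))] at h1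
  linarith

theorem lintegral_polar_le {F : ℂ → ℝ≥0∞} (hF : Measurable F) {H : ℝ → ℝ → ℝ≥0∞} {a b : ℝ}
    (ha : 0 ≤ a) (h : ∀ θ, ∀ r ∈ Ioo a b, H θ r ≤ ENNReal.ofReal r * F (r * bpt θ)) :
    ∫⁻ θ in Ioc 0 (2 * π), ∫⁻ r in Ioo a b, H θ r ≤ ∫⁻ z, F z := by
  rw [lintegral_polar hF]
  refine lintegral_mono fun θ => ?_
  refine (setLIntegral_mono' measurableSet_Ioo (h θ)).trans ?_
  exact lintegral_mono_set fun r hr => ha.trans_lt hr.1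

/-- The annulus `1 < |y| < 4`. -/
def annul : Set ℂ := {y | 1 < ‖y‖ ∧ ‖y‖ < 4}

theorem measurableSet_annul : MeasurableSet annul :=
  (measurableSet_lt measurable_const measurable_norm).inter
    (measurableSet_lt measurable_norm measurable_const)

/-- The integral representation with the sharp constant. -/
theorem abs_sub_cmean_le (hu : ContDiffOn ℝ 1 u cdisc) {x : ℂ} (hx : x ∈ cdisc) :
    ENNReal.ofReal (2 * π * |u x - cmean u|) ≤
      (∫⁻ y in ball 0 4, gE u y * rdist x y) + 2 * ∫⁻ y in annul, gE u y := by
  have hx1 : ‖x‖ ≤ 1 := by simpa [cdisc] using hx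
  have hub : Continuous fun θ => u (bpt θ) :=
    hu.continuousOn.comp_continuous continuous_bpt bpt_mem_cdisc
  have hgm := measurable_gE hu
  have hbm := continuous_bpt.measurable
  have h0 : ENNReal.ofReal (2 * π * |u x - cmean u|) ≤
      ∫⁻ θ in Ioc 0 (2 * π), ENNReal.ofReal |u x - u (bpt θ)| := by
    have : 2 * π * (u x - cmean u) = ∫ θ in (0 : ℝ)..(2 * π), (u x - u (bpt θ)) := by
      rw [intervalIntegral.integral_sub (by simp) (hub.intervalIntegrable _ _),
        intervalIntegral.integral_const, cmean, circInt, smul_eq_mul]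
      field_simp
      ring
    rw [← abs_of_pos Real.two_pi_pos, ← abs_mul, this, abs_of_pos Real.two_pi_pos,
      intervalIntegral.integral_of_le Real.two_pi_pos.le, ← Real.enorm_eq_ofReal_abs]
    refine (enorm_integral_le_lintegral_enorm _).trans (le_of_eq ?_)
    simp_rw [Real.enorm_eq_ofReal_abs]
  have h1 : ∀ θ, ENNReal.ofReal |u x - u (bpt θ)| ≤
      (∫⁻ r in Ioo (0 : ℝ) 3, gE u (x + r * bpt θ)) +
      (∫⁻ s in Ioo (0 : ℝ) 1, ∫⁻ R in Ioo (2 : ℝ) 3, gE u (s * x + R * bpt θ)) +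
      ∫⁻ r in Ioo (1 : ℝ) 3, gE u (r * bpt θ) := by
    intro θ
    have hv : volume (Ioo (2 : ℝ) 3) = 1 := by simp; norm_num
    have hc : ∀ c : ℝ≥0∞, ∫⁻ _ in Ioo (2 : ℝ) 3, c = c := fun c => by
      rw [setLIntegral_const, hv, mul_one]
    rw [← hc (ENNReal.ofReal |u x - u (bpt θ)|)]
    refine (setLIntegral_mono' measurableSet_Ioo fun R hR => abs_sub_bpt_le hu hx θ hR).trans ?_
    rw [lintegral_add_right _ measurable_const, lintegral_add_left measurable_const, hc, hc,
      lintegral_lintegral_swap]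
    exact Measurable.aemeasurable (by fun_prop)
  refine (h0.trans (lintegral_mono h1)).trans ?_
  have m1 : Measurable fun θ => ∫⁻ r in Ioo (0 : ℝ) 3, gE u (x + r * bpt θ) := by
    refine Measurable.lintegral_prod_right' (f := fun p : ℝ × ℝ => gE u (x + p.2 * bpt p.1)) ?_
    fun_prop
  have m2 : Measurable fun p : ℝ × ℝ => ∫⁻ R in Ioo (2 : ℝ) 3, gE u (p.2 * x + R * bpt p.1) := by
    refine Measurable.lintegral_prod_right' (ν := volume.restrict (Ioo (2 : ℝ) 3))
      (f := fun p : (ℝ × ℝ) × ℝ => gE u (p.1.2 * x + p.2 * bpt p.1.1)) ?_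
    fun_prop
  have m3 : Measurable fun θ => ∫⁻ s in Ioo (0 : ℝ) 1, ∫⁻ R in Ioo (2 : ℝ) 3,
      gE u (s * x + R * bpt θ) := Measurable.lintegral_prod_right' m2
  rw [lintegral_add_left (by fun_prop), lintegral_add_left m1,
    two_mul (∫⁻ y in annul, gE u y), ← add_assoc]
  refine add_le_add (add_le_add ?_ ?_) ?_
  · set F : ℂ → ℝ≥0∞ := fun z => (ball (0 : ℂ) 4).indicator (fun y => gE u y * rdist x y) (x + z) with hF
    have hFm : Measurable F := by
      have : Measurable ((ball (0 : ℂ) 4).indicator (fun y => gE u y * rdist x y)) := by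
        refine Measurable.indicator ?_ measurableSet_ball
        unfold rdist; fun_prop
      fun_prop
    refine (lintegral_polar_le hFm le_rfl fun θ r hr => ?_).trans (le_of_eq ?_)
    · have hn : ‖(r : ℂ) * bpt θ‖ = r := by
        rw [norm_mul, norm_bpt, mul_one, Complex.norm_real, Real.norm_of_nonneg hr.1.le]
      have hmem : x + r * bpt θ ∈ ball (0 : ℂ) 4 := by
        rw [mem_ball_zero_iff]
        linarith [norm_add_le x (r * bpt θ), hr.2]
      rw [hF]
      simp only [indicator_of_mem hmem]
      have : rdist x (x + r * bpt θ) = (ENNReal.ofReal r)⁻¹ := by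
        rw [rdist, sub_add_cancel_left, norm_neg, hn]
      rw [this, mul_left_comm, ENNReal.mul_inv_cancel (by simpa using hr.1) (by simp), mul_one]
    · rw [hF, lintegral_add_left_eq_self, lintegral_indicator measurableSet_ball]
  · rw [lintegral_lintegral_swap m2.aemeasurable]
    have hv : volume (Ioo (0 : ℝ) 1) = 1 := by simp
    calc _ ≤ ∫⁻ s in Ioo (0 : ℝ) 1, ∫⁻ y in annul, gE u y := by
          refine setLIntegral_mono' measurableSet_Ioo fun s hs => ?_
          refine (lintegral_polar_le (F := fun z => annul.indicator (gE u) (s * x + z)) ?_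
            (by norm_num) fun θ r hr => ?_).trans (le_of_eq ?_)
          · have := hgm.indicator measurableSet_annul
            fun_prop
          · have hn : ‖(r : ℂ) * bpt θ‖ = r := by
              rw [norm_mul, norm_bpt, mul_one, Complex.norm_real,
                Real.norm_of_nonneg (by linarith [hr.1])]
            have hs1 : ‖(s : ℂ) * x‖ ≤ 1 := by
              rw [norm_mul, Complex.norm_real, Real.norm_of_nonneg hs.1.le]
              nlinarith [hs.2, hs.1, norm_nonneg x]
            have hmem : (s : ℂ) * x + r * bpt θ ∈ annul := by
              constructor
              · have h1 := norm_sub_norm_le (r * bpt θ) (-((s : ℂ) * x))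
                rw [norm_neg, sub_neg_eq_add, add_comm (r * bpt θ)] at h1
                linarith [hr.1]
              · linarith [norm_add_le (s * x) (r * bpt θ), hr.2]
            simp only [indicator_of_mem hmem]
            exact le_mul_of_one_le_left' (by simpa using (by linarith [hr.1] : (1 : ℝ) ≤ r))
          · rw [lintegral_add_left_eq_self, lintegral_indicator measurableSet_annul]
      _ = ∫⁻ y in annul, gE u y := by rw [setLIntegral_const, hv, mul_one]
  · refine (lintegral_polar_le (F := annul.indicator (gE u)) (hgm.indicator measurableSet_annul)
      zero_le_one fun θ r hr => ?_).trans (le_of_eq ?_)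
    · have hn : ‖(r : ℂ) * bpt θ‖ = r := by
        rw [norm_mul, norm_bpt, mul_one, Complex.norm_real, Real.norm_of_nonneg (by linarith [hr.1])]
      have hmem : (r : ℂ) * bpt θ ∈ annul := ⟨by rw [hn]; exact hr.1, by rw [hn]; linarith [hr.2]⟩
      rw [indicator_of_mem hmem]
      exact le_mul_of_one_le_left' (by simpa using hr.1.le)
    · rw [lintegral_indicator measurableSet_annul]

theorem measurableSet_odisc : MeasurableSet odisc := measurableSet_ball

theorem integrableOn_odisc {w : ℂ → ℝ} (hw : ContinuousOn w cdisc) : IntegrableOn w odisc :=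
  (hw.integrableOn_compact isCompact_cdisc).mono_set odisc_subset_cdisc

theorem ofReal_ballInt {w : ℂ → ℝ} (hw : ContinuousOn w cdisc) (h0 : ∀ z ∈ cdisc, 0 ≤ w z) :
    ENNReal.ofReal (ballInt w) = ∫⁻ z in odisc, ENNReal.ofReal (w z) :=
  ofReal_integral_eq_lintegral_ofReal (integrableOn_odisc hw)
    ((ae_restrict_iff' measurableSet_odisc).2
      (Eventually.of_forall fun z hz => h0 z (odisc_subset_cdisc hz)))

theorem lintegral_gE_sq_odisc (hu : ContDiffOn ℝ 1 u cdisc) :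
    ∫⁻ y in odisc, gE u y ^ 2 = ENNReal.ofReal (dirich u) := by
  have hc : ContinuousOn (fun z => gsq (fderivWithin ℝ u cdisc z)) cdisc :=
    continuous_gsq.comp_continuousOn (continuousOn_fderivWithin_cdisc hu)
  rw [dirich, ofReal_ballInt hc fun _ _ => gsq_nonneg _]
  refine setLIntegral_congr_fun measurableSet_odisc fun y hy => ?_
  have hy1 : ‖y‖ < 1 := by simpa [odisc] using hy
  simp only [gE]
  rw [← ENNReal.ofReal_pow (gext_nonneg _ _), gext, crefl_of_mem (odisc_subset_cdisc hy), gradN,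
    max_eq_left (by nlinarith [norm_nonneg y]), inv_one, one_mul, Real.sq_sqrt (gsq_nonneg _)]

theorem lintegral_gE_sq_annul_le (hu : ContDiffOn ℝ 1 u cdisc) :
    ∫⁻ y in annul, gE u y ^ 2 ≤ ENNReal.ofReal (dirich u) := by
  rw [← lintegral_gE_sq_odisc hu]
  have hgm := measurable_gE hu
  rw [← lintegral_indicator measurableSet_annul, ← lintegral_indicator measurableSet_odisc,
    lintegral_polar ((by fun_prop : Measurable fun y => gE u y ^ 2).indicator measurableSet_annul),
    lintegral_polar ((by fun_prop : Measurable fun y => gE u y ^ 2).indicator measurableSet_odisc)]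
  refine lintegral_mono fun θ => ?_
  set h : ℝ → ℝ≥0∞ := fun s => ENNReal.ofReal s *
    odisc.indicator (fun y => gE u y ^ 2) (s * bpt θ) with hh
  have hn : ∀ r : ℝ, 0 < r → ‖(r : ℂ) * bpt θ‖ = r := fun r hr => by
    rw [norm_mul, norm_bpt, mul_one, Complex.norm_real, Real.norm_of_nonneg hr.le]
  have himg := lintegral_image_eq_lintegral_abs_deriv_mul (s := Ioo (1 : ℝ) 4) (f := fun r => r⁻¹)
    (f' := fun r => -(r ^ 2)⁻¹) measurableSet_Ioo
    (fun r hr => (hasDerivAt_inv (zero_lt_one.trans hr.1).ne').hasDerivWithinAt)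
    inv_injective.injOn h
  have hsub : (fun r : ℝ => r⁻¹) '' Ioo (1 : ℝ) 4 ⊆ Ioi 0 := by
    rintro _ ⟨r, hr, rfl⟩
    exact inv_pos.2 (zero_lt_one.trans hr.1)
  calc ∫⁻ r in Ioi (0 : ℝ), ENNReal.ofReal r * annul.indicator (fun y => gE u y ^ 2) (r * bpt θ)
      ≤ ∫⁻ r in Ioo (1 : ℝ) 4, ENNReal.ofReal |(-(r ^ 2)⁻¹)| * h r⁻¹ := by
        rw [← lintegral_indicator measurableSet_Ioo, ← lintegral_indicator measurableSet_Ioi]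
        refine lintegral_mono fun r => ?_
        by_cases hr : 0 < r
        swap
        · rw [indicator_of_notMem (by simpa using hr)]; exact bot_le
        rw [indicator_of_mem (by simpa using hr)]
        by_cases hra : (r : ℂ) * bpt θ ∈ annul
        swap
        · rw [indicator_of_notMem hra, mul_zero]; exact bot_le
        have hr1 : 1 < r := by have := hra.1; rwa [hn r hr] at this
        have hr4 : r < 4 := by have := hra.2; rwa [hn r hr] at this
        have hri : r⁻¹ < 1 := inv_lt_one_of_one_lt₀ hr1
        have hod : ((r⁻¹ : ℝ) : ℂ) * bpt θ ∈ odisc := by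
          rw [odisc, mem_ball_zero_iff, hn _ (inv_pos.2 hr)]; exact hri
        rw [indicator_of_mem hra, indicator_of_mem (show r ∈ Ioo (1 : ℝ) 4 from ⟨hr1, hr4⟩), hh]
        simp only [indicator_of_mem hod, gE]
        rw [← ENNReal.ofReal_pow (gext_nonneg _ _), ← ENNReal.ofReal_pow (gext_nonneg _ _),
          ← ENNReal.ofReal_mul hr.le, ← ENNReal.ofReal_mul (inv_pos.2 hr).le,
          ← ENNReal.ofReal_mul (abs_nonneg _)]
        refine ENNReal.ofReal_le_ofReal (le_of_eq ?_)
        have hc : crefl ((r : ℂ) * bpt θ) = ((r⁻¹ : ℝ) : ℂ) * bpt θ := by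
          rw [crefl, hn r hr, max_eq_right (by nlinarith), Complex.real_smul]
          have : (r : ℂ) ≠ 0 := by exact_mod_cast hr.ne'
          push_cast
          field_simp
        rw [gext, gext, hc, crefl_of_mem (odisc_subset_cdisc hod), hn r hr, hn _ (inv_pos.2 hr),
          max_eq_right (by nlinarith), max_eq_left (by nlinarith [inv_pos.2 hr]), abs_neg,
          abs_of_pos (by positivity)]
        field_simp
    _ = ∫⁻ r in (fun r : ℝ => r⁻¹) '' Ioo (1 : ℝ) 4, h r := himg.symm
    _ ≤ ∫⁻ r in Ioi (0 : ℝ), h r := lintegral_mono_set hsub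

theorem lintegral_mul_le_sqrt {α : Type*} [MeasurableSpace α] (μ : Measure α) {f g : α → ℝ≥0∞}
    (hf : Measurable f) (hg : Measurable g) {a b : ℝ}
    (h1 : ∫⁻ x, f x ^ 2 ∂μ ≤ ENNReal.ofReal a) (h2 : ∫⁻ x, g x ^ 2 ∂μ ≤ ENNReal.ofReal b) :
    ∫⁻ x, f x * g x ∂μ ≤ ENNReal.ofReal (√a * √b) := by
  have h := ENNReal.lintegral_mul_le_Lp_mul_Lq μ Real.HolderConjugate.two_two hf.aemeasurable
    hg.aemeasurable
  simp only [ENNReal.rpow_two] at h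
  refine h.trans ?_
  rw [ENNReal.ofReal_mul (Real.sqrt_nonneg _)]
  have key : ∀ c : ℝ, ENNReal.ofReal c ^ (1 / (2 : ℝ)) = ENNReal.ofReal √c := by
    intro c
    rcases le_total 0 c with hc | hc
    · rw [ENNReal.ofReal_rpow_of_nonneg hc (by norm_num), Real.sqrt_eq_rpow]
    · simp [ENNReal.ofReal_of_nonpos hc, Real.sqrt_eq_zero_of_nonpos hc]
  rw [← key a, ← key b]
  exact mul_le_mul' (ENNReal.rpow_le_rpow h1 (by norm_num)) (ENNReal.rpow_le_rpow h2 (by norm_num))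

theorem lintegral_gE_annul_le (hu : ContDiffOn ℝ 1 u cdisc) :
    ∫⁻ y in annul, gE u y ≤ ENNReal.ofReal (√(dirich u) * √(16 * π)) := by
  have hvol : ∫⁻ _ in annul, (1 : ℝ≥0∞) ^ 2 ≤ ENNReal.ofReal (16 * π) := by
    rw [one_pow, setLIntegral_const, one_mul]
    refine (measure_mono (fun y hy => by simpa using hy.2 : annul ⊆ ball (0 : ℂ) 4)).trans (le_of_eq ?_)
    rw [Complex.volume_ball, ENNReal.ofReal_mul (by norm_num), ← ENNReal.ofReal_pow (by norm_num)]
    norm_num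
    exact congrArg _ (congrArg _ (Real.toNNReal_of_nonneg Real.pi_pos.le).symm)
  simpa using lintegral_mul_le_sqrt (volume.restrict annul) (measurable_gE hu) measurable_const
    (lintegral_gE_sq_annul_le hu) hvol

/-- The integral representation with an explicit remainder. -/
theorem abs_sub_cmean_le' (hu : ContDiffOn ℝ 1 u cdisc) {x : ℂ} (hx : x ∈ cdisc) :
    ENNReal.ofReal (2 * π * |u x - cmean u|) ≤
      (∫⁻ y in ball 0 4, gE u y * rdist x y) + ENNReal.ofReal (16 * √(dirich u)) := by
  refine (abs_sub_cmean_le hu hx).trans (add_le_add le_rfl ?_)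
  refine (mul_le_mul' le_rfl (lintegral_gE_annul_le hu)).trans ?_
  rw [show (2 : ℝ≥0∞) = ENNReal.ofReal 2 by simp, ← ENNReal.ofReal_mul (by norm_num)]
  refine ENNReal.ofReal_le_ofReal ?_
  have : √(16 * π) ≤ 8 := by
    rw [Real.sqrt_le_left (by norm_num)]; linarith [Real.pi_le_four]
  nlinarith [Real.sqrt_nonneg (dirich u)]

end

/-! ### The conformal measure and its logarithmic energy -/

/-- The conformal density `e^{kv}` of the reflected function. -/
def cdens (k : ℝ) (v : ℂ → ℝ) (z : ℂ) : ℝ≥0∞ := ENNReal.ofReal (Real.exp (k * v (crefl z)))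

/-- The sum of the conformal area `e^{2v} dz` and the conformal boundary length `e^v ds₀`. -/
def muM (v : ℂ → ℝ) : Measure ℂ :=
  (volume.restrict odisc).withDensity (cdens 2 v) + circM.withDensity (cdens 1 v)

/-- The total conformal mass. -/
def mass (v : ℂ → ℝ) : ℝ :=
  (ballInt fun z => Real.exp (2 * v z)) + circInt fun z => Real.exp (v z)

theorem measurable_cdens {v : ℂ → ℝ} (hv : ContinuousOn v cdisc) (k : ℝ) : Measurable (cdens k v) := by
  have h := continuous_comp_crefl hv
  have h2 : Continuous fun z => v (crefl z) := h
  exact (Real.continuous_exp.comp (continuous_const.mul h2)).measurable.ennreal_ofReal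

theorem lintegral_muM {v : ℂ → ℝ} (hv : ContinuousOn v cdisc) {F : ℂ → ℝ≥0∞} (hF : Measurable F) :
    ∫⁻ z, F z ∂(muM v) = (∫⁻ z in odisc, cdens 2 v z * F z) + ∫⁻ z, cdens 1 v z * F z ∂circM := by
  rw [muM, lintegral_add_measure, lintegral_withDensity_eq_lintegral_mul _ (measurable_cdens hv 2) hF,
    lintegral_withDensity_eq_lintegral_mul _ (measurable_cdens hv 1) hF]
  rfl

theorem ofReal_circInt {w : ℂ → ℝ} (hw : Continuous fun θ => w (bpt θ)) (h0 : ∀ θ, 0 ≤ w (bpt θ)) :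
    ENNReal.ofReal (circInt w) = ∫⁻ θ in Ioc 0 (2 * π), ENNReal.ofReal (w (bpt θ)) := by
  rw [circInt, intervalIntegral.integral_of_le Real.two_pi_pos.le]
  exact ofReal_integral_eq_lintegral_ofReal (hw.intervalIntegrable _ _).1
    (Eventually.of_forall fun θ => h0 θ)

theorem continuous_comp_bpt {w : ℂ → ℝ} (hw : ContinuousOn w cdisc) : Continuous fun θ => w (bpt θ) :=
  hw.comp_continuous continuous_bpt bpt_mem_cdisc

theorem ballInt_nonneg {w : ℂ → ℝ} (h0 : ∀ z ∈ cdisc, 0 ≤ w z) : 0 ≤ ballInt w :=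
  setIntegral_nonneg measurableSet_odisc fun z hz => h0 z (odisc_subset_cdisc hz)

theorem circInt_nonneg {w : ℂ → ℝ} (h0 : ∀ z ∈ cdisc, 0 ≤ w z) : 0 ≤ circInt w :=
  intervalIntegral.integral_nonneg Real.two_pi_pos.le fun θ _ => h0 _ (bpt_mem_cdisc θ)

/-- Integrals against the conformal measure in terms of integrals over the disc and the circle. -/
theorem lintegral_muM_ofReal {v w : ℂ → ℝ} (hv : ContinuousOn v cdisc) (hw : ContinuousOn w cdisc)
    (h0 : ∀ z ∈ cdisc, 0 ≤ w z) :
    ∫⁻ z, ENNReal.ofReal (w (crefl z)) ∂(muM v) =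
      ENNReal.ofReal ((ballInt fun z => w z * Real.exp (2 * v z)) +
        circInt fun z => w z * Real.exp (v z)) := by
  have hwc : Continuous fun z => w (crefl z) := continuous_comp_crefl hw
  have hvc : Continuous fun z => v (crefl z) := continuous_comp_crefl hv
  have hd1 : ∀ z ∈ cdisc, 0 ≤ w z * Real.exp (2 * v z) := fun z hz =>
    mul_nonneg (h0 z hz) (Real.exp_nonneg _)
  have hd2 : ∀ z ∈ cdisc, 0 ≤ w z * Real.exp (v z) := fun z hz =>
    mul_nonneg (h0 z hz) (Real.exp_nonneg _)
  have hc2 : ContinuousOn (fun z => w z * Real.exp (v z)) cdisc := by fun_prop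
  rw [lintegral_muM hv hwc.measurable.ennreal_ofReal, ENNReal.ofReal_add (ballInt_nonneg hd1) (circInt_nonneg hd2),
    ofReal_ballInt (by fun_prop) hd1,
    ofReal_circInt (continuous_comp_bpt hc2) fun θ => hd2 _ (bpt_mem_cdisc θ), lintegral_circM]
  · congr 1
    · refine setLIntegral_congr_fun measurableSet_odisc fun z hz => ?_
      simp only [cdens, crefl_of_mem (odisc_subset_cdisc hz)]
      rw [mul_comm, ← ENNReal.ofReal_mul (h0 z (odisc_subset_cdisc hz))]
    · refine lintegral_congr fun θ => ?_
      simp only [cdens, crefl_of_mem (bpt_mem_cdisc θ)]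
      rw [mul_comm, ← ENNReal.ofReal_mul (h0 _ (bpt_mem_cdisc θ)), one_mul]
  · exact (measurable_cdens hv 1).mul hwc.measurable.ennreal_ofReal

theorem muM_univ {v : ℂ → ℝ} (hv : ContinuousOn v cdisc) : muM v univ = ENNReal.ofReal (mass v) := by
  have := lintegral_muM_ofReal hv (w := fun _ => 1) continuousOn_const (fun _ _ => zero_le_one)
  simpa [mass] using this

theorem isFiniteMeasure_muM {v : ℂ → ℝ} (hv : ContinuousOn v cdisc) : IsFiniteMeasure (muM v) :=
  ⟨by rw [muM_univ hv]; exact ENNReal.ofReal_lt_top⟩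

theorem ae_mem_cdisc_circM : ∀ᵐ z ∂circM, z ∈ cdisc := by
  exact (ae_map_iff (p := fun z => z ∈ cdisc) continuous_bpt.aemeasurable
    isClosed_closedBall.measurableSet).2 (Eventually.of_forall bpt_mem_cdisc)

theorem ae_mem_cdisc (v : ℂ → ℝ) : ∀ᵐ z ∂(muM v), z ∈ cdisc := by
  rw [muM, ae_add_measure_iff]
  constructor
  · refine (withDensity_absolutelyContinuous _ _).ae_le ?_
    filter_upwards [ae_restrict_mem measurableSet_odisc] with z hz using odisc_subset_cdisc hz
  · exact (withDensity_absolutelyContinuous _ _).ae_le ae_mem_cdisc_circM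

/-- The positive part of the reflected function. -/
def posE (v : ℂ → ℝ) (z : ℂ) : ℝ≥0∞ := ENNReal.ofReal (v (crefl z))

theorem measurable_posE {v : ℂ → ℝ} (hv : ContinuousOn v cdisc) : Measurable (posE v) := by
  have h : Continuous fun z => v (crefl z) := continuous_comp_crefl hv
  exact h.measurable.ennreal_ofReal

/-- The bound for the convolution of two reciprocal distances. -/
def lker (x y : ℂ) : ℝ≥0∞ :=
  if x = y then ∞ else ENNReal.ofReal (2 * π * Real.log (5 / ‖x - y‖) + 16 * π)

theorem measurable_lker : Measurable fun p : ℂ × ℂ => lker p.1 p.2 := by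
  unfold lker
  refine Measurable.ite (measurableSet_eq_fun measurable_fst measurable_snd) measurable_const ?_
  fun_prop

theorem lintegral_rdist_mul_le_lker {x x' : ℂ} (hx : x ∈ cdisc) (hx' : x' ∈ cdisc) :
    ∫⁻ y in ball 0 4, rdist x y * rdist x' y ≤ lker x x' := by
  unfold lker
  split_ifs with h
  · exact le_top
  · exact lintegral_rdist_mul_rdist_le hx hx' h

theorem ofReal_eq_ofReal_max (a : ℝ) : ENNReal.ofReal a = ENNReal.ofReal (max a 0) := by
  simp [ENNReal.ofReal, Real.toNNReal]

/-- Young's inequality for the entropy pairing. -/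
theorem log_inv_mul_exp_le {k q w r : ℝ} (hr : 0 < r) :
    q * Real.log (5 / r) * Real.exp (k * w) ≤
      (k * w + q * Real.log 5) * Real.exp (k * w) + r⁻¹ ^ q := by
  have h1 : Real.log (5 / r) = Real.log 5 + Real.log r⁻¹ := by
    rw [Real.log_div (by norm_num) hr.ne', Real.log_inv]; ring
  have h2 : r⁻¹ ^ q = Real.exp (q * Real.log r⁻¹) := by
    rw [Real.rpow_def_of_pos (inv_pos.2 hr), mul_comm]
  rw [h1, h2]
  set b := q * Real.log r⁻¹ with hb
  have h3 : b - k * w + 1 ≤ Real.exp (b - k * w) := Real.add_one_le_exp _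
  have h4 : Real.exp b = Real.exp (b - k * w) * Real.exp (k * w) := by rw [← Real.exp_add]; ring_nf
  have h5 := mul_le_mul_of_nonneg_right h3 (Real.exp_nonneg (k * w))
  rw [h4]
  nlinarith [Real.exp_pos (k * w)]

theorem lker_mul_cdens_le {v : ℂ → ℝ} {k s : ℝ} (hk : 0 < k) (hs : 0 < s) (x z : ℂ) :
    lker x z * cdens k v z ≤
      cdens k v z * (ENNReal.ofReal (4 * π / s) * posE v z + ENNReal.ofReal (2 * π * Real.log 5 + 16 * π)) +
        ENNReal.ofReal (4 * π / (k * s)) * rdist x z ^ (k * s / 2) := by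
  have hq : 0 < k * s / 2 := by positivity
  by_cases h : x = z
  · subst h
    have : rdist x x = ∞ := by simp [rdist]
    rw [this, ENNReal.top_rpow_of_pos hq, ENNReal.mul_top]
    · simp
    · simp; positivity
  · have hr : 0 < ‖x - z‖ := norm_pos_iff.2 (sub_ne_zero.2 h)
    have hlog5 : 0 < Real.log 5 := Real.log_pos (by norm_num)
    rw [lker, if_neg h, rdist_eq_ofReal h, cdens, posE,
      ENNReal.ofReal_rpow_of_nonneg (by positivity) hq.le, ofReal_eq_ofReal_max (v (crefl z)),
      ← ENNReal.ofReal_mul' (Real.exp_nonneg _), ← ENNReal.ofReal_mul (by positivity),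
      ← ENNReal.ofReal_mul (by positivity), ← ENNReal.ofReal_add (by positivity) (by positivity),
      ← ENNReal.ofReal_mul (by positivity), ← ENNReal.ofReal_add (by positivity) (by positivity)]
    refine ENNReal.ofReal_le_ofReal ?_
    have hy := log_inv_mul_exp_le (k := k) (q := k * s / 2) (w := v (crefl z)) hr
    have h1 : k * v (crefl z) * Real.exp (k * v (crefl z)) ≤
        k * max (v (crefl z)) 0 * Real.exp (k * v (crefl z)) := by
      gcongr; exact le_max_left _ _
    set E := Real.exp (k * v (crefl z))
    set P := max (v (crefl z)) 0
    set T := ‖x - z‖⁻¹ ^ (k * s / 2)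
    set Lg := Real.log (5 / ‖x - z‖)
    have h2 : Lg * E ≤ (2 / s * P + Real.log 5) * E + 2 / (k * s) * T := by
      have h3 : k * s / 2 * Lg * E ≤ (k * P + k * s / 2 * Real.log 5) * E + T := by nlinarith
      have h4 : Lg * E = 2 / (k * s) * (k * s / 2 * Lg * E) := by field_simp
      rw [h4]
      refine (mul_le_mul_of_nonneg_left h3 (by positivity)).trans (le_of_eq ?_)
      field_simp
    have h5 := mul_le_mul_of_nonneg_left h2 Real.two_pi_pos.le
    have h6 : E * (4 * π / s * P + (2 * π * Real.log 5 + 16 * π)) + 4 * π / (k * s) * T =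
      2 * π * ((2 / s * P + Real.log 5) * E + 2 / (k * s) * T) + 16 * π * E := by ring
    rw [h6]; nlinarith

theorem exists_setLIntegral_lker_le {s m₁ : ℝ} (hs : 0 < s) (hs2 : s < 2) :
    ∃ C : ℝ, 0 ≤ C ∧ ∀ v : ℂ → ℝ, ContinuousOn v cdisc → mass v ≤ m₁ →
      ∀ A : Set ℂ, MeasurableSet A → ∀ x ∈ cdisc,
      ∫⁻ z in A, lker x z ∂(muM v) ≤
        ENNReal.ofReal (4 * π / s) * (∫⁻ z in A, posE v z ∂(muM v)) + ENNReal.ofReal C := by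
  obtain ⟨Cc, hCc0, hCc⟩ := exists_rdist_rpow_circM_le (p := s / 2) (by positivity) (by linarith)
  set K := 2 * π * Real.log 5 + 16 * π with hK
  have hK0 : 0 ≤ K := by have := Real.log_nonneg (by norm_num : (1 : ℝ) ≤ 5); positivity
  set Ca := 2 * π * (2 ^ (2 - s) / (2 - s)) with hCa
  have h2s : 0 < 2 - s := by linarith
  have hCa0 : 0 ≤ Ca := by positivity
  refine ⟨K * max m₁ 0 + 4 * π / (2 * s) * Ca + 4 * π / (1 * s) * Cc, by positivity,
    fun v hv hm A hA x hx => ?_⟩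
  have hx1 : ‖x‖ ≤ 1 := by simpa [cdisc] using hx
  have hposm := measurable_posE hv
  have hdm := measurable_cdens hv
  have hlm : Measurable fun z => lker x z := measurable_lker.comp (measurable_prodMk_left)
  have hrm : ∀ p : ℝ, Measurable fun z => rdist x z ^ p := fun p => by unfold rdist; fun_prop
  set H : ℂ → ℝ≥0∞ := fun z => ENNReal.ofReal (4 * π / s) * posE v z + ENNReal.ofReal K with hH
  have hHm : Measurable H := by fun_prop
  have key : ∀ k : ℝ, 0 < k → ∀ z, cdens k v z * A.indicator (fun z => lker x z) z ≤
      cdens k v z * A.indicator H z + ENNReal.ofReal (4 * π / (k * s)) * rdist x z ^ (k * s / 2) := by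
    intro k hk z
    by_cases hz : z ∈ A
    · rw [indicator_of_mem hz, indicator_of_mem hz, mul_comm]
      exact lker_mul_cdens_le hk hs x z
    · rw [indicator_of_notMem hz]; simp
  have harea : ∫⁻ z in odisc, rdist x z ^ (2 * s / 2) ≤ ENNReal.ofReal Ca := by
    rw [show 2 * s / 2 = s by ring]
    refine rdist_rpow_lintegral_le x measurableSet_odisc hs.le hs2 zero_le_two fun y hy => ?_
    have : ‖y‖ < 1 := by simpa [odisc] using hy
    linarith [norm_sub_le x y]
  have hcirc : ∫⁻ z, rdist x z ^ (1 * s / 2) ∂circM ≤ ENNReal.ofReal Cc := by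
    rw [one_mul]; exact hCc x
  have hmassA : (muM v) A ≤ ENNReal.ofReal (max m₁ 0) := by
    refine (measure_mono (subset_univ A)).trans ?_
    rw [muM_univ hv]
    exact ENNReal.ofReal_le_ofReal (hm.trans (le_max_left _ _))
  calc ∫⁻ z in A, lker x z ∂(muM v)
      = (∫⁻ z in odisc, cdens 2 v z * A.indicator (fun z => lker x z) z) +
          ∫⁻ z, cdens 1 v z * A.indicator (fun z => lker x z) z ∂circM := by
        rw [← lintegral_indicator hA, lintegral_muM hv (hlm.indicator hA)]
    _ ≤ (∫⁻ z in odisc, (cdens 2 v z * A.indicator H z +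
          ENNReal.ofReal (4 * π / (2 * s)) * rdist x z ^ (2 * s / 2))) +
        ∫⁻ z, (cdens 1 v z * A.indicator H z +
          ENNReal.ofReal (4 * π / (1 * s)) * rdist x z ^ (1 * s / 2)) ∂circM :=
        add_le_add (lintegral_mono (key 2 two_pos)) (lintegral_mono (key 1 one_pos))
    _ = (∫⁻ z in A, H z ∂(muM v)) +
        (ENNReal.ofReal (4 * π / (2 * s)) * ∫⁻ z in odisc, rdist x z ^ (2 * s / 2)) +
        (ENNReal.ofReal (4 * π / (1 * s)) * ∫⁻ z, rdist x z ^ (1 * s / 2) ∂circM) := by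
        have hi := hHm.indicator hA
        rw [lintegral_add_right _ ((hrm _).const_mul _), lintegral_add_right _ ((hrm _).const_mul _),
          lintegral_const_mul _ (hrm _), lintegral_const_mul _ (hrm _),
          ← lintegral_indicator hA H, lintegral_muM hv hi]
        abel
    _ ≤ (ENNReal.ofReal (4 * π / s) * (∫⁻ z in A, posE v z ∂(muM v)) +
          ENNReal.ofReal K * ENNReal.ofReal (max m₁ 0)) +
        ENNReal.ofReal (4 * π / (2 * s)) * ENNReal.ofReal Ca +
        ENNReal.ofReal (4 * π / (1 * s)) * ENNReal.ofReal Cc := by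
        refine add_le_add (add_le_add ?_ (mul_le_mul' le_rfl harea)) (mul_le_mul' le_rfl hcirc)
        rw [hH, lintegral_add_right _ measurable_const, lintegral_const_mul _ hposm, setLIntegral_const]
        exact add_le_add le_rfl (mul_le_mul' le_rfl hmassA)
    _ = _ := by
        rw [← ENNReal.ofReal_mul hK0, ← ENNReal.ofReal_mul (by positivity),
          ← ENNReal.ofReal_mul (by positivity), add_assoc, add_assoc, 
          ← ENNReal.ofReal_add (by positivity) (by positivity),
          ← ENNReal.ofReal_add (by positivity) (by positivity), add_assoc (K * _)]

theorem measurable_rdist_left (y : ℂ) : Measurable fun x => rdist x y := by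
  unfold rdist; fun_prop

theorem measurable_rdist_right (x : ℂ) : Measurable fun y => rdist x y := by
  unfold rdist; fun_prop

/-- The `L²` norm of a potential is controlled by the logarithmic kernel. -/
theorem lintegral_potential_sq_le (ν : Measure ℂ) [SFinite ν] (hν : ∀ᵐ x ∂ν, x ∈ cdisc) :
    ∫⁻ y in ball 0 4, (∫⁻ x, rdist x y ∂ν) ^ 2 ≤ ∫⁻ x, ∫⁻ x', lker x x' ∂ν ∂ν := by
  have hm3 : Measurable fun p : (ℂ × ℂ) × ℂ => rdist p.1.2 p.1.1 * rdist p.2 p.1.1 :=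
    (measurable_rdist.comp (f := fun p : (ℂ × ℂ) × ℂ => (p.1.2, p.1.1)) (by fun_prop)).mul
      (measurable_rdist.comp (f := fun p : (ℂ × ℂ) × ℂ => (p.2, p.1.1)) (by fun_prop))
  have hm3' : Measurable fun p : (ℂ × ℂ) × ℂ => rdist p.1.1 p.1.2 * rdist p.2 p.1.2 :=
    (measurable_rdist.comp (f := fun p : (ℂ × ℂ) × ℂ => (p.1.1, p.1.2)) (by fun_prop)).mul
      (measurable_rdist.comp (f := fun p : (ℂ × ℂ) × ℂ => (p.2, p.1.2)) (by fun_prop))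
  calc ∫⁻ y in ball 0 4, (∫⁻ x, rdist x y ∂ν) ^ 2
      = ∫⁻ y in ball 0 4, (∫⁻ x, (∫⁻ x', rdist x y * rdist x' y ∂ν) ∂ν) := by
        refine lintegral_congr fun y => ?_
        rw [sq, ← lintegral_mul_const _ (measurable_rdist_left y)]
        refine lintegral_congr fun x => ?_
        rw [lintegral_const_mul _ (measurable_rdist_left y)]
    _ = ∫⁻ x, (∫⁻ y in ball 0 4, ∫⁻ x', rdist x y * rdist x' y ∂ν) ∂ν := by
        rw [lintegral_lintegral_swap]
        exact (hm3.lintegral_prod_right' (ν := ν)).aemeasurable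
    _ = ∫⁻ x, ∫⁻ x', (∫⁻ y in ball 0 4, rdist x y * rdist x' y) ∂ν ∂ν := by
        refine lintegral_congr fun x => ?_
        rw [lintegral_lintegral_swap]
        exact (hm3'.comp (f := fun p : ℂ × ℂ => ((x, p.1), p.2)) (by fun_prop)).aemeasurable
    _ ≤ ∫⁻ x, ∫⁻ x', lker x x' ∂ν ∂ν := by
        refine lintegral_mono_ae (hν.mono fun x hx => lintegral_mono_ae (hν.mono fun x' hx' => ?_))
        exact lintegral_rdist_mul_le_lker hx hx'

theorem lker_le_of_dist {x z : ℂ} (h : z ∉ ball x (1 / 10)) :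
    lker x z ≤ ENNReal.ofReal (2 * π * Real.log 50 + 16 * π) := by
  have hr : 1 / 10 ≤ ‖x - z‖ := by
    rw [mem_ball, not_lt, dist_comm, dist_eq_norm] at h; exact h
  have hne : x ≠ z := by rintro rfl; norm_num at hr
  rw [lker, if_neg hne]
  refine ENNReal.ofReal_le_ofReal ?_
  have : Real.log (5 / ‖x - z‖) ≤ Real.log 50 := by
    refine Real.log_le_log (by positivity) ?_
    rw [div_le_iff₀ (by linarith)]; linarith
  nlinarith [Real.pi_pos]

theorem exists_lintegral_potential_sq_le {s m₁ : ℝ} (hs : 0 < s) (hs2 : s < 2) :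
    ∃ C : ℝ, 0 ≤ C ∧ ∀ v : ℂ → ℝ, ContinuousOn v cdisc → mass v ≤ m₁ →
      ∀ A : Set ℂ, MeasurableSet A → ∀ κ : ℝ≥0∞,
      (∀ x ∈ A ∩ cdisc, muM v (A ∩ ball x (1 / 10)) ≤ κ) →
      ∫⁻ y in ball 0 4, (∫⁻ x in A, rdist x y ∂(muM v)) ^ 2 ≤
        ENNReal.ofReal (4 * π / s) * (κ * ∫⁻ z in A, posE v z ∂(muM v)) + ENNReal.ofReal C := by
  obtain ⟨C₀, hC₀, hC⟩ := exists_setLIntegral_lker_le (m₁ := m₁) hs hs2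
  set K := 2 * π * Real.log 50 + 16 * π with hK
  have hK0 : 0 ≤ K := by have := Real.log_nonneg (by norm_num : (1 : ℝ) ≤ 50); positivity
  refine ⟨(C₀ + K * max m₁ 0) * max m₁ 0, by positivity, fun v hv hm A hA κ hκ => ?_⟩
  have := isFiniteMeasure_muM hv
  set ν := (muM v).restrict A with hν
  have hνd : ∀ᵐ x ∂ν, x ∈ cdisc := ae_restrict_of_ae (ae_mem_cdisc v)
  have hνA : ∀ᵐ x ∂ν, x ∈ A := ae_restrict_mem hA
  have hpos := measurable_posE hv
  have hνu : ν univ ≤ ENNReal.ofReal (max m₁ 0) := by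
    rw [hν, Measure.restrict_apply_univ]
    refine (measure_mono (subset_univ A)).trans ?_
    rw [muM_univ hv]
    exact ENNReal.ofReal_le_ofReal (hm.trans (le_max_left _ _))
  have hset : MeasurableSet {p : ℂ × ℂ | p.2 ∈ ball p.1 (1 / 10)} :=
    (isOpen_lt (f := fun p : ℂ × ℂ => dist p.2 p.1) (by fun_prop) continuous_const).measurableSet
  have hker : ∀ᵐ x ∂ν, ∫⁻ x', lker x x' ∂ν ≤
      ENNReal.ofReal (4 * π / s) * (∫⁻ z, (ball x (1 / 10)).indicator (posE v) z ∂ν) +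
        ENNReal.ofReal (C₀ + K * max m₁ 0) := by
    filter_upwards [hνd] with x hx
    have h1 : ∀ z, lker x z ≤ (ball x (1 / 10)).indicator (fun z => lker x z) z + ENNReal.ofReal K := by
      intro z
      by_cases hz : z ∈ ball x (1 / 10)
      · rw [indicator_of_mem hz]; exact le_self_add
      · rw [indicator_of_notMem hz, zero_add]; exact lker_le_of_dist hz
    have h2 := hC v hv hm (A ∩ ball x (1 / 10)) (hA.inter measurableSet_ball) x hx
    refine (lintegral_mono h1).trans ?_
    rw [lintegral_add_right _ measurable_const, lintegral_const, lintegral_indicator measurableSet_ball,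
      lintegral_indicator measurableSet_ball, hν, Measure.restrict_restrict measurableSet_ball,
      inter_comm, ENNReal.ofReal_add hC₀ (by positivity), ← add_assoc, ENNReal.ofReal_mul hK0]
    exact add_le_add h2 (mul_le_mul' le_rfl hνu)
  have hswap : ∫⁻ x, ∫⁻ z, (ball x (1 / 10)).indicator (posE v) z ∂ν ∂ν ≤ κ * ∫⁻ z, posE v z ∂ν := by
    have hmeas : Measurable fun p : ℂ × ℂ => (ball p.1 (1 / 10)).indicator (posE v) p.2 := by
      have : (fun p : ℂ × ℂ => (ball p.1 (1 / 10)).indicator (posE v) p.2) =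
        {p : ℂ × ℂ | p.2 ∈ ball p.1 (1 / 10)}.indicator fun p => posE v p.2 := by
        ext p; simp [indicator]
      rw [this]
      exact (hpos.comp measurable_snd).indicator hset
    rw [lintegral_lintegral_swap hmeas.aemeasurable, ← lintegral_const_mul _ hpos]
    refine lintegral_mono_ae ?_
    filter_upwards [hνA, hνd] with z hzA hzd
    have : (fun x => (ball x (1 / 10)).indicator (posE v) z) =
        (ball z (1 / 10)).indicator fun _ => posE v z := by
      ext x; simp [indicator, dist_comm]
    rw [this, lintegral_indicator measurableSet_ball, setLIntegral_const, mul_comm]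
    refine mul_le_mul' ?_ le_rfl
    rw [hν, Measure.restrict_apply measurableSet_ball, inter_comm]
    exact hκ z ⟨hzA, hzd⟩
  have hmm : Measurable fun x => ∫⁻ z, (ball x (1 / 10)).indicator (posE v) z ∂ν := by
    have : (fun p : ℂ × ℂ => (ball p.1 (1 / 10)).indicator (posE v) p.2) =
        {p : ℂ × ℂ | p.2 ∈ ball p.1 (1 / 10)}.indicator fun p => posE v p.2 := by
        ext p; simp [indicator]
    have h3 : Measurable fun p : ℂ × ℂ => (ball p.1 (1 / 10)).indicator (posE v) p.2 := by
      rw [this]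
      exact (hpos.comp measurable_snd).indicator hset
    exact h3.lintegral_prod_right'
  calc ∫⁻ y in ball 0 4, (∫⁻ x, rdist x y ∂ν) ^ 2
      ≤ ∫⁻ x, ∫⁻ x', lker x x' ∂ν ∂ν := lintegral_potential_sq_le ν hνd
    _ ≤ ∫⁻ x, (ENNReal.ofReal (4 * π / s) * (∫⁻ z, (ball x (1 / 10)).indicator (posE v) z ∂ν) +
        ENNReal.ofReal (C₀ + K * max m₁ 0)) ∂ν := lintegral_mono_ae hker
    _ = ENNReal.ofReal (4 * π / s) * (∫⁻ x, ∫⁻ z, (ball x (1 / 10)).indicator (posE v) z ∂ν ∂ν) +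
        ENNReal.ofReal (C₀ + K * max m₁ 0) * ν univ := by
        rw [lintegral_add_right _ measurable_const, lintegral_const_mul _ hmm, lintegral_const]
    _ ≤ _ := by
        rw [ENNReal.ofReal_mul (by positivity)]
        exact add_le_add (mul_le_mul' le_rfl hswap) (mul_le_mul' le_rfl hνu)

section

/-! ### Real integrals over the disc and the circle -/

section Integrals

variable {v w w₁ w₂ : ℂ → ℝ}

theorem intervalIntegrable_comp_bpt (hw : ContinuousOn w cdisc) (a b : ℝ) :
    IntervalIntegrable (fun θ => w (bpt θ)) volume a b :=
  (continuous_comp_bpt hw).intervalIntegrable _ _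

theorem ballInt_mono (h₁ : ContinuousOn w₁ cdisc) (h₂ : ContinuousOn w₂ cdisc)
    (h : ∀ z ∈ cdisc, w₁ z ≤ w₂ z) : ballInt w₁ ≤ ballInt w₂ :=
  setIntegral_mono_on (integrableOn_odisc h₁) (integrableOn_odisc h₂) measurableSet_odisc
    fun z hz => h z (odisc_subset_cdisc hz)

theorem circInt_mono (h₁ : ContinuousOn w₁ cdisc) (h₂ : ContinuousOn w₂ cdisc)
    (h : ∀ z ∈ cdisc, w₁ z ≤ w₂ z) : circInt w₁ ≤ circInt w₂ :=
  intervalIntegral.integral_mono_on Real.two_pi_pos.le (intervalIntegrable_comp_bpt h₁ _ _)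
    (intervalIntegrable_comp_bpt h₂ _ _) fun θ _ => h _ (bpt_mem_cdisc θ)

theorem ballInt_add (h₁ : ContinuousOn w₁ cdisc) (h₂ : ContinuousOn w₂ cdisc) :
    (ballInt fun z => w₁ z + w₂ z) = ballInt w₁ + ballInt w₂ :=
  integral_add (integrableOn_odisc h₁) (integrableOn_odisc h₂)

theorem circInt_add (h₁ : ContinuousOn w₁ cdisc) (h₂ : ContinuousOn w₂ cdisc) :
    (circInt fun z => w₁ z + w₂ z) = circInt w₁ + circInt w₂ :=
  intervalIntegral.integral_add (intervalIntegrable_comp_bpt h₁ _ _)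
    (intervalIntegrable_comp_bpt h₂ _ _)

theorem ballInt_const_mul (c : ℝ) (w : ℂ → ℝ) : (ballInt fun z => c * w z) = c * ballInt w :=
  integral_const_mul _ _

theorem circInt_const_mul (c : ℝ) (w : ℂ → ℝ) : (circInt fun z => c * w z) = c * circInt w :=
  intervalIntegral.integral_const_mul _ _

theorem ballInt_congr (h : ∀ z ∈ odisc, w₁ z = w₂ z) : ballInt w₁ = ballInt w₂ :=
  setIntegral_congr_fun measurableSet_odisc h

theorem circInt_congr (h : ∀ z ∈ bdry, w₁ z = w₂ z) : circInt w₁ = circInt w₂ :=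
  intervalIntegral.integral_congr fun θ _ => h _ (bpt_mem_bdry θ)

theorem ballInt_const (c : ℝ) : (ballInt fun _ => c) = c * π := by
  have h : volume.real odisc = π := by
    rw [measureReal_def, odisc, Complex.volume_ball]; simp
  rw [ballInt, setIntegral_const, h, smul_eq_mul, mul_comm]

theorem circInt_const (c : ℝ) : (circInt fun _ => c) = c * (2 * π) := by
  simp [circInt, mul_comm]

/-- The integral of `w` against the conformal measure of `v`. -/
def wInt (v w : ℂ → ℝ) : ℝ :=
  (ballInt fun z => w z * Real.exp (2 * v z)) + circInt fun z => w z * Real.exp (v z)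

theorem wInt_mono (hv : ContinuousOn v cdisc) (h₁ : ContinuousOn w₁ cdisc)
    (h₂ : ContinuousOn w₂ cdisc) (h : ∀ z ∈ cdisc, w₁ z ≤ w₂ z) : wInt v w₁ ≤ wInt v w₂ :=
  add_le_add (ballInt_mono (by fun_prop) (by fun_prop) fun z hz =>
      mul_le_mul_of_nonneg_right (h z hz) (Real.exp_nonneg _))
    (circInt_mono (by fun_prop) (by fun_prop) fun z hz =>
      mul_le_mul_of_nonneg_right (h z hz) (Real.exp_nonneg _))

theorem wInt_nonneg (h : ∀ z ∈ cdisc, 0 ≤ w z) : 0 ≤ wInt v w :=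
  add_nonneg (ballInt_nonneg fun z hz => mul_nonneg (h z hz) (Real.exp_nonneg _))
    (circInt_nonneg fun z hz => mul_nonneg (h z hz) (Real.exp_nonneg _))

theorem wInt_add (hv : ContinuousOn v cdisc) (h₁ : ContinuousOn w₁ cdisc)
    (h₂ : ContinuousOn w₂ cdisc) : (wInt v fun z => w₁ z + w₂ z) = wInt v w₁ + wInt v w₂ := by
  simp only [wInt, add_mul]
  rw [ballInt_add (by fun_prop) (by fun_prop), circInt_add (by fun_prop) (by fun_prop)]
  ring

theorem wInt_const_mul (c : ℝ) : (wInt v fun z => c * w z) = c * wInt v w := by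
  simp only [wInt, mul_assoc]
  rw [ballInt_const_mul, circInt_const_mul]; ring

theorem wInt_const (c : ℝ) : (wInt v fun _ => c) = c * mass v := by
  have := wInt_const_mul (v := v) (w := fun _ => 1) c
  simpa [wInt, mass] using this

theorem lintegral_muM_eq_wInt (hv : ContinuousOn v cdisc) (hw : ContinuousOn w cdisc)
    (h0 : ∀ z ∈ cdisc, 0 ≤ w z) :
    ∫⁻ z, ENNReal.ofReal (w (crefl z)) ∂(muM v) = ENNReal.ofReal (wInt v w) :=
  lintegral_muM_ofReal hv hw h0

theorem mass_nonneg (v : ℂ → ℝ) : 0 ≤ mass v := by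
  have := wInt_nonneg (v := v) (w := fun _ => 1) fun _ _ => zero_le_one
  rwa [wInt_const, one_mul] at this

end Integrals

theorem neg_mul_exp_le_one (x : ℝ) : -x * Real.exp x ≤ 1 := by
  have h1 := Real.add_one_le_exp (-x)
  have h2 : Real.exp (-x) * Real.exp x = 1 := by rw [← Real.exp_add]; simp
  nlinarith [Real.exp_pos x]

/-- The positive part in terms of the mean and the oscillation. -/
theorem wInt_posPart_le {v : ℂ → ℝ} (hv : ContinuousOn v cdisc) (m : ℝ) :
    (wInt v fun z => max (v z) 0) ≤ m * mass v + (wInt v fun z => |v z - m|) + 3 * π := by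
  have key : ∀ k : ℝ, 1 ≤ k → ∀ x : ℝ, max x 0 * Real.exp (k * x) ≤
      (m + |x - m|) * Real.exp (k * x) + 1 := by
    intro k hk x
    have he := Real.exp_pos (k * x)
    have h1 := le_abs_self (x - m)
    have h2 := neg_mul_exp_le_one (k * x)
    rcases le_total x 0 with hx | hx
    · rw [max_eq_right hx]
      have h3 : -x * Real.exp (k * x) ≤ 1 := by nlinarith
      nlinarith
    · rw [max_eq_left hx]; nlinarith
  have hp : ContinuousOn (fun z => max (v z) 0) cdisc := ContinuousOn.sup hv continuousOn_const
  have hd : ContinuousOn (fun z => m + |v z - m|) cdisc := by fun_prop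
  have hb : (ballInt fun z => max (v z) 0 * Real.exp (2 * v z)) ≤
      (ballInt fun z => (m + |v z - m|) * Real.exp (2 * v z)) + 1 * π := by
    rw [← ballInt_const, ← ballInt_add (by fun_prop) (by fun_prop)]
    exact ballInt_mono (by fun_prop) (by fun_prop) fun z _ => key 2 (by norm_num) (v z)
  have hc : (circInt fun z => max (v z) 0 * Real.exp (v z)) ≤
      (circInt fun z => (m + |v z - m|) * Real.exp (v z)) + 1 * (2 * π) := by
    rw [← circInt_const, ← circInt_add (by fun_prop) (by fun_prop)]
    exact circInt_mono (by fun_prop) (by fun_prop) fun z _ => by simpa using key 1 le_rfl (v z)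
  have h1 : (wInt v fun z => m + |v z - m|) = m * mass v + wInt v fun z => |v z - m| := by
    rw [wInt_add hv continuousOn_const (by fun_prop), wInt_const]
  rw [← h1]
  unfold wInt
  linarith

theorem ball_four_ae_subset : (ball (0 : ℂ) 4 : Set ℂ) ≤ᵐ[volume] (odisc ∪ annul : Set ℂ) := by
  have h0 : volume (sphere (0 : ℂ) 1) = 0 := Measure.addHaar_sphere _ _ _
  have h1 : ∀ᵐ z : ℂ, z ∉ sphere (0 : ℂ) 1 := measure_eq_zero_iff_ae_notMem.1 h0
  filter_upwards [h1] with z hz hz4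
  have h4 : ‖z‖ < 4 := by simpa using (show z ∈ ball (0 : ℂ) 4 from hz4)
  have h3 : ‖z‖ ≠ 1 := by simpa using hz
  rcases lt_or_gt_of_ne h3 with h | h
  · exact Or.inl (by simpa [odisc] using h)
  · exact Or.inr ⟨h, h4⟩

theorem lintegral_ball_four_le (F : ℂ → ℝ≥0∞) :
    ∫⁻ y in ball 0 4, F y ≤ (∫⁻ y in odisc, F y) + ∫⁻ y in annul, F y :=
  (lintegral_mono' (Measure.restrict_mono_ae ball_four_ae_subset) le_rfl).trans
    (lintegral_union_le _ _ _)

theorem odisc_subset_ball_four : odisc ⊆ ball (0 : ℂ) 4 := ball_subset_ball (by norm_num)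

theorem lintegral_gE_sq_ball_le {v : ℂ → ℝ} (hv : ContDiffOn ℝ 1 v cdisc) :
    ∫⁻ y in ball 0 4, gE v y ^ 2 ≤ ENNReal.ofReal (2 * dirich v) := by
  refine (lintegral_ball_four_le _).trans ?_
  rw [two_mul, ENNReal.ofReal_add (dirich_nonneg v) (dirich_nonneg v)]
  exact add_le_add (lintegral_gE_sq_odisc hv).le (lintegral_gE_sq_annul_le hv)

/-- Oscillation of `v` in terms of the potentials of the inner and the outer part of its
conformal measure. -/
theorem wInt_abs_sub_cmean_le {v : ℂ → ℝ} (hv : ContDiffOn ℝ 1 v cdisc) {Ni Nb : ℝ}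
    (hi : ∫⁻ y in ball 0 4, (∫⁻ x in closedBall 0 (9 / 10), rdist x y ∂(muM v)) ^ 2 ≤
      ENNReal.ofReal Ni)
    (hb : ∫⁻ y in ball 0 4, (∫⁻ x in (closedBall 0 (9 / 10))ᶜ, rdist x y ∂(muM v)) ^ 2 ≤
      ENNReal.ofReal Nb) :
    2 * π * (wInt v fun z => |v z - cmean v|) ≤
      √(dirich v) * √Ni + √(2 * dirich v) * √Nb + 96 * mass v * √(dirich v) := by
  have hvc := hv.continuousOn
  have := isFiniteMeasure_muM hvc
  have hM := mass_nonneg v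
  set μ := muM v with hμ
  set A := closedBall (0 : ℂ) (9 / 10) with hA
  have hAm : MeasurableSet A := isClosed_closedBall.measurableSet
  have hgm := measurable_gE hv
  have hpm : ∀ ν : Measure ℂ, SFinite ν → Measurable fun y => ∫⁻ x, rdist x y ∂ν := fun ν _ =>
    (measurable_rdist.comp measurable_swap).lintegral_prod_right'
  set Vi : ℂ → ℝ≥0∞ := fun y => ∫⁻ x in A, rdist x y ∂μ with hVi
  set Vb : ℂ → ℝ≥0∞ := fun y => ∫⁻ x in Aᶜ, rdist x y ∂μ with hVb
  have hVim : Measurable Vi := hpm _ inferInstance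
  have hVbm : Measurable Vb := hpm _ inferInstance
  have hd := dirich_nonneg v
  have h1 : ∫⁻ x, ENNReal.ofReal (2 * π * |v (crefl x) - cmean v|) ∂μ ≤
      ∫⁻ x, ((∫⁻ y in ball 0 4, gE v y * rdist x y) + ENNReal.ofReal (16 * √(dirich v))) ∂μ := by
    refine lintegral_mono_ae ((ae_mem_cdisc v).mono fun x hx => ?_)
    rw [crefl_of_mem hx]
    exact abs_sub_cmean_le' hv hx
  have h2 : ∫⁻ x, ENNReal.ofReal (2 * π * |v (crefl x) - cmean v|) ∂μ =
      ENNReal.ofReal (2 * π * wInt v fun z => |v z - cmean v|) := by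
    rw [← wInt_const_mul]
    exact lintegral_muM_eq_wInt hvc (w := fun z => 2 * π * |v z - cmean v|) (by fun_prop)
      fun z _ => by positivity
  have h3 : ∫⁻ x, (∫⁻ y in ball 0 4, gE v y * rdist x y) ∂μ = ∫⁻ y in ball 0 4, gE v y * (Vi y + Vb y) := by
    rw [lintegral_lintegral_swap]
    · refine lintegral_congr fun y => ?_
      rw [lintegral_const_mul _ (measurable_rdist_left y), hVi, hVb,
        ← lintegral_add_compl (fun x => rdist x y) hAm]
    · exact ((hgm.comp measurable_snd).mul measurable_rdist).aemeasurable
  have h4 : ∫⁻ y in ball 0 4, gE v y * Vb y ≤ ENNReal.ofReal (√(2 * dirich v) * √Nb) :=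
    lintegral_mul_le_sqrt _ hgm hVbm (lintegral_gE_sq_ball_le hv) hb
  have h5 : ∫⁻ y in odisc, gE v y * Vi y ≤ ENNReal.ofReal (√(dirich v) * √Ni) :=
    lintegral_mul_le_sqrt _ hgm hVim (lintegral_gE_sq_odisc hv).le
      ((lintegral_mono_set odisc_subset_ball_four).trans hi)
  have h6 : ∫⁻ y in annul, gE v y * Vi y ≤ ENNReal.ofReal (80 * mass v * √(dirich v)) := by
    have hV : ∀ y ∈ annul, gE v y * Vi y ≤ gE v y * ENNReal.ofReal (10 * mass v) := by
      intro y hy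
      refine mul_le_mul' le_rfl ?_
      calc Vi y ≤ ∫⁻ x in A, ENNReal.ofReal 10 ∂μ := by
            refine setLIntegral_mono measurable_const fun x hx => ?_
            have hx' : ‖x‖ ≤ 9 / 10 := by simpa [hA] using hx
            have hxy : (1 : ℝ) / 10 ≤ ‖x - y‖ := by
              have := norm_sub_norm_le y x
              rw [norm_sub_rev] at this
              linarith [hy.1]
            have := rdist_le_ofReal (by norm_num) hxy
            simpa using this
        _ ≤ ENNReal.ofReal 10 * μ univ := by
            rw [setLIntegral_const]; exact mul_le_mul' le_rfl (measure_mono (subset_univ _))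
        _ = _ := by rw [hμ, muM_univ hvc, ← ENNReal.ofReal_mul (by norm_num)]
    refine (setLIntegral_mono (hgm.mul_const _) hV).trans ?_
    rw [lintegral_mul_const _ hgm]
    refine (mul_le_mul' (lintegral_gE_annul_le hv) le_rfl).trans ?_
    rw [← ENNReal.ofReal_mul (by positivity)]
    refine ENNReal.ofReal_le_ofReal ?_
    have h8 : √(16 * π) ≤ 8 := by
      rw [Real.sqrt_le_left (by norm_num)]; nlinarith [Real.pi_le_four]
    calc √(dirich v) * √(16 * π) * (10 * mass v) ≤ √(dirich v) * 8 * (10 * mass v) := by gcongr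
      _ = _ := by ring
  have h7 : ∫⁻ y in ball 0 4, gE v y * (Vi y + Vb y) ≤
      ENNReal.ofReal (√(dirich v) * √Ni) + ENNReal.ofReal (80 * mass v * √(dirich v)) +
        ENNReal.ofReal (√(2 * dirich v) * √Nb) := by
    simp only [mul_add]
    rw [lintegral_add_right _ (show Measurable fun y => gE v y * Vb y from hgm.mul hVbm)]
    refine add_le_add ((lintegral_ball_four_le _).trans (add_le_add h5 h6)) h4
  rw [h2, lintegral_add_right _ measurable_const, h3, lintegral_const, hμ, muM_univ hvc,
    ← ENNReal.ofReal_mul (by positivity)] at h1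
  have h8 := h1.trans (add_le_add h7 le_rfl)
  rw [← ENNReal.ofReal_add (by positivity) (by positivity),
    ← ENNReal.ofReal_add (by positivity) (by positivity),
    ← ENNReal.ofReal_add (by positivity) (by positivity)] at h8
  have h9 := (ENNReal.ofReal_le_ofReal_iff (by positivity)).1 h8
  linarith

theorem sqrt_add_le_sqrt_add_sqrt {a b : ℝ} (ha : 0 ≤ a) (hb : 0 ≤ b) : √(a + b) ≤ √a + √b := by
  rw [Real.sqrt_le_left (by positivity)]
  nlinarith [Real.sq_sqrt ha, Real.sq_sqrt hb, mul_nonneg (Real.sqrt_nonneg a) (Real.sqrt_nonneg b)]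

/-- The algebra behind the lower bound for the mean. -/
theorem nonneg_of_entropy_bounds {p c M Mi Mb Xi Xb Y D C m : ℝ} (hp : 0 ≤ p) (hc : 0 ≤ c)
    (hMi : 0 ≤ Mi) (hMb : 0 ≤ Mb) (hM : Mi + Mb = M) (hXi : 0 ≤ Xi) (hXb : 0 ≤ Xb) (hD : 0 ≤ D)
    (hC : 0 ≤ C)
    (hY : 2 * π * Y ≤ D * √(p * (Mi * Xi) + C) + √2 * D * √(p * (min (c * M) Mb * Xb) + C) +
      96 * M * D)
    (hX : Xi + Xb ≤ m * M + Y + 3 * π) :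
    0 ≤ m * M + p * (1 + c) * M * D ^ 2 / (16 * π ^ 2) + (3 * √C + 96 * M) * D + 3 * π := by
  have hM0 : 0 ≤ M := by linarith
  set κ := min (c * M) Mb with hκ
  have hκ0 : 0 ≤ κ := le_min (by positivity) hMb
  have hκ1 : κ ≤ c * M := min_le_left _ _
  have hκ2 : κ ≤ Mb := min_le_right _ _
  have h1 : √(p * (Mi * Xi) + C) ≤ √(p * (Mi * Xi)) + √C :=
    sqrt_add_le_sqrt_add_sqrt (by positivity) hC
  have h2 : √(p * (κ * Xb) + C) ≤ √(p * (κ * Xb)) + √C :=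
    sqrt_add_le_sqrt_add_sqrt (by positivity) hC
  set X := Xi + Xb with hXdef
  have hX0 : 0 ≤ X := by positivity
  have h3 : √(p * (Mi * Xi)) + √2 * √(p * (κ * Xb)) ≤ √(p * ((1 + c) * M * X)) := by
    rw [← Real.sqrt_mul zero_le_two]
    refine Real.le_sqrt_of_sq_le ?_
    have e1 := Real.sq_sqrt (show 0 ≤ p * (Mi * Xi) by positivity)
    have e2 := Real.sq_sqrt (show 0 ≤ 2 * (p * (κ * Xb)) by positivity)
    have e3 : 2 * (√(p * (Mi * Xi)) * √(2 * (p * (κ * Xb)))) ≤ p * (Mi * Xb + 2 * κ * Xi) := by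
      rw [← Real.sqrt_mul (by positivity)]
      have : √(p * (Mi * Xi) * (2 * (p * (κ * Xb)))) = √((p * (Mi * Xb)) * (p * (2 * κ * Xi))) := by
        congr 1; ring
      rw [this, Real.sqrt_mul (by positivity)]
      have f1 := Real.sq_sqrt (show 0 ≤ p * (Mi * Xb) by positivity)
      have f2 := Real.sq_sqrt (show 0 ≤ p * (2 * κ * Xi) by positivity)
      nlinarith [sq_nonneg (√(p * (Mi * Xb)) - √(p * (2 * κ * Xi)))]
    have e4 : p * ((Mi + 2 * κ) * X) ≤ p * ((1 + c) * M * X) := by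
      gcongr; linarith
    have e5 : p * ((Mi + 2 * κ) * X) = p * (Mi * Xi) + 2 * (p * (κ * Xb)) + p * (Mi * Xb + 2 * κ * Xi) := by
      rw [hXdef]; ring
    nlinarith
  have hs2 : √2 ≤ 2 := by rw [Real.sqrt_le_left (by norm_num)]; norm_num
  have h4 : 2 * π * Y ≤ D * √(p * ((1 + c) * M * X)) + (3 * √C + 96 * M) * D := by
    have a1 := mul_le_mul_of_nonneg_left h1 hD
    have a2 := mul_le_mul_of_nonneg_left h2 (show 0 ≤ √2 * D by positivity)
    have a3 := mul_le_mul_of_nonneg_left h3 hD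
    have a4 : √2 * (D * √C) ≤ 2 * (D * √C) := by gcongr
    nlinarith
  set q := √(p * ((1 + c) * M * X)) with hq
  have hq2 : q ^ 2 = p * ((1 + c) * M * X) := Real.sq_sqrt (by positivity)
  have hpi := Real.pi_pos
  have h5 : Y ≤ D * q / (2 * π) + (3 * √C + 96 * M) * D := by
    have b0 : 0 ≤ (3 * √C + 96 * M) * D := by positivity
    have b1 : Y ≤ (D * q + (3 * √C + 96 * M) * D) / (2 * π) := by
      rw [le_div_iff₀ (by positivity)]; linarith
    have b2 : (3 * √C + 96 * M) * D / (2 * π) ≤ (3 * √C + 96 * M) * D :=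
      div_le_self b0 (by nlinarith [Real.pi_gt_three])
    rw [add_div] at b1
    linarith
  have h6 : D * q / (2 * π) ≤ X + p * (1 + c) * M * D ^ 2 / (16 * π ^ 2) := by
    have hqq : q = √(p * (1 + c) * M) * √X := by
      rw [hq, ← Real.sqrt_mul (by positivity)]; congr 1; ring
    have c1 := Real.sq_sqrt hX0
    have c2 := Real.sq_sqrt (show 0 ≤ p * (1 + c) * M by positivity)
    have c3 := sq_nonneg (√X - D * √(p * (1 + c) * M) / (4 * π))
    have c4 : (√X - D * √(p * (1 + c) * M) / (4 * π)) ^ 2 =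
      √X ^ 2 + √(p * (1 + c) * M) ^ 2 * D ^ 2 / (16 * π ^ 2) - D * (√(p * (1 + c) * M) * √X) / (2 * π) := by
      field_simp; ring
    rw [c4, c1, c2, ← hqq] at c3
    linarith
  linarith

/-- Lower bound for the boundary mean under a concentration bound near the boundary. -/
theorem exists_cmean_lower_bound {s m₀ m₁ : ℝ} (hs : 0 < s) (hs2 : s < 2) (hm₀ : 0 < m₀) :
    ∃ C : ℝ, 0 ≤ C ∧ ∀ c : ℝ, 0 ≤ c → ∀ v : ℂ → ℝ, ContDiffOn ℝ 1 v cdisc → m₀ ≤ mass v →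
      mass v ≤ m₁ →
      (∀ y : ℂ, 9 / 10 ≤ ‖y‖ → ‖y‖ ≤ 1 → muM v (ball y (1 / 10)) ≤ ENNReal.ofReal (c * mass v)) →
      0 ≤ C + cmean v + C * √(dirich v) + (1 + c) / (4 * π * s) * dirich v := by
  obtain ⟨C₀, hC₀, hC⟩ := exists_lintegral_potential_sq_le (m₁ := m₁) hs hs2
  have hpi := Real.pi_pos
  refine ⟨(3 * √C₀ / m₀ + 96) + 3 * π / m₀, by positivity, fun c hc0 v hv hM0 hM1 hconc => ?_⟩
  have hvc := hv.continuousOn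
  have := isFiniteMeasure_muM hvc
  set M := mass v with hM
  have hMpos : 0 < M := hm₀.trans_le hM0
  set A := closedBall (0 : ℂ) (9 / 10) with hA
  have hAm : MeasurableSet A := isClosed_closedBall.measurableSet
  set μ := muM v with hμ
  set Mi := (μ A).toReal with hMi
  set Mb := (μ Aᶜ).toReal with hMb
  have hMi' : μ A = ENNReal.ofReal Mi := (ENNReal.ofReal_toReal (measure_ne_top _ _)).symm
  have hMb' : μ Aᶜ = ENNReal.ofReal Mb := (ENNReal.ofReal_toReal (measure_ne_top _ _)).symm
  have hsum : Mi + Mb = M := by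
    rw [hMi, hMb, ← ENNReal.toReal_add (measure_ne_top _ _) (measure_ne_top _ _),
      measure_add_measure_compl hAm, hμ, muM_univ hvc, ENNReal.toReal_ofReal hMpos.le]
  have hpX : ∫⁻ z, posE v z ∂μ = ENNReal.ofReal (wInt v fun z => max (v z) 0) := by
    rw [← lintegral_muM_eq_wInt hvc (ContinuousOn.sup hvc continuousOn_const) fun z _ => le_max_right _ _]
    exact lintegral_congr fun z => ofReal_eq_ofReal_max _
  have hfin : ∀ S : Set ℂ, ∫⁻ z in S, posE v z ∂μ ≠ ∞ := fun S =>
    ((setLIntegral_le_lintegral S _).trans_lt (hpX ▸ ENNReal.ofReal_lt_top)).ne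
  set Xi := (∫⁻ z in A, posE v z ∂μ).toReal with hXi
  set Xb := (∫⁻ z in Aᶜ, posE v z ∂μ).toReal with hXb
  have hXi' : ∫⁻ z in A, posE v z ∂μ = ENNReal.ofReal Xi := (ENNReal.ofReal_toReal (hfin _)).symm
  have hXb' : ∫⁻ z in Aᶜ, posE v z ∂μ = ENNReal.ofReal Xb := (ENNReal.ofReal_toReal (hfin _)).symm
  have hXsum : Xi + Xb = wInt v fun z => max (v z) 0 := by
    rw [hXi, hXb, ← ENNReal.toReal_add (hfin _) (hfin _), lintegral_add_compl _ hAm, hpX,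
      ENNReal.toReal_ofReal (wInt_nonneg fun z _ => le_max_right _ _)]
  have hMi0 : 0 ≤ Mi := ENNReal.toReal_nonneg
  have hMb0 : 0 ≤ Mb := ENNReal.toReal_nonneg
  have hXi0 : 0 ≤ Xi := ENNReal.toReal_nonneg
  have hXb0 : 0 ≤ Xb := ENNReal.toReal_nonneg
  have hκ0 : 0 ≤ min (c * M) Mb := le_min (by positivity) hMb0
  have hNi := hC v hvc hM1 A hAm (ENNReal.ofReal Mi) fun x _ =>
    hMi' ▸ measure_mono inter_subset_left
  have hNb := hC v hvc hM1 Aᶜ hAm.compl (ENNReal.ofReal (min (c * M) Mb)) fun x hx => by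
    rw [ENNReal.ofReal_min]
    refine le_min ?_ (hMb' ▸ measure_mono inter_subset_left)
    refine (measure_mono inter_subset_right).trans (hconc x ?_ ?_)
    · have := hx.1; simp only [hA, mem_compl_iff, mem_closedBall_zero_iff, not_le] at this; exact this.le
    · simpa [cdisc] using hx.2
  rw [hXi', ← ENNReal.ofReal_mul hMi0, ← ENNReal.ofReal_mul (by positivity),
    ← ENNReal.ofReal_add (by positivity) hC₀] at hNi
  rw [hXb', ← ENNReal.ofReal_mul hκ0, ← ENNReal.ofReal_mul (by positivity),
    ← ENNReal.ofReal_add (by positivity) hC₀] at hNb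
  have hY := wInt_abs_sub_cmean_le hv hNi hNb
  rw [Real.sqrt_mul zero_le_two] at hY
  have hX := wInt_posPart_le hvc (cmean v)
  rw [← hXsum] at hX
  have hfinal := nonneg_of_entropy_bounds (p := 4 * π / s) (by positivity) hc0 hMi0 hMb0 hsum hXi0 hXb0
    (Real.sqrt_nonneg (dirich v)) hC₀ hY hX
  rw [Real.sq_sqrt (dirich_nonneg v)] at hfinal
  set D := √(dirich v) with hD
  have hD0 : 0 ≤ D := Real.sqrt_nonneg _
  have e1 : 3 * π ≤ 3 * π / m₀ * M := by
    rw [div_mul_eq_mul_div, le_div_iff₀ hm₀]; gcongr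
  have e2 : (3 * √C₀ + 96 * M) * D ≤ (3 * √C₀ / m₀ + 96) * D * M := by
    have : 3 * √C₀ ≤ 3 * √C₀ / m₀ * M := by rw [div_mul_eq_mul_div, le_div_iff₀ hm₀]; gcongr
    nlinarith
  have e3 : 4 * π / s * (1 + c) * M * dirich v / (16 * π ^ 2) = (1 + c) / (4 * π * s) * dirich v * M := by
    field_simp; ring
  have e4 : 0 ≤ 3 * π / m₀ * D * M := by positivity
  have e5 : 0 ≤ (3 * √C₀ / m₀ + 96) * M := by positivity
  refine nonneg_of_mul_nonneg_left (b := M) ?_ hMpos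
  rw [e3] at hfinal
  nlinarith

end

/-! ### Higher exponential integrability -/

theorem fderivWithin_const_mul_add {u : ℂ → ℝ} (hu : ContDiffOn ℝ 1 u cdisc) (k b : ℝ) {z : ℂ}
    (hz : z ∈ cdisc) :
    fderivWithin ℝ (fun z => k * u z + b) cdisc z = k • fderivWithin ℝ u cdisc z := by
  have h := (hu.differentiableOn one_ne_zero z hz).hasFDerivWithinAt
  exact ((h.const_mul k).add_const b).fderivWithin (uniqueDiffOn_cdisc z hz)

theorem dirich_const_mul_add {u : ℂ → ℝ} (hu : ContDiffOn ℝ 1 u cdisc) (k b : ℝ) :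
    dirich (fun z => k * u z + b) = k ^ 2 * dirich u := by
  unfold dirich
  rw [← ballInt_const_mul]
  refine ballInt_congr fun z hz => ?_
  rw [fderivWithin_const_mul_add hu k b (odisc_subset_cdisc hz)]
  simp only [gsq, smul_apply, smul_eq_mul]
  ring

theorem cmean_const_mul_add {u : ℂ → ℝ} (hu : ContinuousOn u cdisc) (k b : ℝ) :
    cmean (fun z => k * u z + b) = k * cmean u + b := by
  unfold cmean
  rw [circInt_add (by fun_prop) continuousOn_const, circInt_const_mul, circInt_const]
  field_simp

theorem ballInt_pos {w : ℂ → ℝ} (hw : ContinuousOn w cdisc) (h0 : ∀ z ∈ cdisc, 0 < w z) :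
    0 < ballInt w := by
  obtain ⟨z₀, hz₀, hmin⟩ := isCompact_cdisc.exists_isMinOn ⟨0, by simp [cdisc]⟩ hw
  have h1 : (ballInt fun _ => w z₀) ≤ ballInt w :=
    ballInt_mono continuousOn_const hw fun z hz => hmin hz
  rw [ballInt_const] at h1
  exact (mul_pos (h0 z₀ hz₀) Real.pi_pos).trans_le h1

theorem circInt_pos {w : ℂ → ℝ} (hw : ContinuousOn w cdisc) (h0 : ∀ z ∈ cdisc, 0 < w z) :
    0 < circInt w := by
  obtain ⟨z₀, hz₀, hmin⟩ := isCompact_cdisc.exists_isMinOn ⟨0, by simp [cdisc]⟩ hw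
  have h1 : (circInt fun _ => w z₀) ≤ circInt w :=
    circInt_mono continuousOn_const hw fun z hz => hmin hz
  rw [circInt_const] at h1
  exact (mul_pos (h0 z₀ hz₀) Real.two_pi_pos).trans_le h1

theorem exists_exp_bound (d b : ℝ) :
    ∃ C : ℝ, 0 ≤ C ∧ ∀ u : ℂ → ℝ, ContDiffOn ℝ 1 u cdisc → dirich u ≤ d → cmean u ≤ b →
      (ballInt fun z => Real.exp (4 * u z)) ≤ C ∧ (circInt fun z => Real.exp (2 * u z)) ≤ C := by
  obtain ⟨C, hC0, hC⟩ := exists_cmean_lower_bound (s := 1) (m₀ := 1 / 2) (m₁ := 1) one_pos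
    (by norm_num) (by norm_num)
  set K := C + 2 * b + C * √(4 * d) + (1 + 1) / (4 * π * 1) * (4 * d) with hK
  refine ⟨Real.exp (2 * K) + Real.exp K, by positivity, fun u hu hd hb => ?_⟩
  have huc := hu.continuousOn
  set A := ballInt fun z => Real.exp (4 * u z) with hA
  set L := circInt fun z => Real.exp (2 * u z) with hL
  have hA0 : 0 < A := ballInt_pos (by fun_prop) fun z _ => Real.exp_pos _
  have hL0 : 0 < L := circInt_pos (by fun_prop) fun z _ => Real.exp_pos _
  set q := min (1 / √(2 * A)) (1 / (2 * L)) with hq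
  have hq0 : 0 < q := lt_min (by positivity) (by positivity)
  have hsq : √(2 * A) ^ 2 = 2 * A := Real.sq_sqrt (by positivity)
  have hs0 : 0 < √(2 * A) := by positivity
  have hqA : q ^ 2 * A ≤ 1 / 2 := by
    have h1 : q ≤ 1 / √(2 * A) := min_le_left _ _
    rw [le_div_iff₀ hs0] at h1
    have : (q * √(2 * A)) ^ 2 ≤ 1 := by
      rw [sq_le_one_iff₀ (by positivity)]; exact h1
    rw [mul_pow, hsq] at this; linarith
  have hqL : q * L ≤ 1 / 2 := by
    have h1 : q ≤ 1 / (2 * L) := min_le_right _ _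
    rw [le_div_iff₀ (by positivity)] at h1; linarith
  have hqAL : 1 / 2 ≤ q ^ 2 * A + q * L := by
    rcases min_choice (1 / √(2 * A)) (1 / (2 * L)) with h | h
    · have : q ^ 2 * A = 1 / 2 := by
        rw [hq, h, div_pow, hsq]; field_simp
      have : 0 < q * L := by positivity
      linarith
    · have : q * L = 1 / 2 := by rw [hq, h]; field_simp
      have : 0 < q ^ 2 * A := by positivity
      linarith
  set v : ℂ → ℝ := fun z => 2 * u z + Real.log q with hv
  have hvs : ContDiffOn ℝ 1 v cdisc := (contDiffOn_const.mul hu).add contDiffOn_const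
  have hmass : mass v = q ^ 2 * A + q * L := by
    rw [mass, hA, hL, ← ballInt_const_mul, ← circInt_const_mul]
    congr 1
    · refine ballInt_congr fun z _ => ?_
      rw [hv, show 2 * (2 * u z + Real.log q) = Real.log q + Real.log q + 4 * u z by ring, Real.exp_add,
        Real.exp_add, Real.exp_log hq0]; ring
    · refine circInt_congr fun z _ => ?_
      rw [hv, Real.exp_add, Real.exp_log hq0]; ring
  have h := hC 1 zero_le_one v hvs (by rw [hmass]; exact hqAL) (by rw [hmass]; linarith) fun y _ _ => by
    rw [one_mul, ← muM_univ hvs.continuousOn]; exact measure_mono (subset_univ _)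
  rw [hv, cmean_const_mul_add huc, dirich_const_mul_add hu] at h
  have hlog : -K ≤ Real.log q := by
    rw [show (2 : ℝ) ^ 2 = 4 by norm_num] at h
    have e0 : 4 * dirich u ≤ 4 * d := by linarith
    have e3 := mul_le_mul_of_nonneg_left (Real.sqrt_le_sqrt e0) hC0
    have e2 := mul_le_mul_of_nonneg_left e0 (show 0 ≤ (1 + 1) / (4 * π * 1) by positivity)
    have e4 : 0 ≤ K + Real.log q := h.trans (by rw [hK]; linarith only [e2, e3, hb])
    linarith only [e4]
  have hqK : Real.exp (-K) ≤ q := (Real.le_log_iff_exp_le hq0).1 hlog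
  have hEK : Real.exp (-K) * Real.exp K = 1 := by rw [← Real.exp_add]; simp
  have hE2 : Real.exp (2 * K) = Real.exp K ^ 2 := by rw [← Real.exp_nat_mul]; norm_num
  have hp := Real.exp_pos K
  have hp' := Real.exp_pos (-K)
  constructor
  · have h1 : Real.exp (-K) ^ 2 * A ≤ 1 / 2 := le_trans (by gcongr) hqA
    have h2 : A = Real.exp K ^ 2 * (Real.exp (-K) ^ 2 * A) := by
      rw [← mul_assoc, ← mul_pow, mul_comm (Real.exp K), hEK, one_pow, one_mul]
    rw [hE2, h2]
    nlinarith [sq_nonneg (Real.exp K)]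
  · have h1 : Real.exp (-K) * L ≤ 1 / 2 := le_trans (by gcongr) hqL
    have h2 : L = Real.exp K * (Real.exp (-K) * L) := by
      rw [← mul_assoc, mul_comm (Real.exp K), hEK, one_mul]
    rw [h2]
    nlinarith [Real.exp_pos (2 * K)]

/-! ### A cubic interpolation inequality -/

theorem wInt_mul_le_sqrt {v w₁ w₂ : ℂ → ℝ} (hv : ContinuousOn v cdisc) (h₁ : ContinuousOn w₁ cdisc)
    (h₂ : ContinuousOn w₂ cdisc) (h₁0 : ∀ z ∈ cdisc, 0 ≤ w₁ z) (h₂0 : ∀ z ∈ cdisc, 0 ≤ w₂ z) :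
    (wInt v fun z => w₁ z * w₂ z) ≤ √(wInt v fun z => w₁ z ^ 2) * √(wInt v fun z => w₂ z ^ 2) := by
  have key : ∀ {w : ℂ → ℝ}, ContinuousOn w cdisc → (∀ z ∈ cdisc, 0 ≤ w z) →
      ∫⁻ z, ENNReal.ofReal (w (crefl z)) ^ 2 ∂(muM v) ≤ ENNReal.ofReal (wInt v fun z => w z ^ 2) := by
    intro w hw hw0
    rw [← lintegral_muM_eq_wInt hv (by fun_prop) fun z hz => by positivity]
    exact (lintegral_congr fun z => (ENNReal.ofReal_pow (hw0 _ (crefl_mem z)) 2).symm).le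
  have c₁ : Continuous fun z => w₁ (crefl z) := continuous_comp_crefl h₁
  have c₂ : Continuous fun z => w₂ (crefl z) := continuous_comp_crefl h₂
  have h := lintegral_mul_le_sqrt (muM v) c₁.measurable.ennreal_ofReal c₂.measurable.ennreal_ofReal
    (key h₁ h₁0) (key h₂ h₂0)
  have h' : ∫⁻ z, ENNReal.ofReal (w₁ (crefl z)) * ENNReal.ofReal (w₂ (crefl z)) ∂(muM v) =
      ENNReal.ofReal (wInt v fun z => w₁ z * w₂ z) := by
    rw [← lintegral_muM_eq_wInt hv (by fun_prop) fun z hz => mul_nonneg (h₁0 z hz) (h₂0 z hz)]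
    exact lintegral_congr fun z => (ENNReal.ofReal_mul (h₁0 _ (crefl_mem z))).symm
  rw [h'] at h
  exact (ENNReal.ofReal_le_ofReal_iff (by positivity)).1 h

theorem lintegral_mul_sq_le {α : Type*} [MeasurableSpace α] (μ : Measure α) {f g : α → ℝ≥0∞}
    (hf : Measurable f) (hg : Measurable g) :
    (∫⁻ x, f x * g x ∂μ) ^ 2 ≤ (∫⁻ x, f x ^ 2 ∂μ) * ∫⁻ x, g x ^ 2 ∂μ := by
  have h := ENNReal.lintegral_mul_le_Lp_mul_Lq μ Real.HolderConjugate.two_two hf.aemeasurable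
    hg.aemeasurable
  simp only [ENNReal.rpow_two] at h
  refine (pow_le_pow_left' h 2).trans (le_of_eq ?_)
  rw [mul_pow, ← ENNReal.rpow_natCast, ← ENNReal.rpow_mul, ← ENNReal.rpow_natCast, ← ENNReal.rpow_mul]
  norm_num


theorem rdist_rpow_add {p q : ℝ} (hp : 0 ≤ p) (hq : 0 ≤ q) (x y : ℂ) :
    rdist x y ^ (p + q) = rdist x y ^ p * rdist x y ^ q :=
  ENNReal.rpow_add_of_nonneg _ _ hp hq

/-- Fourth power of a Riesz potential. -/
theorem riesz_pow_four_le {g : ℂ → ℝ≥0∞} (hg : Measurable g) {x : ℂ} (hx : x ∈ cdisc) :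
    (∫⁻ y in ball 0 4, g y * rdist x y) ^ 4 ≤
      ENNReal.ofReal (2 * π * (5 ^ (2 - 15 / 8 : ℝ) / (2 - 15 / 8))) ^ 2 *
        ((∫⁻ y in ball 0 4, g y ^ 2) * ∫⁻ y in ball 0 4, g y ^ 2 * rdist x y ^ (1 / 4 : ℝ)) := by
  have hr := measurable_rdist_right x
  have hrp : ∀ p : ℝ, Measurable fun y => rdist x y ^ p := fun p => hr.pow_const p
  have h1 : (∫⁻ y in ball 0 4, g y * rdist x y) ^ 2 ≤
      (∫⁻ y in ball 0 4, g y * (g y * rdist x y ^ (1 / 8 : ℝ))) *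
        ENNReal.ofReal (2 * π * (5 ^ (2 - 15 / 8 : ℝ) / (2 - 15 / 8))) := by
    have e : ∀ y, g y * rdist x y = g y * rdist x y ^ (1 / 16 : ℝ) * rdist x y ^ (15 / 16 : ℝ) := by
      intro y
      rw [mul_assoc, ← rdist_rpow_add (by norm_num) (by norm_num)]
      norm_num
    simp_rw [e]
    refine (lintegral_mul_sq_le _ (hg.mul (hrp _)) (hrp _)).trans (mul_le_mul' (le_of_eq ?_) ?_)
    · refine lintegral_congr fun y => ?_
      rw [Pi.mul_apply, mul_pow, sq (rdist x y ^ (1 / 16 : ℝ)), ← rdist_rpow_add (by norm_num) (by norm_num), sq,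
        mul_assoc]
      norm_num
    · refine le_trans (le_of_eq ?_) (rdist_rpow_lintegral_le x
        (measurableSet_ball (x := 0) (ε := 4)) (p := 15 / 8) (b := 5)
        (by norm_num) (by norm_num) (by norm_num) fun y hy => ?_)
      · refine lintegral_congr fun y => ?_
        rw [sq, ← rdist_rpow_add (by norm_num) (by norm_num)]
        norm_num
      · have h1 : ‖x‖ ≤ 1 := by simpa [cdisc] using hx
        have h2 : ‖y‖ < 4 := by simpa using hy
        linarith [norm_sub_le x y]
  have h2 : (∫⁻ y in ball 0 4, g y * (g y * rdist x y ^ (1 / 8 : ℝ))) ^ 2 ≤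
      (∫⁻ y in ball 0 4, g y ^ 2) * ∫⁻ y in ball 0 4, g y ^ 2 * rdist x y ^ (1 / 4 : ℝ) := by
    refine (lintegral_mul_sq_le _ hg (hg.mul (hrp _))).trans (mul_le_mul' le_rfl (le_of_eq ?_))
    refine lintegral_congr fun y => ?_
    rw [Pi.mul_apply, mul_pow, sq (rdist x y ^ (1 / 8 : ℝ)), ← rdist_rpow_add (by norm_num) (by norm_num)]
    norm_num
  calc (∫⁻ y in ball 0 4, g y * rdist x y) ^ 4
      = ((∫⁻ y in ball 0 4, g y * rdist x y) ^ 2) ^ 2 := by rw [← pow_mul]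
    _ ≤ _ := pow_le_pow_left' h1 2
    _ ≤ _ := by
      rw [mul_pow, mul_comm]
      exact mul_le_mul' le_rfl h2

theorem ennreal_mul_le_sq_add_sq (a b : ℝ≥0∞) : a * b ≤ a ^ 2 + b ^ 2 := by
  rcases le_total a b with h | h
  · exact (mul_le_mul' h le_rfl).trans ((sq b).symm.le.trans le_add_self)
  · exact (mul_le_mul' le_rfl h).trans ((sq a).symm.le.trans le_self_add)

theorem cdens_sq (k : ℝ) (v : ℂ → ℝ) (z : ℂ) : cdens k v z ^ 2 = cdens (2 * k) v z := by
  rw [cdens, cdens, ← ENNReal.ofReal_pow (Real.exp_nonneg _), ← Real.exp_nat_mul]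
  congr 2; push_cast; ring

theorem exists_lintegral_rdist_rpow_muM_le (a : ℝ) :
    ∃ C : ℝ, 0 ≤ C ∧ ∀ u : ℂ → ℝ, ContinuousOn u cdisc →
      (ballInt fun z => Real.exp (4 * u z)) ≤ a → (circInt fun z => Real.exp (2 * u z)) ≤ a →
      ∀ y ∈ ball (0 : ℂ) 4, ∫⁻ x, rdist x y ^ (1 / 4 : ℝ) ∂(muM u) ≤ ENNReal.ofReal C := by
  obtain ⟨C, hC0, hC⟩ := exists_rdist_rpow_circM_le (p := 1 / 2) (by norm_num) (by norm_num)
  set K : ℝ := 2 * π * (5 ^ (2 - 1 / 2 : ℝ) / (2 - 1 / 2)) with hK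
  have hK0 : 0 ≤ K := by
    have : (0 : ℝ) < 5 ^ (2 - 1 / 2 : ℝ) := by positivity
    have hpi := Real.pi_pos
    rw [hK]; norm_num; positivity
  refine ⟨max a 0 + K + (max a 0 + C), by positivity, fun u hu ha hl y hy => ?_⟩
  have hr : ∀ p : ℝ, Measurable fun x => rdist x y ^ p := fun p => (measurable_rdist_left y).pow_const p
  have hd := measurable_cdens hu
  have hpt : ∀ k x, cdens k u x * rdist x y ^ (1 / 4 : ℝ) ≤ cdens (2 * k) u x + rdist x y ^ (1 / 2 : ℝ) := by
    intro k x
    refine (ennreal_mul_le_sq_add_sq _ _).trans (le_of_eq ?_)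
    rw [cdens_sq, sq (rdist x y ^ _), ← rdist_rpow_add (by norm_num) (by norm_num)]
    norm_num
  rw [lintegral_muM hu (hr _), ENNReal.ofReal_add (by positivity) (by positivity),
    ENNReal.ofReal_add (by positivity) hK0, ENNReal.ofReal_add (by positivity) hC0]
  refine add_le_add ?_ ?_
  · refine (lintegral_mono (hpt 2)).trans ?_
    rw [lintegral_add_right _ (hr _)]
    refine add_le_add ?_ ?_
    · refine le_trans (le_of_eq ?_) (ENNReal.ofReal_le_ofReal (ha.trans (le_max_left _ _)))
      rw [ofReal_ballInt (by fun_prop) fun z _ => Real.exp_nonneg _]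
      refine setLIntegral_congr_fun measurableSet_odisc fun z hz => ?_
      simp only [cdens, crefl_of_mem (odisc_subset_cdisc hz)]
      norm_num
    · simp_rw [rdist_comm _ y]
      refine rdist_rpow_lintegral_le y measurableSet_odisc (by norm_num) (by norm_num) (by norm_num)
        fun x hx => ?_
      have h1 : ‖x‖ < 1 := by simpa [odisc] using hx
      have h2 : ‖y‖ < 4 := by simpa using hy
      linarith [norm_sub_le y x]
  · refine (lintegral_mono (hpt 1)).trans ?_
    rw [lintegral_add_right _ (hr _)]
    refine add_le_add ?_ ?_
    · refine le_trans (le_of_eq ?_) (ENNReal.ofReal_le_ofReal (hl.trans (le_max_left _ _)))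
      have hc : ContinuousOn (fun z => Real.exp (2 * u z)) cdisc := by fun_prop
      rw [ofReal_circInt (continuous_comp_bpt hc) fun θ => Real.exp_nonneg _,
        lintegral_circM (hd _)]
      refine lintegral_congr fun θ => ?_
      simp only [cdens, crefl_of_mem (bpt_mem_cdisc θ), mul_one]
    · simp_rw [rdist_comm _ y]
      exact hC y

theorem exists_wInt_sub_cmean_pow_four_le (a m₁ : ℝ) :
    ∃ C : ℝ, 0 ≤ C ∧ ∀ u : ℂ → ℝ, ContinuousOn u cdisc → mass u ≤ m₁ →
      (ballInt fun z => Real.exp (4 * u z)) ≤ a → (circInt fun z => Real.exp (2 * u z)) ≤ a →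
      ∀ φ : ℂ → ℝ, ContDiffOn ℝ 1 φ cdisc →
      (wInt u fun z => (φ z - cmean φ) ^ 4) ≤ C * dirich φ ^ 2 := by
  obtain ⟨C₂, hC₂0, hC₂⟩ := exists_lintegral_rdist_rpow_muM_le a
  set C₁ : ℝ := 2 * π * (5 ^ (2 - 15 / 8 : ℝ) / (2 - 15 / 8)) with hC₁
  have hC₁0 : 0 ≤ C₁ := by
    have : (0 : ℝ) < 5 ^ (2 - 15 / 8 : ℝ) := by positivity
    have hpi := Real.pi_pos
    rw [hC₁]; norm_num; positivity
  refine ⟨8 * (C₁ ^ 2 * (4 * C₂) + 16 ^ 4 * max m₁ 0), by positivity,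
    fun u hu hm ha hl φ hφ => ?_⟩
  have := isFiniteMeasure_muM hu
  have hφc := hφ.continuousOn
  set μ := muM u with hμ
  set d := dirich φ with hd
  have hd0 : 0 ≤ d := dirich_nonneg φ
  have hg := measurable_gE hφ
  set T : ℂ → ℝ≥0∞ := fun x => ∫⁻ y in ball 0 4, gE φ y * rdist x y with hT
  have hTm : Measurable T := by
    have : Measurable fun p : ℂ × ℂ => gE φ p.2 * rdist p.1 p.2 :=
      (hg.comp measurable_snd).mul measurable_rdist
    exact this.lintegral_prod_right'
  have hT4 : ∫⁻ x, T x ^ 4 ∂μ ≤ ENNReal.ofReal (C₁ ^ 2 * (4 * C₂) * d ^ 2) := by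
    have hm1 : Measurable fun p : ℂ × ℂ => gE φ p.2 ^ 2 * rdist p.1 p.2 ^ (1 / 4 : ℝ) :=
      ((hg.comp measurable_snd).pow_const 2).mul (measurable_rdist.pow_const _)
    calc ∫⁻ x, T x ^ 4 ∂μ ≤ ∫⁻ x, ENNReal.ofReal C₁ ^ 2 * (ENNReal.ofReal (2 * d) *
          ∫⁻ y in ball 0 4, gE φ y ^ 2 * rdist x y ^ (1 / 4 : ℝ)) ∂μ := by
          refine lintegral_mono_ae ((ae_mem_cdisc u).mono fun x hx => ?_)
          refine (riesz_pow_four_le hg hx).trans (mul_le_mul' le_rfl (mul_le_mul' ?_ le_rfl))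
          exact lintegral_gE_sq_ball_le hφ
      _ = ENNReal.ofReal C₁ ^ 2 * (ENNReal.ofReal (2 * d) *
          ∫⁻ y in ball 0 4, ∫⁻ x, gE φ y ^ 2 * rdist x y ^ (1 / 4 : ℝ) ∂μ) := by
          have hm2 : Measurable fun x => ∫⁻ y in ball 0 4, gE φ y ^ 2 * rdist x y ^ (1 / 4 : ℝ) :=
            hm1.lintegral_prod_right'
          rw [lintegral_const_mul _ (hm2.const_mul _), lintegral_const_mul _ hm2,
            lintegral_lintegral_swap hm1.aemeasurable]
      _ ≤ ENNReal.ofReal C₁ ^ 2 * (ENNReal.ofReal (2 * d) * (ENNReal.ofReal (2 * d) * ENNReal.ofReal C₂)) := by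
          refine mul_le_mul' le_rfl (mul_le_mul' le_rfl ?_)
          refine (setLIntegral_mono ((hg.pow_const 2).mul_const (ENNReal.ofReal C₂)) fun y hy => ?_).trans ?_
          · rw [lintegral_const_mul _ ((measurable_rdist_left y).pow_const _)]
            exact mul_le_mul' le_rfl (hC₂ u hu ha hl y hy)
          · rw [lintegral_mul_const _ (hg.pow_const 2)]
            exact mul_le_mul' (lintegral_gE_sq_ball_le hφ) le_rfl
      _ = _ := by
          rw [← ENNReal.ofReal_pow hC₁0, ← ENNReal.ofReal_mul (by positivity),
            ← ENNReal.ofReal_mul (by positivity), ← ENNReal.ofReal_mul (by positivity)]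
          congr 1; ring
  have hpt : ∀ᵐ x ∂μ, ENNReal.ofReal ((φ (crefl x) - cmean φ) ^ 4) ≤
      8 * (T x ^ 4 + ENNReal.ofReal (16 ^ 4 * d ^ 2)) := by
    filter_upwards [ae_mem_cdisc u] with x hx
    rw [crefl_of_mem hx]
    have h1 := abs_sub_cmean_le' hφ hx
    have h2 : ENNReal.ofReal |φ x - cmean φ| ≤ T x + ENNReal.ofReal (16 * √d) := by
      refine le_trans (ENNReal.ofReal_le_ofReal ?_) h1
      nlinarith [abs_nonneg (φ x - cmean φ), Real.pi_gt_three]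
    have h3 : ENNReal.ofReal ((φ x - cmean φ) ^ 4) = ENNReal.ofReal |φ x - cmean φ| ^ 4 := by
      rw [← ENNReal.ofReal_pow (abs_nonneg _), Even.pow_abs (by decide)]
    have h4 : ENNReal.ofReal (16 ^ 4 * d ^ 2) = ENNReal.ofReal (16 * √d) ^ 4 := by
      rw [← ENNReal.ofReal_pow (by positivity), mul_pow, show √d ^ 4 = (√d ^ 2) ^ 2 by ring,
        Real.sq_sqrt hd0]
    rw [h3, h4]
    refine (pow_le_pow_left' h2 4).trans ?_
    have h5 := ENNReal.rpow_add_le_mul_rpow_add_rpow (T x) (ENNReal.ofReal (16 * √d))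
      (p := 4) (by norm_num)
    have h6 : (2 : ℝ≥0∞) ^ ((4 : ℝ) - 1) = 8 := by
      rw [show (4 : ℝ) - 1 = ((3 : ℕ) : ℝ) by norm_num, ENNReal.rpow_natCast]; norm_num
    rw [h6] at h5
    exact_mod_cast h5
  have hfin := lintegral_mono_ae hpt
  rw [lintegral_muM_eq_wInt hu (w := fun z => (φ z - cmean φ) ^ 4) (by fun_prop) fun z _ => by positivity,
    lintegral_const_mul _ (by fun_prop), lintegral_add_right _ measurable_const, lintegral_const, hμ,
    muM_univ hu] at hfin
  have h8 : (8 : ℝ≥0∞) = ENNReal.ofReal 8 := by norm_num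
  have hM0 := mass_nonneg u
  have hfin2 := hfin.trans (mul_le_mul' le_rfl (add_le_add hT4 le_rfl))
  rw [← ENNReal.ofReal_mul (by positivity), ← ENNReal.ofReal_add (by positivity) (by positivity), h8,
    ← ENNReal.ofReal_mul (by norm_num)] at hfin2
  refine ((ENNReal.ofReal_le_ofReal_iff (by positivity)).1 hfin2).trans ?_
  have : mass u ≤ max m₁ 0 := hm.trans (le_max_left _ _)
  have h9 : 16 ^ 4 * d ^ 2 * mass u ≤ 16 ^ 4 * d ^ 2 * max m₁ 0 := by gcongr
  linarith

/-- Interpolation of the cubic integral between the `L²` norm and the Dirichlet energy. -/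
theorem exists_wInt_cubic_le {m₀ : ℝ} (a m₁ : ℝ) (hm₀ : 0 < m₀) :
    ∃ C : ℝ, 0 ≤ C ∧ ∀ u : ℂ → ℝ, ContinuousOn u cdisc → m₀ ≤ mass u → mass u ≤ m₁ →
      (ballInt fun z => Real.exp (4 * u z)) ≤ a → (circInt fun z => Real.exp (2 * u z)) ≤ a →
      ∀ φ : ℂ → ℝ, ContDiffOn ℝ 1 φ cdisc →
      (wInt u fun z => |φ z| ^ 3) ≤
        C * √(wInt u fun z => φ z ^ 2) * (dirich φ + wInt u fun z => φ z ^ 2) := by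
  obtain ⟨C, hC0, hC⟩ := exists_wInt_sub_cmean_pow_four_le a m₁
  set K := (2 + 2 * √(max m₁ 0) * √C) / m₀ with hK
  have hK0 : 0 ≤ K := by positivity
  refine ⟨√(8 * C + 8 * K ^ 2 * max m₁ 0), by positivity, fun u hu hm hm' ha hl φ hφ => ?_⟩
  have hφc := hφ.continuousOn
  have h4 := hC u hu hm' ha hl φ hφ
  set d := dirich φ with hd
  have hd0 : 0 ≤ d := dirich_nonneg φ
  set G := wInt u fun z => φ z ^ 2 with hG
  have hG0 : 0 ≤ G := wInt_nonneg fun z _ => sq_nonneg _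
  set b := cmean φ with hb
  have hM0 : 0 ≤ mass u := mass_nonneg u
  have h2 : (wInt u fun z => (φ z - b) ^ 2) ≤ √(max m₁ 0) * √C * d := by
    have h := wInt_mul_le_sqrt hu (w₁ := fun _ => 1) (w₂ := fun z => (φ z - b) ^ 2) continuousOn_const
      (by fun_prop) (fun _ _ => zero_le_one) fun _ _ => sq_nonneg _
    simp only [one_mul, one_pow, ← pow_mul] at h
    rw [wInt_const, one_mul] at h
    refine h.trans ?_
    rw [mul_assoc]
    refine mul_le_mul (Real.sqrt_le_sqrt (hm'.trans (le_max_left _ _))) ?_ (Real.sqrt_nonneg _)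
      (Real.sqrt_nonneg _)
    refine (Real.sqrt_le_sqrt h4).trans (le_of_eq ?_)
    rw [Real.sqrt_mul hC0, Real.sqrt_sq hd0]
  have hb2 : b ^ 2 ≤ K * (d + G) := by
    have h : (wInt u fun _ => b ^ 2) ≤ wInt u fun z => 2 * φ z ^ 2 + 2 * (φ z - b) ^ 2 :=
      wInt_mono hu continuousOn_const (by fun_prop) fun z _ => by nlinarith [sq_nonneg (2 * φ z - b)]
    rw [wInt_const, wInt_add hu (by fun_prop) (by fun_prop), wInt_const_mul, wInt_const_mul] at h
    rw [hK, div_mul_eq_mul_div, le_div_iff₀ hm₀]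
    have e1 : b ^ 2 * m₀ ≤ b ^ 2 * mass u := by gcongr
    have e2 : 0 ≤ √(max m₁ 0) * √C * G := by positivity
    linarith
  have hφ4 : (wInt u fun z => (φ z ^ 2) ^ 2) ≤ (8 * C + 8 * K ^ 2 * max m₁ 0) * (d + G) ^ 2 := by
    have h : (wInt u fun z => (φ z ^ 2) ^ 2) ≤ wInt u fun z => 8 * (φ z - b) ^ 4 + 8 * b ^ 4 :=
      wInt_mono hu (by fun_prop) (by fun_prop) fun z _ => by
        nlinarith [sq_nonneg (φ z - 2 * b), sq_nonneg (φ z * (φ z - 2 * b)),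
          sq_nonneg (b * (φ z - 2 * b)), sq_nonneg ((φ z - b) ^ 2 - b ^ 2)]
    rw [wInt_add hu (by fun_prop) (by fun_prop), wInt_const_mul, wInt_const] at h
    have hb4 : b ^ 4 ≤ K ^ 2 * (d + G) ^ 2 := by
      rw [← mul_pow, show b ^ 4 = (b ^ 2) ^ 2 by ring]
      exact pow_le_pow_left₀ (sq_nonneg b) hb2 2
    have hd2 : d ^ 2 ≤ (d + G) ^ 2 := pow_le_pow_left₀ hd0 (by linarith) 2
    have f1 : C * d ^ 2 ≤ C * (d + G) ^ 2 := by gcongr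
    have f2 : 8 * b ^ 4 * mass u ≤ 8 * (K ^ 2 * (d + G) ^ 2) * max m₁ 0 := by
      gcongr; exact hm'.trans (le_max_left _ _)
    linarith
  have h := wInt_mul_le_sqrt hu (w₁ := fun z => |φ z|) (w₂ := fun z => φ z ^ 2) (by fun_prop)
    (by fun_prop) (fun _ _ => abs_nonneg _) fun _ _ => sq_nonneg _
  simp only [sq_abs] at h
  have e3 : (wInt u fun z => |φ z| ^ 3) = wInt u fun z => |φ z| * φ z ^ 2 := by
    congr 1; ext z; rw [← sq_abs]; ring
  rw [e3]
  refine h.trans ?_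
  rw [mul_comm (√(8 * C + _)), mul_assoc]
  refine mul_le_mul_of_nonneg_left ?_ (Real.sqrt_nonneg _)
  refine (Real.sqrt_le_sqrt hφ4).trans (le_of_eq ?_)
  rw [Real.sqrt_mul (by positivity), Real.sqrt_sq (by positivity)]

/-! ### The divergence theorem on the disc -/

theorem ballInt_eq_integral_polar (w : ℂ → ℝ) :
    ballInt w = ∫ p in Icc ((0 : ℝ), -π) (1, π), p.1 * w (p.1 * bpt p.2) := by
  rw [ballInt, ← integral_indicator measurableSet_odisc, ← Complex.integral_comp_polarCoord_symm,
    polarCoord_target]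
  have hset : (Icc ((0 : ℝ), -π) (1, π)) =ᵐ[volume] (Ioo (0 : ℝ) 1 ×ˢ Ioo (-π) π : Set (ℝ × ℝ)) := by
    rw [← Icc_prod_Icc, Measure.volume_eq_prod]
    exact Measure.set_prod_ae_eq Ioo_ae_eq_Icc.symm Ioo_ae_eq_Icc.symm
  rw [setIntegral_congr_set hset]
  have hsub : (Ioo (0 : ℝ) 1 ×ˢ Ioo (-π) π : Set (ℝ × ℝ)) ⊆ Ioi 0 ×ˢ Ioo (-π) π :=
    prod_mono Ioo_subset_Ioi_self le_rfl
  rw [setIntegral_eq_of_subset_of_forall_sdiff_eq_zero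
    (measurableSet_Ioi.prod measurableSet_Ioo) hsub]
  · refine setIntegral_congr_fun (measurableSet_Ioo.prod measurableSet_Ioo) fun p hp => ?_
    simp only [Complex.polarCoord_symm_apply, smul_eq_mul]
    rw [indicator_of_mem, bpt_eq_cos_sin]
    have : ‖(p.1 : ℂ) * bpt p.2‖ < 1 := by
      rw [norm_mul, norm_bpt, mul_one, Complex.norm_real, Real.norm_of_nonneg hp.1.1.le]
      exact hp.1.2
    rw [bpt_eq_cos_sin] at this
    simpa [odisc] using this
  · intro p hp
    simp only [Complex.polarCoord_symm_apply, smul_eq_mul]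
    rw [indicator_of_notMem, mul_zero]
    have h0 : 0 < p.1 := hp.1.1
    have h1 : 1 ≤ p.1 := by
      by_contra h
      exact hp.2 ⟨⟨h0, not_le.1 h⟩, hp.1.2⟩
    have : 1 ≤ ‖(p.1 : ℂ) * bpt p.2‖ := by
      rwa [norm_mul, norm_bpt, mul_one, Complex.norm_real, Real.norm_of_nonneg h0.le]
    rw [bpt_eq_cos_sin] at this
    simpa [odisc] using this

theorem circInt_eq_integral_symm (w : ℂ → ℝ) : circInt w = ∫ θ in (-π)..π, w (bpt θ) := by
  have hp : Function.Periodic (fun θ => w (bpt θ)) (2 * π) := fun θ => by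
    simp only [bpt_add_two_pi]
  have := hp.intervalIntegral_add_eq 0 (-π)
  rw [zero_add, show -π + 2 * π = π by ring] at this
  exact this

theorem bpt_re (θ : ℝ) : (bpt θ).re = Real.cos θ := by
  rw [bpt, Complex.exp_ofReal_mul_I_re]

theorem bpt_im (θ : ℝ) : (bpt θ).im = Real.sin θ := by
  rw [bpt, Complex.exp_ofReal_mul_I_im]

theorem hasDerivAt_bpt (θ : ℝ) : HasDerivAt bpt (Complex.I * bpt θ) θ := by
  have h : HasDerivAt (fun θ : ℝ => (θ : ℂ) * Complex.I) Complex.I θ := by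
    simpa using (Complex.ofRealCLM.hasDerivAt (x := θ)).mul_const Complex.I
  have := h.cexp
  rw [mul_comm] at this
  exact this

theorem mul_bpt_mem_cdisc {r θ : ℝ} (h0 : 0 ≤ r) (h1 : r ≤ 1) : (r : ℂ) * bpt θ ∈ cdisc := by
  simpa [cdisc, abs_of_nonneg h0] using h1

theorem ballInt_divergence {X Y : ℂ → ℝ} (hX : ContDiffOn ℝ 1 X cdisc) (hY : ContDiffOn ℝ 1 Y cdisc) :
    (ballInt fun z => fderivWithin ℝ X cdisc z 1 + fderivWithin ℝ Y cdisc z Complex.I) =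
      circInt fun z => z.re * X z + z.im * Y z := by
  set γ : ℝ × ℝ → ℂ := fun p => (p.1 : ℂ) * bpt p.2 with hγ
  have hγc : Continuous γ := by
    have := continuous_bpt
    fun_prop
  have hγm : MapsTo γ (Icc ((0 : ℝ), -π) (1, π)) cdisc := fun p hp =>
    mul_bpt_mem_cdisc hp.1.1 hp.2.1
  have hXc : ContinuousOn (fun p => X (γ p)) (Icc ((0 : ℝ), -π) (1, π)) :=
    hX.continuousOn.comp hγc.continuousOn hγm
  have hYc : ContinuousOn (fun p => Y (γ p)) (Icc ((0 : ℝ), -π) (1, π)) :=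
    hY.continuousOn.comp hγc.continuousOn hγm
  set P : ℝ × ℝ → ℝ := fun p => p.1 * (Real.cos p.2 * X (γ p) + Real.sin p.2 * Y (γ p)) with hP
  set Q : ℝ × ℝ → ℝ := fun p => -Real.sin p.2 * X (γ p) + Real.cos p.2 * Y (γ p) with hQ
  have hγd : ∀ p, DifferentiableAt ℝ γ p := fun p => by
    have h1 : DifferentiableAt ℝ (fun p : ℝ × ℝ => bpt p.2) p :=
      (hasDerivAt_bpt p.2).differentiableAt.comp p differentiableAt_snd
    have h2 : DifferentiableAt ℝ (fun p : ℝ × ℝ => (p.1 : ℂ)) p :=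
      Complex.ofRealCLM.differentiableAt.comp p differentiableAt_fst
    exact h2.mul h1
  have hmem : ∀ p ∈ Ioo (0 : ℝ) 1 ×ˢ Ioo (-π) π, ‖γ p‖ < 1 := fun p hp => by
    simpa [hγ, abs_of_pos hp.1.1] using hp.1.2
  have hXd : ∀ p ∈ Ioo (0 : ℝ) 1 ×ˢ Ioo (-π) π, DifferentiableAt ℝ (fun p => X (γ p)) p := fun p hp =>
    (hasFDerivAt_of_norm_lt hX (hmem p hp)).differentiableAt.comp p (hγd p)
  have hYd : ∀ p ∈ Ioo (0 : ℝ) 1 ×ˢ Ioo (-π) π, DifferentiableAt ℝ (fun p => Y (γ p)) p := fun p hp =>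
    (hasFDerivAt_of_norm_lt hY (hmem p hp)).differentiableAt.comp p (hγd p)
  have hPd : ∀ p ∈ Ioo (0 : ℝ) 1 ×ˢ Ioo (-π) π, DifferentiableAt ℝ P p := fun p hp => by
    exact differentiableAt_fst.mul (((Real.differentiable_cos.comp differentiable_snd p).mul
      (hXd p hp)).add ((Real.differentiable_sin.comp differentiable_snd p).mul (hYd p hp)))
  have hQd : ∀ p ∈ Ioo (0 : ℝ) 1 ×ˢ Ioo (-π) π, DifferentiableAt ℝ Q p := fun p hp => by
    exact ((Real.differentiable_sin.comp differentiable_snd p).neg.mul (hXd p hp)).add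
      ((Real.differentiable_cos.comp differentiable_snd p).mul (hYd p hp))
  have hdiv : ∀ p ∈ Ioo (0 : ℝ) 1 ×ˢ Ioo (-π) π, fderiv ℝ P p (1, 0) + fderiv ℝ Q p (0, 1) =
      p.1 * (fderivWithin ℝ X cdisc (γ p) 1 + fderivWithin ℝ Y cdisc (γ p) Complex.I) := by
    rintro ⟨r, θ⟩ hp
    have hl1 : HasDerivAt (fun s : ℝ => (s, θ)) ((1 : ℝ), (0 : ℝ)) r :=
      (hasDerivAt_id r).prodMk (hasDerivAt_const r θ)
    have hl2 : HasDerivAt (fun s : ℝ => (r, s)) ((0 : ℝ), (1 : ℝ)) θ :=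
      (hasDerivAt_const θ r).prodMk (hasDerivAt_id θ)
    have e1 := (hPd _ hp).hasFDerivAt.comp_hasDerivAt r hl1
    have e2 := (hQd _ hp).hasFDerivAt.comp_hasDerivAt θ hl2
    have g1 : HasDerivAt (fun s : ℝ => γ (s, θ)) (bpt θ) r := by
      simpa using (Complex.ofRealCLM.hasDerivAt (x := r)).mul_const (bpt θ)
    have g2 : HasDerivAt (fun s : ℝ => γ (r, s)) (r * (Complex.I * bpt θ)) θ :=
      (hasDerivAt_bpt θ).const_mul (r : ℂ)
    have x1 := (hasFDerivAt_of_norm_lt hX (hmem _ hp)).comp_hasDerivAt r g1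
    have x2 := (hasFDerivAt_of_norm_lt hX (hmem _ hp)).comp_hasDerivAt θ g2
    have y1 := (hasFDerivAt_of_norm_lt hY (hmem _ hp)).comp_hasDerivAt r g1
    have y2 := (hasFDerivAt_of_norm_lt hY (hmem _ hp)).comp_hasDerivAt θ g2
    have E1 := (hasDerivAt_id r).mul ((x1.const_mul (Real.cos θ)).add (y1.const_mul (Real.sin θ)))
    have E2 := ((Real.hasDerivAt_sin θ).neg.mul x2).add ((Real.hasDerivAt_cos θ).mul y2)
    rw [e1.unique E1, e2.unique E2, clm_apply_eq _ (bpt θ), clm_apply_eq _ (bpt θ),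
      clm_apply_eq _ (r * (Complex.I * bpt θ)), clm_apply_eq _ (r * (Complex.I * bpt θ))]
    simp only [Complex.mul_re, Complex.mul_im, Complex.I_re, Complex.I_im, Complex.ofReal_re,
      Complex.ofReal_im, bpt_re, bpt_im, Pi.add_apply, Function.comp_apply, id_eq, Pi.neg_apply]
    have := Real.sin_sq_add_cos_sq θ
    linear_combination (r * (fderivWithin ℝ X cdisc (γ (r, θ)) 1 +
      fderivWithin ℝ Y cdisc (γ (r, θ)) Complex.I)) * this
  have hset : (Ioo (0 : ℝ) 1 ×ˢ Ioo (-π) π : Set (ℝ × ℝ)) =ᵐ[volume] (Icc ((0 : ℝ), -π) (1, π)) := by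
    rw [← Icc_prod_Icc, Measure.volume_eq_prod]
    exact Measure.set_prod_ae_eq Ioo_ae_eq_Icc Ioo_ae_eq_Icc
  have hdc : ContinuousOn (fun p => p.1 * (fderivWithin ℝ X cdisc (γ p) 1 +
      fderivWithin ℝ Y cdisc (γ p) Complex.I)) (Icc ((0 : ℝ), -π) (1, π)) := by
    have h1 := (continuousOn_fderivWithin_cdisc hX).comp hγc.continuousOn hγm
    have h2 := (continuousOn_fderivWithin_cdisc hY).comp hγc.continuousOn hγm
    exact continuousOn_fst.mul ((h1.clm_apply continuousOn_const).add (h2.clm_apply continuousOn_const))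
  have hmeas : MeasurableSet (Ioo (0 : ℝ) 1 ×ˢ Ioo (-π) π) := measurableSet_Ioo.prod measurableSet_Ioo
  have h_int : IntegrableOn (fun p => fderiv ℝ P p (1, 0) + fderiv ℝ Q p (0, 1))
      (Icc ((0 : ℝ), -π) (1, π)) := by
    rw [← integrableOn_congr_set_ae hset]
    refine IntegrableOn.congr_fun ?_ (fun p hp => (hdiv p hp).symm) hmeas
    rw [integrableOn_congr_set_ae hset]
    exact hdc.integrableOn_compact isCompact_Icc
  have hPc : ContinuousOn P (Icc ((0 : ℝ), -π) (1, π)) :=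
    continuousOn_fst.mul (((Real.continuous_cos.comp continuous_snd).continuousOn.mul hXc).add
      ((Real.continuous_sin.comp continuous_snd).continuousOn.mul hYc))
  have hQc : ContinuousOn Q (Icc ((0 : ℝ), -π) (1, π)) :=
    ((Real.continuous_sin.comp continuous_snd).neg.continuousOn.mul hXc).add
      ((Real.continuous_cos.comp continuous_snd).continuousOn.mul hYc)
  have key := integral_divergence_prod_Icc_of_hasFDerivAt_of_le P Q (fderiv ℝ P) (fderiv ℝ Q)
    ((0 : ℝ), -π) (1, π) ⟨zero_le_one, by linarith [Real.pi_pos]⟩ hPc hQc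
    (fun p hp => (hPd p hp).hasFDerivAt) (fun p hp => (hQd p hp).hasFDerivAt) h_int
  rw [← setIntegral_congr_set hset, setIntegral_congr_fun hmeas hdiv, setIntegral_congr_set hset] at key
  rw [ballInt_eq_integral_polar, circInt_eq_integral_symm]
  refine key.trans ?_
  have hper : ∀ r, γ (r, π) = γ (r, -π) := fun r => by
    have := bpt_add_two_pi (-π)
    rw [show -π + 2 * π = π by ring] at this
    simp [hγ, this]
  have hb : ∀ θ, P (1, θ) = (bpt θ).re * X (bpt θ) + (bpt θ).im * Y (bpt θ) := fun θ => by
    simp [hP, hγ, bpt_re, bpt_im]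
  simp only [hb]
  simp [hQ, hP, hper]

/-- Green's first identity on the disc. -/
theorem ballInt_green {η v : ℂ → ℝ} (hη : ContDiffOn ℝ 1 η cdisc) (hv : ContDiffOn ℝ 2 v cdisc) :
    (ballInt fun z => η z * lapW v z) + (ballInt fun z =>
      fderivWithin ℝ η cdisc z 1 * fderivWithin ℝ v cdisc z 1 +
        fderivWithin ℝ η cdisc z Complex.I * fderivWithin ℝ v cdisc z Complex.I) =
      circInt fun z => η z * nder v z := by
  have hd : ContDiffOn ℝ 1 (fderivWithin ℝ v cdisc) cdisc :=
    hv.fderivWithin uniqueDiffOn_cdisc (by norm_num)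
  have h1 : ContDiffOn ℝ 1 (fun z => fderivWithin ℝ v cdisc z 1) cdisc := hd.clm_apply contDiffOn_const
  have h2 : ContDiffOn ℝ 1 (fun z => fderivWithin ℝ v cdisc z Complex.I) cdisc :=
    hd.clm_apply contDiffOn_const
  have key := ballInt_divergence (hη.mul h1) (hη.mul h2)
  have hc0 := continuousOn_fderivWithin_cdisc hη
  have hc := continuousOn_fderivWithin_cdisc (hv.of_le one_le_two)
  have hl : ContinuousOn (lapW v) cdisc :=
    ((continuousOn_fderivWithin_cdisc h1).clm_apply continuousOn_const).add
      ((continuousOn_fderivWithin_cdisc h2).clm_apply continuousOn_const)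
  have hηl : ContinuousOn (fun z => η z * lapW v z) cdisc := hη.continuousOn.mul hl
  rw [← ballInt_add hηl (by fun_prop)]
  have e : (circInt fun z => η z * nder v z) = circInt fun z => z.re * (η z * fderivWithin ℝ v cdisc z 1) +
      z.im * (η z * fderivWithin ℝ v cdisc z Complex.I) := by
    refine circInt_congr fun z _ => ?_
    rw [nder, clm_apply_eq _ z]; ring
  rw [e]
  refine Eq.trans (ballInt_congr fun z hz => ?_) key
  have hzc := odisc_subset_cdisc hz
  have hu := uniqueDiffOn_cdisc z hzc
  have d0 := (hη.differentiableOn one_ne_zero z hzc)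
  rw [fderivWithin_fun_mul hu d0 (h1.differentiableOn one_ne_zero z hzc),
    fderivWithin_fun_mul hu d0 (h2.differentiableOn one_ne_zero z hzc)]
  simp only [lapW, add_apply, smul_apply, smul_eq_mul]
  ring

section

/-! ### Möbius transformations of the disc -/

/-- The denominator of the disc automorphism that sends `0` to `a`. -/
def mden (a z : ℂ) : ℂ := 1 + (starRingEnd ℂ) a * z

/-- The disc automorphism `z ↦ (z + a) / (1 + ā z)`. -/
def mob (a z : ℂ) : ℂ := (z + a) / mden a z

/-- The logarithm of the conformal factor of `mob a`. -/
def mpsi (a z : ℂ) : ℝ := Real.log ((1 - ‖a‖ ^ 2) / ‖mden a z‖ ^ 2)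

variable {a b z : ℂ}

theorem mem_cdisc_iff : z ∈ cdisc ↔ ‖z‖ ≤ 1 := by simp [cdisc]

theorem mem_odisc_iff : z ∈ odisc ↔ ‖z‖ < 1 := by simp [odisc]

theorem mem_bdry_iff : z ∈ bdry ↔ ‖z‖ = 1 := by simp [bdry]

theorem norm_conj_mul_lt (ha : ‖a‖ < 1) (hz : z ∈ cdisc) : ‖(starRingEnd ℂ) a * z‖ < 1 := by
  rw [norm_mul, Complex.norm_conj]
  rw [mem_cdisc_iff] at hz
  nlinarith [norm_nonneg a, norm_nonneg z]

theorem mden_re_pos (ha : ‖a‖ < 1) (hz : z ∈ cdisc) : 0 < (mden a z).re := by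
  have h := norm_conj_mul_lt ha hz
  have h2 := (abs_le.1 (Complex.abs_re_le_norm ((starRingEnd ℂ) a * z))).1
  rw [mden, Complex.add_re, Complex.one_re]
  linarith

theorem mden_ne_zero (ha : ‖a‖ < 1) (hz : z ∈ cdisc) : mden a z ≠ 0 := fun h => by
  have := mden_re_pos ha hz
  rw [h] at this
  simp at this

theorem norm_mden_pos (ha : ‖a‖ < 1) (hz : z ∈ cdisc) : 0 < ‖mden a z‖ :=
  norm_pos_iff.2 (mden_ne_zero ha hz)

theorem one_sub_norm_sq_pos (ha : ‖a‖ < 1) : 0 < 1 - ‖a‖ ^ 2 := by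
  nlinarith [norm_nonneg a]

theorem exp_mpsi (ha : ‖a‖ < 1) (hz : z ∈ cdisc) :
    Real.exp (mpsi a z) = (1 - ‖a‖ ^ 2) / ‖mden a z‖ ^ 2 :=
  Real.exp_log (div_pos (one_sub_norm_sq_pos ha) (pow_pos (norm_mden_pos ha hz) 2))

theorem norm_mden_sq_sub (a z : ℂ) :
    ‖mden a z‖ ^ 2 - ‖z + a‖ ^ 2 = (1 - ‖a‖ ^ 2) * (1 - ‖z‖ ^ 2) := by
  simp only [mden, Complex.sq_norm, Complex.normSq_apply, Complex.add_re, Complex.add_im,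
    Complex.mul_re, Complex.mul_im, Complex.conj_re, Complex.conj_im, Complex.one_re, Complex.one_im]
  ring

theorem one_sub_norm_mob_sq (ha : ‖a‖ < 1) (hz : z ∈ cdisc) :
    1 - ‖mob a z‖ ^ 2 = (1 - ‖a‖ ^ 2) * (1 - ‖z‖ ^ 2) / ‖mden a z‖ ^ 2 := by
  have := norm_mden_pos ha hz
  rw [← norm_mden_sq_sub, mob, norm_div]
  field_simp

theorem mob_mem_cdisc (ha : ‖a‖ < 1) (hz : z ∈ cdisc) : mob a z ∈ cdisc := by
  have h := one_sub_norm_mob_sq ha hz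
  have hz' := mem_cdisc_iff.1 hz
  have : 0 ≤ 1 - ‖mob a z‖ ^ 2 := by
    rw [h]
    have h1 : 0 ≤ 1 - ‖z‖ ^ 2 := by nlinarith [norm_nonneg z]
    have := one_sub_norm_sq_pos ha
    positivity
  rw [mem_cdisc_iff]
  nlinarith [norm_nonneg (mob a z)]

theorem mob_mem_odisc (ha : ‖a‖ < 1) (hz : z ∈ odisc) : mob a z ∈ odisc := by
  have h := one_sub_norm_mob_sq ha (odisc_subset_cdisc hz)
  have : 0 < 1 - ‖mob a z‖ ^ 2 := by
    rw [h]
    exact div_pos (mul_pos (one_sub_norm_sq_pos ha) (one_sub_norm_sq_pos (mem_odisc_iff.1 hz)))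
      (pow_pos (norm_mden_pos ha (odisc_subset_cdisc hz)) 2)
  rw [mem_odisc_iff]
  nlinarith [norm_nonneg (mob a z)]

/-- The denominators of composed disc automorphisms. -/
theorem mden_mob (ha : ‖a‖ < 1) (hb : ‖b‖ < 1) (hz : z ∈ cdisc) :
    mden b (mob a z) * mden a z = (1 + (starRingEnd ℂ) b * a) * mden (mob a b) z := by
  have h1 := mden_ne_zero ha hz
  have hb' : b ∈ cdisc := mem_cdisc_iff.2 hb.le
  have h2 := mden_ne_zero ha hb'
  have h3 : (starRingEnd ℂ) (mden a b) ≠ 0 := by simpa using h2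
  have h4 : (starRingEnd ℂ) (mden a b) = 1 + (starRingEnd ℂ) b * a := by
    simp [mden, mul_comm]
  rw [h4] at h3
  have e1 : mden b (mob a z) = 1 + (starRingEnd ℂ) b * ((z + a) / mden a z) := rfl
  have e2 : mden (mob a b) z = 1 + ((starRingEnd ℂ) b + (starRingEnd ℂ) a) /
      (1 + (starRingEnd ℂ) b * a) * z := by
    rw [← h4]; simp [mob, mden]
  rw [e1, e2]
  field_simp
  rw [mden]; ring

theorem mpsi_mob (ha : ‖a‖ < 1) (hb : ‖b‖ < 1) (hz : z ∈ cdisc) :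
    mpsi b (mob a z) + mpsi a z = mpsi (mob a b) z := by
  have hb' : b ∈ cdisc := mem_cdisc_iff.2 hb.le
  have hc : ‖mob a b‖ < 1 := mem_odisc_iff.1 (mob_mem_odisc ha (mem_odisc_iff.2 hb))
  apply Real.exp_injective
  rw [Real.exp_add, exp_mpsi hb (mob_mem_cdisc ha hz), exp_mpsi ha hz, exp_mpsi hc hz,
    one_sub_norm_mob_sq ha hb']
  have key := congrArg norm (mden_mob ha hb hz)
  have h4 : ‖1 + (starRingEnd ℂ) b * a‖ = ‖mden a b‖ := by
    rw [← Complex.norm_conj (mden a b)]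
    congr 1
    simp [mden, mul_comm]
  rw [norm_mul, norm_mul, h4] at key
  have p1 := norm_mden_pos ha hz
  have p2 := norm_mden_pos ha hb'
  have p3 := norm_mden_pos hc hz
  have p4 := norm_mden_pos hb (mob_mem_cdisc ha hz)
  rw [div_mul_div_comm, div_div, div_eq_div_iff (by positivity) (by positivity), ← mul_pow, ← mul_pow, key]
  ring

theorem mpsi_zero (z : ℂ) : mpsi 0 z = 0 := by simp [mpsi, mden]

theorem mob_neg_self (a : ℂ) : mob a (-a) = 0 := by simp [mob]

theorem mpsi_neg_mob (ha : ‖a‖ < 1) (hz : z ∈ cdisc) : mpsi (-a) (mob a z) = -mpsi a z := by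
  have := mpsi_mob ha (b := -a) (by simpa using ha) hz
  rw [mob_neg_self, mpsi_zero] at this
  linarith

theorem mob_neg_mob (ha : ‖a‖ < 1) (hz : z ∈ cdisc) : mob (-a) (mob a z) = z := by
  have h1 := mden_ne_zero ha hz
  have h2 : mden (-a) (mob a z) * mden a z = ((1 - ‖a‖ ^ 2 : ℝ) : ℂ) := by
    have := mden_mob ha (b := -a) (by simpa using ha) hz
    rw [this, mob_neg_self]
    simp only [mden, map_zero, zero_mul, add_zero, mul_one, map_neg, neg_mul]
    rw [mul_comm, Complex.mul_conj, Complex.normSq_eq_norm_sq]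
    push_cast; ring
  have h3 : ((1 - ‖a‖ ^ 2 : ℝ) : ℂ) ≠ 0 := by
    exact_mod_cast (one_sub_norm_sq_pos ha).ne'
  have h4 : mden (-a) (mob a z) ≠ 0 := fun h => h3 (by rw [← h2, h, zero_mul])
  rw [show mob (-a) (mob a z) = (mob a z + -a) / mden (-a) (mob a z) from rfl, div_eq_iff h4]
  have h5 : mden (-a) (mob a z) = ((1 - ‖a‖ ^ 2 : ℝ) : ℂ) / mden a z := by rw [← h2]; field_simp
  rw [h5, mob]
  field_simp
  have h6 : (starRingEnd ℂ) a * a = (‖a‖ : ℂ) ^ 2 := by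
    rw [mul_comm, Complex.mul_conj, Complex.normSq_eq_norm_sq]; push_cast; ring
  push_cast
  rw [← h6, mden]; ring

theorem hasDerivAt_mden (a z : ℂ) : HasDerivAt (mden a) ((starRingEnd ℂ) a) z := by
  exact (((hasDerivAt_id z).const_mul ((starRingEnd ℂ) a)).const_add 1).congr_deriv (mul_one _)

theorem hasDerivAt_mob (ha : ‖a‖ < 1) (hz : z ∈ cdisc) :
    HasDerivAt (mob a) (((1 - ‖a‖ ^ 2 : ℝ) : ℂ) / mden a z ^ 2) z := by
  have h := ((hasDerivAt_id z).add_const a).div (hasDerivAt_mden a z) (mden_ne_zero ha hz)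
  refine h.congr_deriv ?_
  congr 1
  have h6 : (starRingEnd ℂ) a * a = (‖a‖ : ℂ) ^ 2 := by
    rw [mul_comm, Complex.mul_conj, Complex.normSq_eq_norm_sq]; push_cast; ring
  push_cast
  rw [← h6, mden, id]; ring

theorem norm_deriv_mob (ha : ‖a‖ < 1) (hz : z ∈ cdisc) :
    ‖((1 - ‖a‖ ^ 2 : ℝ) : ℂ) / mden a z ^ 2‖ = Real.exp (mpsi a z) := by
  rw [exp_mpsi ha hz, norm_div, norm_pow, Complex.norm_real,
    Real.norm_of_nonneg (one_sub_norm_sq_pos ha).le]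

theorem det_smul_one_complex (c : ℂ) : (c • (1 : ℂ →L[ℝ] ℂ)).det = ‖c‖ ^ 2 := by
  rw [ContinuousLinearMap.det, ← LinearMap.det_toMatrix Complex.basisOneI, Matrix.det_fin_two]
  simp [LinearMap.toMatrix_apply, Complex.sq_norm, Complex.normSq_apply]

theorem ballInt_comp_mob (ha : ‖a‖ < 1) (w : ℂ → ℝ) :
    (ballInt fun z => w (mob a z) * Real.exp (2 * mpsi a z)) = ballInt w := by
  have hna : ‖-a‖ < 1 := by simpa using ha
  have himg : mob a '' odisc = odisc := by
    ext y
    constructor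
    · rintro ⟨x, hx, rfl⟩
      exact mob_mem_odisc ha hx
    · intro hy
      refine ⟨mob (-a) y, mob_mem_odisc hna hy, ?_⟩
      have := mob_neg_mob hna (odisc_subset_cdisc hy)
      rwa [neg_neg] at this
  have hinj : InjOn (mob a) odisc := fun x hx y hy hxy => by
    rw [← mob_neg_mob ha (odisc_subset_cdisc hx), hxy, mob_neg_mob ha (odisc_subset_cdisc hy)]
  have key := integral_image_eq_integral_abs_det_fderiv_smul volume measurableSet_odisc
    (fun x hx => (hasDerivAt_mob ha (odisc_subset_cdisc hx)).complexToReal_fderiv.hasFDerivWithinAt)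
    hinj w
  rw [himg] at key
  rw [ballInt, ballInt, key]
  refine setIntegral_congr_fun measurableSet_odisc fun x hx => ?_
  simp only [det_smul_one_complex, norm_deriv_mob ha (odisc_subset_cdisc hx), smul_eq_mul]
  rw [abs_of_nonneg (by positivity), ← Real.exp_nat_mul]
  push_cast; ring

/-- A lift of the boundary action of `mob a` to the real line. -/
def mlift (a : ℂ) (θ : ℝ) : ℝ := θ - 2 * (Complex.log (mden a (bpt θ))).im

theorem hasDerivAt_mlift (ha : ‖a‖ < 1) (θ : ℝ) :
    HasDerivAt (mlift a) (Real.exp (mpsi a (bpt θ))) θ := by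
  have hz := bpt_mem_cdisc θ
  have h1 : HasDerivAt (fun θ => mden a (bpt θ)) ((starRingEnd ℂ) a * (Complex.I * bpt θ)) θ :=
    (hasDerivAt_mden a (bpt θ)).scomp θ (hasDerivAt_bpt θ) |>.congr_deriv (by simp [mul_comm])
  have h2 := h1.clog_real (Or.inl (mden_re_pos ha hz))
  have h3 := (Complex.imCLM.hasFDerivAt.comp_hasDerivAt θ h2).const_mul 2
  have h4 := (hasDerivAt_id θ).sub h3
  refine h4.congr_deriv ?_
  rw [exp_mpsi ha hz]
  have hp := norm_mden_pos ha hz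
  simp only [Complex.imCLM_apply]
  have e : ((starRingEnd ℂ) a * (Complex.I * bpt θ) / mden a (bpt θ)).im =
      ((starRingEnd ℂ) a * bpt θ * (starRingEnd ℂ) (mden a (bpt θ))).re / ‖mden a (bpt θ)‖ ^ 2 := by
    rw [div_eq_mul_inv, Complex.inv_def, Complex.normSq_eq_norm_sq, ← mul_assoc, Complex.im_mul_ofReal,
      div_eq_mul_inv]
    congr 1
    simp only [Complex.mul_im, Complex.mul_re, Complex.I_re, Complex.I_im]; ring
  rw [e, eq_div_iff (by positivity), sub_mul, mul_assoc, div_mul_cancel₀ _ (by positivity)]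
  have hn : (bpt θ).re ^ 2 + (bpt θ).im ^ 2 = 1 := by
    rw [bpt_re, bpt_im]; exact Real.cos_sq_add_sin_sq θ
  simp only [mden, Complex.sq_norm, Complex.normSq_apply, Complex.add_re, Complex.add_im,
    Complex.mul_re, Complex.mul_im, Complex.conj_re, Complex.conj_im, Complex.one_re, Complex.one_im]
  linear_combination (-(a.re ^ 2 + a.im ^ 2)) * hn

theorem bpt_mlift (ha : ‖a‖ < 1) (θ : ℝ) : bpt (mlift a θ) = mob a (bpt θ) := by
  have hz := bpt_mem_cdisc θ
  have hd := mden_ne_zero ha hz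
  set q := Complex.log (mden a (bpt θ)) with hq
  have h1 : Complex.exp q = mden a (bpt θ) := Complex.exp_log hd
  have h2 : Complex.exp ((starRingEnd ℂ) q) = (starRingEnd ℂ) (mden a (bpt θ)) := by
    rw [Complex.exp_conj, h1]
  have h3 : ((mlift a θ : ℝ) : ℂ) * Complex.I = θ * Complex.I + ((starRingEnd ℂ) q - q) := by
    rw [mlift, ← hq]
    apply Complex.ext <;> simp
    ring
  rw [bpt, h3, Complex.exp_add, Complex.exp_sub, h1, h2, mob, mul_div_assoc']
  congr 1
  have hb : bpt θ * (starRingEnd ℂ) (bpt θ) = 1 := by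
    rw [Complex.mul_conj, Complex.normSq_eq_norm_sq, norm_bpt]; simp
  change bpt θ * _ = _
  simp only [mden, map_add, map_one, map_mul, Complex.conj_conj]
  linear_combination a * hb

theorem continuous_mden (a : ℂ) : Continuous (mden a) := by unfold mden; fun_prop

theorem continuousOn_mob (ha : ‖a‖ < 1) : ContinuousOn (mob a) cdisc := fun _ hz =>
  (hasDerivAt_mob ha hz).continuousAt.continuousWithinAt

theorem continuousOn_mpsi (ha : ‖a‖ < 1) : ContinuousOn (mpsi a) cdisc := by
  unfold mpsi
  have hd := continuous_mden a
  refine ContinuousOn.log (continuousOn_const.div (by fun_prop) fun z hz => ?_) fun z hz => ?_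
  · exact (pow_pos (norm_mden_pos ha hz) 2).ne'
  · exact (div_pos (one_sub_norm_sq_pos ha) (pow_pos (norm_mden_pos ha hz) 2)).ne'

theorem circInt_comp_mob (ha : ‖a‖ < 1) {w : ℂ → ℝ} (hw : ContinuousOn w cdisc) :
    (circInt fun z => w (mob a z) * Real.exp (mpsi a z)) = circInt w := by
  have hc := continuous_comp_bpt hw
  have he : Continuous fun θ => Real.exp (mpsi a (bpt θ)) :=
    Real.continuous_exp.comp (continuous_comp_bpt (continuousOn_mpsi ha))
  have key := intervalIntegral.integral_comp_mul_deriv (a := 0) (b := 2 * π)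
    (fun θ _ => hasDerivAt_mlift ha θ) he.continuousOn hc
  have h2 : mlift a (2 * π) = mlift a 0 + 2 * π := by
    have := bpt_add_two_pi 0
    rw [zero_add] at this
    simp only [mlift, this]; ring
  have hp : Function.Periodic (fun θ => w (bpt θ)) (2 * π) := fun θ => by
    simp only [bpt_add_two_pi]
  rw [h2, hp.intervalIntegral_add_eq (mlift a 0) 0, zero_add] at key
  rw [circInt, circInt, ← key]
  simp [bpt_mlift ha]

end

section

variable {a b z : ℂ}

/-! ### Möbius invariance of the Liouville energy -/

/-- The Liouville energy `½ ∫_B |∇u|² + ∫_{∂B} u`. -/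
def liou (u : ℂ → ℝ) : ℝ := dirich u / 2 + circInt u

/-- The pull-back of a conformal factor under a disc automorphism. -/
def pull (a : ℂ) (u : ℂ → ℝ) (z : ℂ) : ℝ := u (mob a z) + mpsi a z

theorem contDiff_mden (a : ℂ) (n : WithTop ℕ∞) : ContDiff ℝ n (mden a) := by
  unfold mden; fun_prop

theorem contDiffOn_mob (ha : ‖a‖ < 1) (n : WithTop ℕ∞) : ContDiffOn ℝ n (mob a) cdisc := by
  unfold mob
  refine ContDiffOn.mul (by fun_prop) (ContDiffOn.inv ((contDiff_mden a n).contDiffOn) ?_)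
  exact fun z hz => mden_ne_zero ha hz

theorem contDiffOn_mpsi (ha : ‖a‖ < 1) (n : WithTop ℕ∞) : ContDiffOn ℝ n (mpsi a) cdisc := by
  unfold mpsi
  refine ContDiffOn.log (ContDiffOn.div contDiffOn_const
    ((contDiff_mden a n).norm_sq ℝ).contDiffOn fun z hz => ?_) fun z hz => ?_
  · exact (pow_pos (norm_mden_pos ha hz) 2).ne'
  · exact (div_pos (one_sub_norm_sq_pos ha) (pow_pos (norm_mden_pos ha hz) 2)).ne'

theorem contDiffOn_comp_mob (ha : ‖a‖ < 1) {u : ℂ → ℝ} (hu : ContDiffOn ℝ 1 u cdisc) :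
    ContDiffOn ℝ 1 (fun z => u (mob a z)) cdisc :=
  hu.comp (contDiffOn_mob ha 1) fun _ hz => mob_mem_cdisc ha hz

theorem contDiffOn_pull (ha : ‖a‖ < 1) {u : ℂ → ℝ} (hu : ContDiffOn ℝ 1 u cdisc) :
    ContDiffOn ℝ 1 (pull a u) cdisc :=
  (contDiffOn_comp_mob ha hu).add (contDiffOn_mpsi ha 1)

theorem hasFDerivWithinAt_re_comp {g : ℂ → ℂ} {g' : ℂ} {s : Set ℂ} (hg : HasDerivAt g g' z) :
    HasFDerivWithinAt (fun x => (g x).re) (Complex.reCLM.comp (g' • (1 : ℂ →L[ℝ] ℂ))) s z :=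
  (Complex.reCLM.hasFDerivAt.comp z hg.complexToReal_fderiv).hasFDerivWithinAt

theorem mpsi_eq (ha : ‖a‖ < 1) (hz : z ∈ cdisc) :
    mpsi a z = Real.log (1 - ‖a‖ ^ 2) - 2 * (Complex.log (mden a z)).re := by
  rw [mpsi, Real.log_div (one_sub_norm_sq_pos ha).ne' (pow_pos (norm_mden_pos ha hz) 2).ne',
    Real.log_pow, Complex.log_re]
  norm_num

theorem fderivWithin_mpsi (ha : ‖a‖ < 1) (hz : z ∈ cdisc) (h : ℂ) :
    fderivWithin ℝ (mpsi a) cdisc z h = -2 * ((starRingEnd ℂ) a / mden a z * h).re := by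
  have h1 := (hasDerivAt_mden a z).clog (Or.inl (mden_re_pos ha hz))
  have h2 := ((hasFDerivWithinAt_re_comp (s := cdisc) h1).const_mul 2).const_sub (Real.log (1 - ‖a‖ ^ 2))
  have h3 := h2.congr (fun x hx => mpsi_eq ha hx) (mpsi_eq ha hz)
  rw [h3.fderivWithin (uniqueDiffOn_cdisc z hz)]
  simp

theorem lapW_mpsi (ha : ‖a‖ < 1) (hz : z ∈ cdisc) : lapW (mpsi a) z = 0 := by
  have hd := (hasDerivAt_const z ((starRingEnd ℂ) a)).div (hasDerivAt_mden a z) (mden_ne_zero ha hz)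
  have key : ∀ h : ℂ, fderivWithin ℝ (fun x => fderivWithin ℝ (mpsi a) cdisc x h) cdisc z h =
      2 * ((starRingEnd ℂ) a ^ 2 / mden a z ^ 2 * h ^ 2).re := fun h => by
    have h2 := (hasFDerivWithinAt_re_comp (s := cdisc) (hd.mul_const h)).const_mul (-2)
    have h3 := h2.congr (fun x hx => fderivWithin_mpsi ha hx h) (fderivWithin_mpsi ha hz h)
    rw [h3.fderivWithin (uniqueDiffOn_cdisc z hz)]
    simp only [smul_apply, ContinuousLinearMap.comp_apply, Complex.reCLM_apply, smul_eq_mul,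
      one_apply_eq_self]
    rw [show (0 * mden a z - (starRingEnd ℂ) a * (starRingEnd ℂ) a) / mden a z ^ 2 * h * h =
      -((starRingEnd ℂ) a ^ 2 / mden a z ^ 2 * h ^ 2) by ring, Complex.neg_re]
    ring
  rw [lapW, key, key, Complex.I_sq, mul_neg, one_pow, mul_one, Complex.neg_re]
  ring

theorem nder_mpsi (ha : ‖a‖ < 1) (hz : z ∈ bdry) : nder (mpsi a) z = Real.exp (mpsi a z) - 1 := by
  have hn := mem_bdry_iff.1 hz
  have hz' : z ∈ cdisc := mem_cdisc_iff.2 hn.le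
  rw [nder, fderivWithin_mpsi ha hz', exp_mpsi ha hz']
  have hp := norm_mden_pos ha hz'
  have e : ((starRingEnd ℂ) a / mden a z * z).re =
      ((starRingEnd ℂ) a * z * (starRingEnd ℂ) (mden a z)).re / ‖mden a z‖ ^ 2 := by
    rw [div_mul_eq_mul_div, div_eq_mul_inv, Complex.inv_def, Complex.normSq_eq_norm_sq, ← mul_assoc,
      Complex.re_mul_ofReal, div_eq_mul_inv]
  rw [e, eq_sub_iff_add_eq, eq_div_iff (by positivity), add_mul, mul_assoc,
    div_mul_cancel₀ _ (by positivity)]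
  have hn2 : z.re ^ 2 + z.im ^ 2 = 1 := by
    have := Complex.sq_norm z
    rw [hn, Complex.normSq_apply] at this
    linarith
  simp only [mden, Complex.sq_norm, Complex.normSq_apply, Complex.add_re, Complex.add_im,
    Complex.mul_re, Complex.mul_im, Complex.conj_re, Complex.conj_im, Complex.one_re, Complex.one_im]
  linear_combination (-(a.re ^ 2 + a.im ^ 2)) * hn2

theorem circInt_mpsi (ha : ‖a‖ < 1) : circInt (mpsi a) = Real.log (1 - ‖a‖ ^ 2) * (2 * π) := by
  have h := circleAverage_log_norm_add_const_eq_posLog (a := a)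
  rw [(Real.posLog_eq_zero_iff _).2 (by rw [abs_norm]; exact ha.le), Real.circleAverage_def,
    smul_eq_mul, mul_eq_zero] at h
  have h0 : ∫ θ in (0 : ℝ)..2 * π, Real.log ‖circleMap 0 1 θ + a‖ = 0 :=
    h.resolve_left (by positivity)
  have e : ∀ θ : ℝ, mpsi a (bpt θ) =
      Real.log (1 - ‖a‖ ^ 2) + (-2) * Real.log ‖circleMap 0 1 θ + a‖ := fun θ => by
    have hz := bpt_mem_cdisc θ
    have h1 := norm_mden_sq_sub a (bpt θ)
    rw [norm_bpt] at h1
    have h2 : ‖mden a (bpt θ)‖ = ‖bpt θ + a‖ := by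
      rw [← sq_eq_sq₀ (norm_nonneg _) (norm_nonneg _)]; linarith
    have h3 : circleMap 0 1 θ = bpt θ := by simp [circleMap, bpt]
    rw [mpsi, Real.log_div (one_sub_norm_sq_pos ha).ne' (pow_pos (norm_mden_pos ha hz) 2).ne',
      Real.log_pow, h2, h3]
    push_cast; ring
  have hc : Continuous fun θ => mpsi a (bpt θ) := continuous_comp_bpt (continuousOn_mpsi ha)
  have h5 : Continuous fun θ : ℝ => Real.log ‖circleMap 0 1 θ + a‖ := by
    have : (fun θ : ℝ => Real.log ‖circleMap 0 1 θ + a‖) =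
      fun θ => (mpsi a (bpt θ) - Real.log (1 - ‖a‖ ^ 2)) / (-2) := by
      funext θ; rw [e]; ring
    rw [this]; fun_prop
  rw [circInt]
  simp only [e]
  rw [intervalIntegral.integral_add intervalIntegrable_const ((h5.const_mul _).intervalIntegrable _ _),
    intervalIntegral.integral_const_mul, h0, intervalIntegral.integral_const]
  simp; ring

theorem gsq_comp_smul_one (L : ℂ →L[ℝ] ℝ) (c : ℂ) :
    gsq (L.comp (c • (1 : ℂ →L[ℝ] ℂ))) = gsq L * ‖c‖ ^ 2 := by
  simp only [gsq, ContinuousLinearMap.comp_apply, smul_apply, one_apply_eq_self,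
    smul_eq_mul, mul_one]
  rw [clm_apply_eq L c, clm_apply_eq L (c * Complex.I), Complex.sq_norm, Complex.normSq_apply]
  simp
  ring

theorem dirich_comp_mob (ha : ‖a‖ < 1) {u : ℂ → ℝ} (hu : ContDiffOn ℝ 1 u cdisc) :
    dirich (fun z => u (mob a z)) = dirich u := by
  rw [dirich, dirich, ← ballInt_comp_mob ha fun z => gsq (fderivWithin ℝ u cdisc z)]
  refine ballInt_congr fun z hz => ?_
  have hz' := odisc_subset_cdisc hz
  have h1 := (hu.differentiableOn one_ne_zero _ (mob_mem_cdisc ha hz')).hasFDerivWithinAt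
  have h2 := (hasDerivAt_mob ha hz').complexToReal_fderiv.hasFDerivWithinAt (s := cdisc)
  have h3 : HasFDerivWithinAt (fun z => u (mob a z)) _ cdisc z :=
    h1.comp z h2 fun x hx => mob_mem_cdisc ha hx
  rw [h3.fderivWithin (uniqueDiffOn_cdisc z hz'), gsq_comp_smul_one, norm_deriv_mob ha hz',
    ← Real.exp_nat_mul]
  norm_num

theorem dirich_eq_of_contDiffOn {η v : ℂ → ℝ} (hη : ContDiffOn ℝ 1 η cdisc)
    (hv : ContDiffOn ℝ 1 v cdisc) :
    dirich (fun z => η z + v z) = dirich η + 2 * (ballInt fun z =>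
      fderivWithin ℝ η cdisc z 1 * fderivWithin ℝ v cdisc z 1 +
        fderivWithin ℝ η cdisc z Complex.I * fderivWithin ℝ v cdisc z Complex.I) + dirich v := by
  have h1 := continuousOn_fderivWithin_cdisc hη
  have h2 := continuousOn_fderivWithin_cdisc hv
  have g1 : ContinuousOn (fun z => gsq (fderivWithin ℝ η cdisc z)) cdisc :=
    continuous_gsq.comp_continuousOn h1
  have g2 : ContinuousOn (fun z => gsq (fderivWithin ℝ v cdisc z)) cdisc :=
    continuous_gsq.comp_continuousOn h2
  rw [dirich, dirich, dirich, ← ballInt_const_mul, ← ballInt_add g1 (by fun_prop),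
    ← ballInt_add (by fun_prop) g2]
  refine ballInt_congr fun z hz => ?_
  have hz' := odisc_subset_cdisc hz
  rw [fderivWithin_fun_add (uniqueDiffOn_cdisc z hz') (hη.differentiableOn one_ne_zero z hz')
    (hv.differentiableOn one_ne_zero z hz')]
  simp only [gsq, add_apply]
  ring

theorem ballInt_grad_mul_grad_mpsi (ha : ‖a‖ < 1) {η : ℂ → ℝ} (hη : ContDiffOn ℝ 1 η cdisc) :
    (ballInt fun z => fderivWithin ℝ η cdisc z 1 * fderivWithin ℝ (mpsi a) cdisc z 1 +
        fderivWithin ℝ η cdisc z Complex.I * fderivWithin ℝ (mpsi a) cdisc z Complex.I) =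
      (circInt fun z => η z * Real.exp (mpsi a z)) - circInt η := by
  have key := ballInt_green hη (contDiffOn_mpsi ha 2)
  have h0 : (ballInt fun z => η z * lapW (mpsi a) z) = 0 := by
    rw [ballInt_congr (w₂ := fun _ => 0) fun z hz => by
      rw [lapW_mpsi ha (odisc_subset_cdisc hz), mul_zero], ballInt_const, zero_mul]
  have hψ := continuousOn_mpsi ha
  have hηc := hη.continuousOn
  rw [h0, zero_add] at key
  rw [key, circInt_congr (w₂ := fun z => η z * Real.exp (mpsi a z) + (-1) * η z) fun z hz => by
    rw [nder_mpsi ha hz]; ring, circInt_add (by fun_prop) (by fun_prop), circInt_const_mul]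
  ring

theorem liou_mpsi (ha : ‖a‖ < 1) : liou (mpsi a) = 0 := by
  have hna : ‖-a‖ < 1 := by simpa using ha
  have h1 := ballInt_grad_mul_grad_mpsi ha (contDiffOn_mpsi ha 1)
  have h2 : dirich (mpsi a) = _ := (ballInt_congr fun z _ => by rw [gsq, sq, sq]).trans h1
  have h3 := circInt_comp_mob ha (continuousOn_mpsi hna)
  rw [circInt_congr (w₂ := fun z => (-1) * (mpsi a z * Real.exp (mpsi a z))) fun z hz => by
    rw [mpsi_neg_mob ha (mem_cdisc_iff.2 (mem_bdry_iff.1 hz).le)]; ring, circInt_const_mul,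
    circInt_mpsi hna, norm_neg, ← circInt_mpsi ha] at h3
  rw [liou, h2]
  linarith

theorem liou_pull (ha : ‖a‖ < 1) {u : ℂ → ℝ} (hu : ContDiffOn ℝ 1 u cdisc) :
    liou (pull a u) = liou u := by
  have h1 := dirich_eq_of_contDiffOn (contDiffOn_comp_mob ha hu) (contDiffOn_mpsi ha 1)
  rw [ballInt_grad_mul_grad_mpsi ha (contDiffOn_comp_mob ha hu), dirich_comp_mob ha hu,
    circInt_comp_mob ha hu.continuousOn] at h1
  have h2 := circInt_add (contDiffOn_comp_mob ha hu).continuousOn (continuousOn_mpsi ha)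
  have h3 := liou_mpsi ha
  rw [liou] at h3 ⊢
  rw [liou, show dirich (pull a u) = _ from h1, show circInt (pull a u) = _ from h2]
  linarith

theorem wInt_pull (ha : ‖a‖ < 1) {u w : ℂ → ℝ} (hu : ContinuousOn u cdisc) (hw : ContinuousOn w cdisc) :
    (wInt (pull a u) fun z => w (mob a z)) = wInt u w := by
  rw [wInt, wInt, ← ballInt_comp_mob ha fun z => w z * Real.exp (2 * u z),
    ← circInt_comp_mob ha (w := fun z => w z * Real.exp (u z)) (by fun_prop)]
  simp only [pull, mul_add, Real.exp_add, mul_assoc]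

theorem mass_pull (ha : ‖a‖ < 1) {u : ℂ → ℝ} (hu : ContinuousOn u cdisc) :
    mass (pull a u) = mass u := by
  have := wInt_pull ha hu (w := fun _ => 1) continuousOn_const
  rwa [wInt_const, wInt_const, one_mul, one_mul] at this

end

section

variable {a b z : ℂ}

/-! ### Centring the conformal measure -/

theorem norm_mden_le (ha : ‖a‖ < 1) (hz : z ∈ cdisc) : ‖mden a z‖ ≤ 2 := by
  refine (norm_add_le _ _).trans ?_
  rw [norm_one]
  linarith [norm_conj_mul_lt ha hz]

theorem neg_one_le_fderivWithin_mpsi_self (ha : ‖a‖ < 1) (hz : z ∈ cdisc) :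
    -1 ≤ fderivWithin ℝ (mpsi a) cdisc z z := by
  rw [fderivWithin_mpsi ha hz]
  have hp := norm_mden_pos ha hz
  have e : ((starRingEnd ℂ) a / mden a z * z).re =
      ((starRingEnd ℂ) a * z * (starRingEnd ℂ) (mden a z)).re / ‖mden a z‖ ^ 2 := by
    rw [div_mul_eq_mul_div, div_eq_mul_inv, Complex.inv_def, Complex.normSq_eq_norm_sq, ← mul_assoc,
      Complex.re_mul_ofReal, div_eq_mul_inv]
  have h1 : ((starRingEnd ℂ) a / mden a z * z).re ≤ 1 / 2 := by
    rw [e, div_le_iff₀ (by positivity)]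
    have h2 := norm_conj_mul_lt ha hz
    set w := (starRingEnd ℂ) a * z with hw
    have h3 : ‖w‖ ^ 2 ≤ 1 := by nlinarith [norm_nonneg w]
    rw [mden, ← hw]
    rw [Complex.sq_norm, Complex.normSq_apply] at h3 ⊢
    simp
    nlinarith
  linarith

theorem ballInt_mpsi_le (ha : ‖a‖ < 1) : ballInt (mpsi a) ≤ Real.log (1 - ‖a‖ ^ 2) * π + π / 2 := by
  have hψ := contDiffOn_mpsi ha 1
  have hre : ContDiffOn ℝ 1 (fun z : ℂ => z.re) cdisc := Complex.reCLM.contDiff.contDiffOn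
  have him : ContDiffOn ℝ 1 (fun z : ℂ => z.im) cdisc := Complex.imCLM.contDiff.contDiffOn
  have key := ballInt_divergence (hre.mul hψ) (him.mul hψ)
  have h1 : (circInt fun z => z.re * (z.re * mpsi a z) + z.im * (z.im * mpsi a z)) = circInt (mpsi a) := by
    refine circInt_congr fun z hz => ?_
    have := Complex.sq_norm z
    rw [mem_bdry_iff.1 hz, Complex.normSq_apply] at this
    linear_combination (-mpsi a z) * this
  rw [h1, circInt_mpsi ha] at key
  have hc := continuousOn_fderivWithin_cdisc hψ
  have hψc := continuousOn_mpsi ha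
  have h2 : (ballInt fun z => fderivWithin ℝ (fun x : ℂ => x.re * mpsi a x) cdisc z 1 +
      fderivWithin ℝ (fun x : ℂ => x.im * mpsi a x) cdisc z Complex.I) =
      2 * ballInt (mpsi a) + ballInt fun z => fderivWithin ℝ (mpsi a) cdisc z z := by
    rw [← ballInt_const_mul, ← ballInt_add (by fun_prop) (by fun_prop)]
    refine ballInt_congr fun z hz => ?_
    have hz' := odisc_subset_cdisc hz
    have hu := uniqueDiffOn_cdisc z hz'
    have d0 := hψ.differentiableOn one_ne_zero z hz'
    have e1 : fderivWithin ℝ (fun z : ℂ => z.re) cdisc z = Complex.reCLM :=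
      Complex.reCLM.hasFDerivWithinAt.fderivWithin hu
    have e2 : fderivWithin ℝ (fun z : ℂ => z.im) cdisc z = Complex.imCLM :=
      Complex.imCLM.hasFDerivWithinAt.fderivWithin hu
    rw [fderivWithin_fun_mul hu (hre.differentiableOn one_ne_zero z hz') d0,
      fderivWithin_fun_mul hu (him.differentiableOn one_ne_zero z hz') d0, e1, e2, clm_apply_eq _ z]
    simp
    ring
  have h3 : (ballInt fun _ => (-1 : ℝ)) ≤ ballInt fun z => fderivWithin ℝ (mpsi a) cdisc z z :=
    ballInt_mono continuousOn_const (by fun_prop) fun z hz => neg_one_le_fderivWithin_mpsi_self ha hz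
  rw [ballInt_const] at h3
  have h4 := h2.symm.trans key
  linarith

theorem exists_wInt_mpsi_le {u : ℂ → ℝ} (hu : ContinuousOn u cdisc) :
    ∃ C : ℝ, ∀ a : ℂ, ‖a‖ < 1 → wInt u (mpsi a) ≤ C := by
  obtain ⟨B, hB⟩ := isCompact_cdisc.bddAbove_image hu
  have hB' : ∀ z ∈ cdisc, u z ≤ B := fun z hz => hB (mem_image_of_mem u hz)
  refine ⟨Real.exp (2 * B) * (π / 2 + 2 * Real.log 2 * π) +
    Real.exp B * (2 * Real.log 2 * (2 * π)), fun a ha => ?_⟩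
  set l := Real.log (1 - ‖a‖ ^ 2) with hl
  have hl0 : l ≤ 0 := Real.log_nonpos (one_sub_norm_sq_pos ha).le (by nlinarith [norm_nonneg a])
  have hψ := continuousOn_mpsi ha
  have hlow : ∀ z ∈ cdisc, 0 ≤ mpsi a z + (2 * Real.log 2 - l) := fun z hz => by
    rw [mpsi_eq ha hz, Complex.log_re]
    have := Real.log_le_log (norm_mden_pos ha hz) (norm_mden_le ha hz)
    linarith
  have h1 : wInt u (fun z => mpsi a z + (2 * Real.log 2 - l)) =
      wInt u (mpsi a) + (2 * Real.log 2 - l) * mass u := by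
    rw [wInt_add hu hψ continuousOn_const, wInt_const]
  have hb : (ballInt fun z => (mpsi a z + (2 * Real.log 2 - l)) * Real.exp (2 * u z)) ≤
      Real.exp (2 * B) * (π / 2 + 2 * Real.log 2 * π) := by
    calc _ ≤ ballInt fun z => Real.exp (2 * B) * (mpsi a z + (2 * Real.log 2 - l)) :=
          ballInt_mono (by fun_prop) (by fun_prop) fun z hz => by
            rw [mul_comm]
            exact mul_le_mul_of_nonneg_right (Real.exp_le_exp.2 (by linarith [hB' z hz])) (hlow z hz)
      _ = Real.exp (2 * B) * (ballInt (mpsi a) + (2 * Real.log 2 - l) * π) := by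
          rw [ballInt_const_mul, ballInt_add hψ continuousOn_const, ballInt_const]
      _ ≤ _ := by
          have := ballInt_mpsi_le ha
          refine mul_le_mul_of_nonneg_left ?_ (Real.exp_nonneg _)
          nlinarith
  have hc : (circInt fun z => (mpsi a z + (2 * Real.log 2 - l)) * Real.exp (u z)) ≤
      Real.exp B * (2 * Real.log 2 * (2 * π)) := by
    calc _ ≤ circInt fun z => Real.exp B * (mpsi a z + (2 * Real.log 2 - l)) :=
          circInt_mono (by fun_prop) (by fun_prop) fun z hz => by
            rw [mul_comm]
            exact mul_le_mul_of_nonneg_right (Real.exp_le_exp.2 (hB' z hz)) (hlow z hz)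
      _ = Real.exp B * (2 * Real.log 2 * (2 * π)) := by
          rw [circInt_const_mul, circInt_add hψ continuousOn_const, circInt_const, circInt_mpsi ha]
          ring
  have h2 : wInt u (fun z => mpsi a z + (2 * Real.log 2 - l)) ≤ _ := add_le_add hb hc
  have h3 : 0 ≤ (2 * Real.log 2 - l) * mass u :=
    mul_nonneg (by linarith [Real.log_nonneg one_le_two]) (mass_nonneg u)
  linarith

/-- Some disc automorphism makes every ball of radius `1/10` centred near the boundary carry at most
two thirds of the conformal measure. -/
theorem exists_pull_muM_ball_le {u : ℂ → ℝ} (hu : ContinuousOn u cdisc) (hm : 0 < mass u) :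
    ∃ a : ℂ, ‖a‖ < 1 ∧ ∀ y : ℂ, 9 / 10 ≤ ‖y‖ → ‖y‖ ≤ 1 →
      muM (pull a u) (ball y (1 / 10)) ≤ ENNReal.ofReal (2 / 3 * mass (pull a u)) := by
  obtain ⟨C, hC⟩ := exists_wInt_mpsi_le hu
  set S : Set ℝ := (fun a => wInt u (mpsi a)) '' ball 0 1 with hS
  have hbdd : BddAbove S := ⟨C, by rintro _ ⟨a, ha, rfl⟩; exact hC a (by simpa using ha)⟩
  have hne : S.Nonempty := ⟨_, 0, by simp, rfl⟩
  obtain ⟨_, ⟨a₀, ha₀, rfl⟩, hlt⟩ := exists_lt_of_lt_csSup hne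
    (show sSup S - mass u / 12 < sSup S by linarith)
  have ha₀ : ‖a₀‖ < 1 := by simpa using ha₀
  have hna : ‖-a₀‖ < 1 := by simpa using ha₀
  have hmax : ∀ c : ℂ, ‖c‖ < 1 → wInt u (mpsi c) - wInt u (mpsi a₀) ≤ mass u / 12 := fun c hc => by
    have := le_csSup hbdd (mem_image_of_mem _ (by simpa using hc : c ∈ ball (0 : ℂ) 1))
    simp only at hlt this
    linarith
  refine ⟨-a₀, hna, fun y hy1 hy2 => ?_⟩
  have hpc : ContinuousOn (pull (-a₀) u) cdisc :=
    (hu.comp (continuousOn_mob hna) fun z hz => mob_mem_cdisc hna hz).add (continuousOn_mpsi hna)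
  have hy0 : 0 < ‖y‖ := by linarith
  set b : ℂ := -((2 * ‖y‖)⁻¹ • y) with hbdef
  have hbn : ‖b‖ = 1 / 2 := by
    rw [hbdef, norm_neg, norm_smul, Real.norm_of_nonneg (by positivity)]; field_simp
  have hb : ‖b‖ < 1 := by rw [hbn]; norm_num
  have hψb := continuousOn_mpsi hb
  have hcen : wInt (pull (-a₀) u) (mpsi b) ≤ mass u / 12 := by
    have hc : ‖mob a₀ b‖ < 1 := mem_odisc_iff.1 (mob_mem_odisc ha₀ (mem_odisc_iff.2 hb))
    have e1 : wInt u (fun z => mpsi (mob a₀ b) z + (-1) * mpsi a₀ z) =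
        wInt u (mpsi (mob a₀ b)) - wInt u (mpsi a₀) := by
      rw [wInt_add hu (continuousOn_mpsi hc) ((continuousOn_mpsi ha₀).const_mul (-1)), wInt_const_mul]
      ring
    have e2 := wInt_pull hna hu (w := fun z => mpsi (mob a₀ b) z + (-1) * mpsi a₀ z)
      ((continuousOn_mpsi hc).add ((continuousOn_mpsi ha₀).const_mul (-1)))
    have hpt : ∀ z ∈ cdisc, mpsi (mob a₀ b) (mob (-a₀) z) + (-1) * mpsi a₀ (mob (-a₀) z) = mpsi b z := by
      intro z hz
      have h1 := mpsi_mob ha₀ hb (mob_mem_cdisc hna hz)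
      have h2 := mob_neg_mob hna hz
      rw [neg_neg] at h2
      rw [h2] at h1
      linarith
    have e3 : wInt (pull (-a₀) u) (mpsi b) = wInt (pull (-a₀) u) fun z =>
        mpsi (mob a₀ b) (mob (-a₀) z) + (-1) * mpsi a₀ (mob (-a₀) z) := by
      rw [wInt, wInt]
      congr 1
      · exact ballInt_congr fun z hz => by rw [hpt z (odisc_subset_cdisc hz)]
      · exact circInt_congr fun z hz => by rw [hpt z (mem_cdisc_iff.2 (mem_bdry_iff.1 hz).le)]
    rw [e3, e2, e1]
    exact hmax _ hc
  have hlow : ∀ z ∈ cdisc, 0 ≤ mpsi b z + Real.log 3 := fun z hz => by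
    have h1 : ‖mden b z‖ ≤ 3 / 2 := by
      refine (norm_add_le _ _).trans ?_
      rw [norm_one, norm_mul, Complex.norm_conj, hbn]
      have := mem_cdisc_iff.1 hz
      linarith
    have hp := norm_mden_pos hb hz
    rw [mpsi, ← Real.log_mul (by rw [hbn]; positivity) (by norm_num)]
    apply Real.log_nonneg
    rw [hbn, div_mul_eq_mul_div, le_div_iff₀ (by positivity)]
    nlinarith
  have hball : ∀ z ∈ cdisc, z ∈ ball y (1 / 10) → Real.log 2 + Real.log 3 ≤ mpsi b z + Real.log 3 := by
    intro z hz hzy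
    have hzy' : ‖z - y‖ < 1 / 10 := by simpa [dist_eq_norm] using hzy
    have hp := norm_mden_pos hb hz
    have hyy : (starRingEnd ℂ) y * y = (‖y‖ : ℂ) ^ 2 := by
      rw [mul_comm, Complex.mul_conj, Complex.normSq_eq_norm_sq]; push_cast; ring
    have e : mden b z = ((1 - ‖y‖ / 2 : ℝ) : ℂ) + (starRingEnd ℂ) b * (z - y) := by
      have hyc : (‖y‖ : ℂ) ≠ 0 := by exact_mod_cast hy0.ne'
      have : (starRingEnd ℂ) b * y = ((-(‖y‖ / 2) : ℝ) : ℂ) := by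
        rw [hbdef, Complex.real_smul]
        simp only [map_neg, map_mul, Complex.conj_ofReal]
        rw [neg_mul, mul_assoc, hyy]
        push_cast
        field_simp
      rw [mden, mul_sub, this]
      push_cast; ring
    have h1 : ‖mden b z‖ ≤ 3 / 5 := by
      rw [e]
      refine (norm_add_le _ _).trans ?_
      rw [norm_mul, Complex.norm_conj, hbn, Complex.norm_real, Real.norm_of_nonneg (by linarith)]
      linarith
    have h2 : Real.log 2 ≤ mpsi b z := by
      apply Real.log_le_log two_pos
      rw [hbn, le_div_iff₀ (by positivity)]
      nlinarith
    linarith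
  set v := pull (-a₀) u with hv
  have hmv : mass v = mass u := mass_pull hna hu
  have hL6 : 0 < Real.log 2 + Real.log 3 := by
    have := Real.log_pos one_lt_two
    have := Real.log_pos (show (1 : ℝ) < 3 by norm_num)
    linarith
  have key : ENNReal.ofReal (Real.log 2 + Real.log 3) * muM v (ball y (1 / 10)) ≤
      ENNReal.ofReal (wInt v fun z => mpsi b z + Real.log 3) := by
    rw [← lintegral_muM_eq_wInt hpc (w := fun z => mpsi b z + Real.log 3) (hψb.add continuousOn_const) hlow, ← setLIntegral_const]
    refine (lintegral_mono_ae ?_).trans (setLIntegral_le_lintegral (ball y (1 / 10)) _)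
    filter_upwards [ae_restrict_mem measurableSet_ball, ae_restrict_of_ae (ae_mem_cdisc v)] with z hz1 hz2
    rw [crefl_of_mem hz2]
    exact ENNReal.ofReal_le_ofReal (hball z hz2 hz1)
  have htot : (wInt v fun z => mpsi b z + Real.log 3) ≤
      (Real.log 2 + Real.log 3) * (2 / 3 * mass v) := by
    rw [wInt_add hpc hψb continuousOn_const, wInt_const, hmv]
    have h43 : 1 / 4 ≤ 2 * Real.log 2 - Real.log 3 := by
      have h := Real.one_sub_inv_le_log_of_pos (show (0 : ℝ) < 4 / 3 by norm_num)
      rw [Real.log_div (by norm_num) (by norm_num), show (4 : ℝ) = 2 ^ 2 by norm_num, Real.log_pow] at h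
      norm_num at h
      linarith
    nlinarith
  have h := key.trans (ENNReal.ofReal_le_ofReal htot)
  rw [ENNReal.ofReal_mul hL6.le] at h
  exact (ENNReal.mul_le_mul_iff_right (by simpa using hL6) ENNReal.ofReal_ne_top).1 h

end

/-- On conformal factors of controlled mass, an upper bound for the Liouville energy entails a lower
bound for it, and an interpolation inequality for the conformal measure. -/
theorem exists_liou_lower_bound_and_cubic_bound {m₀ : ℝ} (m₁ s₀ : ℝ) (hm₀ : 0 < m₀) :
    ∃ C : ℝ, 0 ≤ C ∧ ∀ u : ℂ → ℝ, ContDiffOn ℝ 1 u cdisc → m₀ ≤ mass u → mass u ≤ m₁ →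
      liou u ≤ s₀ → -C ≤ liou u ∧ ∀ φ : ℂ → ℝ, ContDiffOn ℝ 1 φ cdisc →
        (wInt u fun z => |φ z| ^ 3) ≤
          C * √(wInt u fun z => φ z ^ 2) * (dirich φ + wInt u fun z => φ z ^ 2) := by
  have hpi := Real.pi_pos
  obtain ⟨C₀, hC₀, hlow⟩ := exists_cmean_lower_bound (s := 11 / 6) (m₀ := m₀) (m₁ := m₁)
    (by norm_num) (by norm_num) hm₀
  set K := 2 * π * C₀ with hK
  have hK0 : 0 ≤ K := by positivity
  obtain ⟨C₁, -, hexp⟩ := exists_exp_bound (44 * (s₀ + K + 11 * K ^ 2)) (s₀ / (2 * π))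
  obtain ⟨C₂, hC₂, hcub⟩ := exists_wInt_cubic_le C₁ m₁ hm₀
  refine ⟨K + 6 * K ^ 2 + C₂, by positivity, fun u hu hm hm' hs => ?_⟩
  have huc := hu.continuousOn
  obtain ⟨a, ha, hconc⟩ := exists_pull_muM_ball_le huc (hm₀.trans_le hm)
  have hv := contDiffOn_pull ha hu
  have hmv := mass_pull ha huc
  have hsv := liou_pull ha hu
  set v := pull a u with hvdef
  have hmain : 0 ≤ K + circInt v + K * √(dirich v) + 5 / 11 * dirich v := by
    have h := hlow (2 / 3) (by norm_num) v hv (hmv ▸ hm) (hmv ▸ hm') hconc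
    have h2 := mul_nonneg (by positivity : (0 : ℝ) ≤ 2 * π) h
    have e : 2 * π * (C₀ + cmean v + C₀ * √(dirich v) +
        (1 + 2 / 3) / (4 * π * (11 / 6)) * dirich v) =
        K + circInt v + K * √(dirich v) + 5 / 11 * dirich v := by
      rw [cmean, hK]
      field_simp
      ring
    rwa [e] at h2
  have hD := dirich_nonneg v
  have hsq := Real.sq_sqrt hD
  have hliou : liou v = dirich v / 2 + circInt v := rfl
  have hsq0 := Real.sqrt_nonneg (dirich v)
  refine ⟨?_, fun φ hφ => ?_⟩
  · rw [← hsv]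
    nlinarith [sq_nonneg (√(dirich v) - 11 * K)]
  · have hd : dirich v ≤ 44 * (s₀ + K + 11 * K ^ 2) := by
      rw [← hsv] at hs
      nlinarith [sq_nonneg (√(dirich v) - 22 * K)]
    have hb : cmean v ≤ s₀ / (2 * π) := by
      rw [cmean]
      gcongr
      rw [← hsv] at hs
      linarith
    obtain ⟨h1, h2⟩ := hexp v hv hd hb
    have h := hcub v hv.continuousOn (hmv ▸ hm) (hmv ▸ hm') h1 h2 _ (contDiffOn_comp_mob ha hφ)
    have hφc := hφ.continuousOn
    rw [dirich_comp_mob ha hφ, wInt_pull ha huc (w := fun z => φ z ^ 2) (hφc.pow 2),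
      wInt_pull ha huc (w := fun z => |φ z| ^ 3) (hφc.abs.pow 3)] at h
    refine h.trans ?_
    have hw : 0 ≤ wInt u fun z => φ z ^ 2 := wInt_nonneg fun z _ => sq_nonneg _
    have := dirich_nonneg φ
    gcongr
    nlinarith

theorem two_le_smooth : (2 : WithTop ℕ∞) ≤ ((⊤ : ℕ∞) : WithTop ℕ∞) :=
  WithTop.coe_le_coe.2 (le_top : (2 : ℕ∞) ≤ ⊤)

/-- The space-time cylinder over the closed disc with positive times. -/
def sdom : Set (ℂ × ℝ) := cdisc ×ˢ Ioi 0

/-- Joint smoothness of a time-dependent function up to the boundary, for positive times. -/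
def SpacetimeSmooth (V : ℂ → ℝ → ℝ) : Prop :=
  ContDiffOn ℝ (⊤ : ℕ∞) (fun p : ℂ × ℝ => V p.1 p.2) sdom

theorem uniqueDiffOn_sdom : UniqueDiffOn ℝ sdom :=
  uniqueDiffOn_cdisc.prod isOpen_Ioi.uniqueDiffOn

theorem closure_interior_sdom : sdom ⊆ closure (interior sdom) := by
  rintro ⟨z, t⟩ ⟨hz, ht⟩
  rw [sdom, interior_prod_eq, closure_prod_eq, isOpen_Ioi.interior_eq]
  refine ⟨?_, subset_closure ht⟩
  change z ∈ closure (interior (closedBall (0 : ℂ) 1))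
  rw [interior_closedBall _ one_ne_zero, closure_ball _ one_ne_zero]
  exact hz

namespace SpacetimeSmooth

variable {V : ℂ → ℝ → ℝ} {z : ℂ} {t : ℝ}

theorem hasFDerivWithinAt (hV : SpacetimeSmooth V) (hz : z ∈ cdisc) (ht : 0 < t) :
    HasFDerivWithinAt (fun p : ℂ × ℝ => V p.1 p.2)
      (fderivWithin ℝ (fun p : ℂ × ℝ => V p.1 p.2) sdom (z, t)) sdom (z, t) :=
  ((hV.differentiableOn (by simp)) (z, t) ⟨hz, ht⟩).hasFDerivWithinAt

theorem hasDerivAt_fderivWithin (hV : SpacetimeSmooth V) (hz : z ∈ cdisc) (ht : 0 < t) :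
    HasDerivAt (V z) (fderivWithin ℝ (fun p : ℂ × ℝ => V p.1 p.2) sdom (z, t) (0, 1)) t := by
  have h1 : HasDerivWithinAt (fun s : ℝ => (z, s)) ((0 : ℂ), (1 : ℝ)) (Ioi 0) t :=
    (hasDerivWithinAt_const t (Ioi 0) z).prodMk (hasDerivWithinAt_id t (Ioi 0))
  have h2 := (hV.hasFDerivWithinAt hz ht).comp_hasDerivWithinAt t h1 fun s hs => ⟨hz, hs⟩
  exact h2.hasDerivAt (Ioi_mem_nhds ht)

theorem hasDerivAt (hV : SpacetimeSmooth V) (hz : z ∈ cdisc) (ht : 0 < t) :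
    HasDerivAt (V z) (deriv (V z) t) t :=
  (hV.hasDerivAt_fderivWithin hz ht).differentiableAt.hasDerivAt

theorem slice (hV : SpacetimeSmooth V) (ht : 0 < t) :
    ContDiffOn ℝ (⊤ : ℕ∞) (fun z => V z t) cdisc :=
  hV.comp (contDiff_id.prodMk contDiff_const).contDiffOn fun _ hz => ⟨hz, ht⟩

theorem slice_one (hV : SpacetimeSmooth V) (ht : 0 < t) : ContDiffOn ℝ 1 (fun z => V z t) cdisc :=
  (hV.slice ht).of_le (by exact_mod_cast le_top)

theorem slice_two (hV : SpacetimeSmooth V) (ht : 0 < t) : ContDiffOn ℝ 2 (fun z => V z t) cdisc :=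
  (hV.slice ht).of_le two_le_smooth

theorem continuousOn_slice (hV : SpacetimeSmooth V) (ht : 0 < t) :
    ContinuousOn (fun z => V z t) cdisc :=
  (hV.slice ht).continuousOn

theorem fderivWithin_slice (hV : SpacetimeSmooth V) (hz : z ∈ cdisc) (ht : 0 < t) (h : ℂ) :
    fderivWithin ℝ (fun x => V x t) cdisc z h =
      fderivWithin ℝ (fun p : ℂ × ℝ => V p.1 p.2) sdom (z, t) (h, 0) := by
  have h1 : HasFDerivWithinAt (fun x : ℂ => (x, t))
      ((ContinuousLinearMap.id ℝ ℂ).prod (0 : ℂ →L[ℝ] ℝ)) cdisc z :=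
    (hasFDerivWithinAt_id z cdisc).prodMk (hasFDerivWithinAt_const t z cdisc)
  have h2 := (hV.hasFDerivWithinAt hz ht).comp z h1 (fun s hs => (⟨hs, ht⟩ : (s, t) ∈ sdom))
  have h3 := h2.fderivWithin (uniqueDiffOn_cdisc z hz)
  change fderivWithin ℝ (fun x => V x t) cdisc z = _ at h3
  rw [h3]
  simp

theorem contDiffOn_fderivWithin_apply (hV : SpacetimeSmooth V) (v : ℂ × ℝ) :
    ContDiffOn ℝ (⊤ : ℕ∞)
      (fun p => fderivWithin ℝ (fun p : ℂ × ℝ => V p.1 p.2) sdom p v) sdom :=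
  (hV.fderivWithin uniqueDiffOn_sdom (by simp)).clm_apply contDiffOn_const

theorem timeDeriv (hV : SpacetimeSmooth V) : SpacetimeSmooth fun z t => deriv (V z) t :=
  (hV.contDiffOn_fderivWithin_apply (0, 1)).congr fun _ hp =>
    (hV.hasDerivAt_fderivWithin hp.1 hp.2).deriv

theorem grad (hV : SpacetimeSmooth V) (h : ℂ) :
    SpacetimeSmooth fun z t => fderivWithin ℝ (fun x => V x t) cdisc z h :=
  (hV.contDiffOn_fderivWithin_apply (h, 0)).congr fun _ hp =>
    hV.fderivWithin_slice hp.1 hp.2 h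

theorem hasDerivAt_grad (hV : SpacetimeSmooth V) (hz : z ∈ cdisc) (ht : 0 < t) (h : ℂ) :
    HasDerivAt (fun t => fderivWithin ℝ (fun x => V x t) cdisc z h)
      (fderivWithin ℝ (fun x => deriv (V x) t) cdisc z h) t := by
  have hp : (z, t) ∈ sdom := ⟨hz, ht⟩
  have h1 := (hV.grad h).hasDerivAt_fderivWithin hz ht
  have hud := uniqueDiffOn_sdom (z, t) hp
  have hd2 : DifferentiableWithinAt ℝ (fderivWithin ℝ (fun p : ℂ × ℝ => V p.1 p.2) sdom) sdom (z, t) :=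
    (hV.fderivWithin (m := (⊤ : ℕ∞)) uniqueDiffOn_sdom (by simp)).differentiableOn (by simp) _ hp
  have key : ∀ v w : ℂ × ℝ,
      fderivWithin ℝ (fun p => fderivWithin ℝ (fun p : ℂ × ℝ => V p.1 p.2) sdom p v) sdom (z, t) w =
      fderivWithin ℝ (fderivWithin ℝ (fun p : ℂ × ℝ => V p.1 p.2) sdom) sdom (z, t) w v := by
    intro v w
    rw [fderivWithin_clm_apply hud hd2 (differentiableWithinAt_const v)]
    simp
  have e1 : fderivWithin ℝ (fun p : ℂ × ℝ => fderivWithin ℝ (fun x => V x p.2) cdisc p.1 h) sdom (z, t) =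
      fderivWithin ℝ (fun p => fderivWithin ℝ (fun p : ℂ × ℝ => V p.1 p.2) sdom p (h, 0)) sdom (z, t) :=
    fderivWithin_congr' (fun p hp => hV.fderivWithin_slice hp.1 hp.2 h) hp
  have e2 : fderivWithin ℝ (fun p : ℂ × ℝ => deriv (V p.1) p.2) sdom (z, t) =
      fderivWithin ℝ (fun p => fderivWithin ℝ (fun p : ℂ × ℝ => V p.1 p.2) sdom p (0, 1)) sdom (z, t) :=
    fderivWithin_congr' (fun p hp => (hV.hasDerivAt_fderivWithin hp.1 hp.2).deriv) hp
  have hsymm := ContDiffWithinAt.isSymmSndFDerivWithinAt (hV (z, t) hp) (by simpa using two_le_smooth)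
    uniqueDiffOn_sdom (closure_interior_sdom hp) hp
  rw [hV.timeDeriv.fderivWithin_slice hz ht h, e2, key, hsymm.eq, ← key, ← e1]
  exact h1

end SpacetimeSmooth

/-- `G` is continuous on the space-time cylinder with continuous time derivative `G'`. -/
structure TimeC1 (G G' : ℂ → ℝ → ℝ) : Prop where
  cont : ContinuousOn (fun p : ℂ × ℝ => G p.1 p.2) sdom
  cont' : ContinuousOn (fun p : ℂ × ℝ => G' p.1 p.2) sdom
  deriv : ∀ z ∈ cdisc, ∀ t : ℝ, 0 < t → HasDerivAt (G z) (G' z t) t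

theorem SpacetimeSmooth.timeC1 {V : ℂ → ℝ → ℝ} (hV : SpacetimeSmooth V) :
    TimeC1 V fun z t => deriv (V z) t :=
  ⟨hV.continuousOn, hV.timeDeriv.continuousOn, fun _ hz _ ht => hV.hasDerivAt hz ht⟩

theorem SpacetimeSmooth.timeC1_grad {V : ℂ → ℝ → ℝ} (hV : SpacetimeSmooth V) (h : ℂ) :
    TimeC1 (fun z t => fderivWithin ℝ (fun x => V x t) cdisc z h)
      fun z t => fderivWithin ℝ (fun x => deriv (V x) t) cdisc z h :=
  ⟨(hV.grad h).continuousOn, (hV.timeDeriv.grad h).continuousOn,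
    fun _ hz _ ht => hV.hasDerivAt_grad hz ht h⟩

namespace TimeC1

variable {G G' H H' : ℂ → ℝ → ℝ} {t : ℝ}

theorem of_continuousOn {η : ℂ → ℝ} (hη : ContinuousOn η cdisc) :
    TimeC1 (fun z _ => η z) fun _ _ => 0 :=
  ⟨hη.comp continuousOn_fst fun _ hp => hp.1, continuousOn_const, fun _ _ t _ => hasDerivAt_const t _⟩

theorem add (hG : TimeC1 G G') (hH : TimeC1 H H') :
    TimeC1 (fun z t => G z t + H z t) fun z t => G' z t + H' z t :=
  ⟨hG.cont.add hH.cont, hG.cont'.add hH.cont', fun z hz t ht =>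
    (hG.deriv z hz t ht).add (hH.deriv z hz t ht)⟩

theorem mul (hG : TimeC1 G G') (hH : TimeC1 H H') :
    TimeC1 (fun z t => G z t * H z t) fun z t => G' z t * H z t + G z t * H' z t :=
  ⟨hG.cont.mul hH.cont, (hG.cont'.mul hH.cont).add (hG.cont.mul hH.cont'), fun z hz t ht =>
    (hG.deriv z hz t ht).mul (hH.deriv z hz t ht)⟩

theorem exp_const_mul (hG : TimeC1 G G') (c : ℝ) :
    TimeC1 (fun z t => Real.exp (c * G z t)) fun z t => Real.exp (c * G z t) * (c * G' z t) :=
  ⟨(continuousOn_const.mul hG.cont).rexp,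
    ((continuousOn_const.mul hG.cont).rexp).mul (continuousOn_const.mul hG.cont'), fun z hz t ht =>
    ((hG.deriv z hz t ht).const_mul c).exp⟩

theorem exp (hG : TimeC1 G G') :
    TimeC1 (fun z t => Real.exp (G z t)) fun z t => Real.exp (G z t) * G' z t := by
  simpa using hG.exp_const_mul 1

theorem continuousOn_slice (hG : ContinuousOn (fun p : ℂ × ℝ => G p.1 p.2) sdom) (ht : 0 < t) :
    ContinuousOn (fun z => G z t) cdisc :=
  hG.comp (continuousOn_id.prodMk continuousOn_const) fun _ hz => ⟨hz, ht⟩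

theorem exists_bound (hG : ContinuousOn (fun p : ℂ × ℝ => G p.1 p.2) sdom) (ht : 0 < t) :
    ∃ C : ℝ, ∀ z ∈ cdisc, ∀ s ∈ Icc (t / 2) (2 * t), ‖G z s‖ ≤ C := by
  have hc : IsCompact (cdisc ×ˢ Icc (t / 2) (2 * t)) := isCompact_cdisc.prod isCompact_Icc
  obtain ⟨C, hC⟩ := hc.exists_bound_of_continuousOn
    (hG.mono (prod_mono_right fun s hs => (half_pos ht).trans_le hs.1))
  exact ⟨C, fun z hz s hs => hC (z, s) ⟨hz, hs⟩⟩

theorem Icc_mem_nhds_double (ht : 0 < t) : Icc (t / 2) (2 * t) ∈ 𝓝 t :=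
  Icc_mem_nhds (by linarith) (by linarith)

theorem hasDerivAt_ballInt (hG : TimeC1 G G') (ht : 0 < t) :
    HasDerivAt (fun t => ballInt fun z => G z t) (ballInt fun z => G' z t) t := by
  obtain ⟨C, hC⟩ := exists_bound hG.cont' ht
  have hae : ∀ {p : ℂ → Prop}, (∀ z ∈ cdisc, p z) → ∀ᵐ z ∂(volume.restrict odisc), p z := fun h =>
    (ae_restrict_iff' measurableSet_odisc).2 (Eventually.of_forall fun z hz =>
      h z (odisc_subset_cdisc hz))
  refine (hasDerivAt_integral_of_dominated_loc_of_deriv_le (bound := fun _ => C)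
    (F := fun t z => G z t) (F' := fun t z => G' z t) (Icc_mem_nhds_double ht) ?_
    (integrableOn_odisc (continuousOn_slice hG.cont ht))
    (integrableOn_odisc (continuousOn_slice hG.cont' ht)).aestronglyMeasurable
    (hae fun z hz s hs => hC z hz s hs) (integrableOn_odisc continuousOn_const)
    (hae fun z hz s hs => hG.deriv z hz s ((half_pos ht).trans_le hs.1))).2
  filter_upwards [Ioi_mem_nhds ht] with s hs
  exact (integrableOn_odisc (continuousOn_slice hG.cont hs)).aestronglyMeasurable

theorem hasDerivAt_circInt (hG : TimeC1 G G') (ht : 0 < t) :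
    HasDerivAt (fun t => circInt fun z => G z t) (circInt fun z => G' z t) t := by
  obtain ⟨C, hC⟩ := exists_bound hG.cont' ht
  refine (intervalIntegral.hasDerivAt_integral_of_dominated_loc_of_deriv_le (bound := fun _ => C)
    (F := fun t θ => G (bpt θ) t) (F' := fun t θ => G' (bpt θ) t) (Icc_mem_nhds_double ht) ?_
    ((continuous_comp_bpt (continuousOn_slice hG.cont ht)).intervalIntegrable _ _)
    (continuous_comp_bpt (continuousOn_slice hG.cont' ht)).aestronglyMeasurable
    (Eventually.of_forall fun θ _ s hs => hC _ (bpt_mem_cdisc θ) s hs) (by simp)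
    (Eventually.of_forall fun θ _ s hs =>
      hG.deriv _ (bpt_mem_cdisc θ) s ((half_pos ht).trans_le hs.1))).2
  filter_upwards [Ioi_mem_nhds ht] with s hs
  exact (continuous_comp_bpt (continuousOn_slice hG.cont hs)).aestronglyMeasurable

end TimeC1

theorem continuousOn_lapW {v : ℂ → ℝ} (hv : ContDiffOn ℝ 2 v cdisc) : ContinuousOn (lapW v) cdisc := by
  have hd : ContDiffOn ℝ 1 (fderivWithin ℝ v cdisc) cdisc :=
    hv.fderivWithin uniqueDiffOn_cdisc (by norm_num)
  have h : ∀ k : ℂ, ContinuousOn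
      (fun z => fderivWithin ℝ (fun x => fderivWithin ℝ v cdisc x k) cdisc z k) cdisc := fun k =>
    (continuousOn_fderivWithin_cdisc (hd.clm_apply contDiffOn_const)).clm_apply continuousOn_const
  exact (h 1).add (h Complex.I)

theorem continuousOn_nder {v : ℂ → ℝ} (hv : ContDiffOn ℝ 1 v cdisc) : ContinuousOn (nder v) cdisc :=
  (continuousOn_fderivWithin_cdisc hv).clm_apply continuousOn_id

/-- The Dirichlet pairing of two functions on the disc. -/
def gdot (η v : ℂ → ℝ) : ℝ := ballInt fun z =>
  fderivWithin ℝ η cdisc z 1 * fderivWithin ℝ v cdisc z 1 +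
    fderivWithin ℝ η cdisc z Complex.I * fderivWithin ℝ v cdisc z Complex.I

theorem gdot_self (v : ℂ → ℝ) : gdot v v = dirich v := by
  simp only [gdot, dirich, gsq, sq]

theorem gdot_const_left (c : ℝ) (v : ℂ → ℝ) : gdot (fun _ => c) v = 0 := by
  simp [gdot, ballInt]

/-- The prescribed curvature flow for positive times, with the boundary datum extended to the disc. -/
structure FlowData (f j : ℂ → ℝ) (u : ℂ → ℝ → ℝ) (ρ : ℝ → ℝ) : Prop where
  hf : ContinuousOn f cdisc
  fpos : ∀ z ∈ cdisc, 0 < f z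
  hj : ContinuousOn j cdisc
  jpos : ∀ z ∈ cdisc, 0 < j z
  smooth : SpacetimeSmooth u
  rho_mem : ∀ t : ℝ, 0 < t → ρ t ∈ Ioo 0 π
  rho_deriv : ∀ t : ℝ, 0 < t →
    HasDerivAt ρ (Real.log (betaC j u ρ t ^ 2 / alphaC f u ρ t)) t
  interior_eq : ∀ t : ℝ, 0 < t → ∀ z ∈ odisc,
    deriv (u z) t = alphaC f u ρ t * f z + Real.exp (-(2 * u z t)) * lapW (fun w => u w t) z
  boundary_eq : ∀ t : ℝ, 0 < t → ∀ z ∈ bdry,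
    deriv (u z) t = betaC j u ρ t * j z - Real.exp (-(u z t)) * (nder (fun w => u w t) z + 1)

namespace FlowData

variable {f j : ℂ → ℝ} {u : ℂ → ℝ → ℝ} {ρ : ℝ → ℝ} {t : ℝ}

theorem ballInt_pos (h : FlowData f j u ρ) (ht : 0 < t) :
    0 < ballInt fun z => f z * Real.exp (2 * u z t) := by
  have hu := h.smooth.continuousOn_slice ht
  have hf := h.hf
  exact _root_.ballInt_pos (by fun_prop) fun z hz => mul_pos (h.fpos z hz) (Real.exp_pos _)

theorem circInt_pos (h : FlowData f j u ρ) (ht : 0 < t) :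
    0 < circInt fun z => j z * Real.exp (u z t) := by
  have hu := h.smooth.continuousOn_slice ht
  have hj := h.hj
  exact _root_.circInt_pos (by fun_prop) fun z hz => mul_pos (h.jpos z hz) (Real.exp_pos _)

theorem alphaC_mul (h : FlowData f j u ρ) (ht : 0 < t) :
    alphaC f u ρ t * (ballInt fun z => f z * Real.exp (2 * u z t)) = 2 * ρ t :=
  div_mul_cancel₀ _ (h.ballInt_pos ht).ne'

theorem betaC_mul (h : FlowData f j u ρ) (ht : 0 < t) :
    betaC j u ρ t * (circInt fun z => j z * Real.exp (u z t)) = 2 * (π - ρ t) :=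
  div_mul_cancel₀ _ (h.circInt_pos ht).ne'

theorem alphaC_pos (h : FlowData f j u ρ) (ht : 0 < t) : 0 < alphaC f u ρ t :=
  div_pos (mul_pos two_pos (h.rho_mem t ht).1) (h.ballInt_pos ht)

theorem betaC_pos (h : FlowData f j u ρ) (ht : 0 < t) : 0 < betaC j u ρ t :=
  div_pos (mul_pos two_pos (sub_pos.2 (h.rho_mem t ht).2)) (h.circInt_pos ht)

/-- The weak formulation of the flow equation. -/
theorem weak_eq (h : FlowData f j u ρ) (ht : 0 < t) {η : ℂ → ℝ} (hη : ContDiffOn ℝ 1 η cdisc) :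
    (wInt (fun z => u z t) fun z => deriv (u z) t * η z) =
      alphaC f u ρ t * (ballInt fun z => f z * η z * Real.exp (2 * u z t)) +
      betaC j u ρ t * (circInt fun z => j z * η z * Real.exp (u z t)) -
      gdot η (fun z => u z t) - circInt η := by
  have hu := h.smooth.continuousOn_slice ht
  have hf := h.hf
  have hj := h.hj
  have hηc := hη.continuousOn
  have hl := continuousOn_lapW (h.smooth.slice_two ht)
  have hn := continuousOn_nder (h.smooth.slice_one ht)
  have hg : _ + gdot η (fun z => u z t) = _ := ballInt_green hη (h.smooth.slice_two ht)
  have e1 : (ballInt fun z => deriv (u z) t * η z * Real.exp (2 * u z t)) =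
      alphaC f u ρ t * (ballInt fun z => f z * η z * Real.exp (2 * u z t)) +
        ballInt fun z => η z * lapW (fun w => u w t) z := by
    rw [← ballInt_const_mul, ← ballInt_add (by fun_prop) (by fun_prop)]
    refine ballInt_congr fun z hz => ?_
    rw [h.interior_eq t ht z hz, Real.exp_neg]
    field_simp
  have e2 : (circInt fun z => deriv (u z) t * η z * Real.exp (u z t)) =
      betaC j u ρ t * (circInt fun z => j z * η z * Real.exp (u z t)) +
        ((-1) * (circInt fun z => η z * nder (fun w => u w t) z) + (-1) * circInt η) := by
    rw [← circInt_const_mul, ← circInt_const_mul, ← circInt_const_mul,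
      ← circInt_add (by fun_prop) (by fun_prop), ← circInt_add (by fun_prop) (by fun_prop)]
    refine circInt_congr fun z hz => ?_
    rw [h.boundary_eq t ht z hz, Real.exp_neg]
    field_simp
    ring
  rw [wInt, e1, e2]
  linarith

theorem wInt_deriv_eq_zero (h : FlowData f j u ρ) (ht : 0 < t) :
    (wInt (fun z => u z t) fun z => deriv (u z) t) = 0 := by
  have := h.weak_eq ht (η := fun _ => 1) contDiffOn_const
  simp only [mul_one, gdot_const_left, circInt_const] at this
  rw [h.alphaC_mul ht, h.betaC_mul ht] at this
  rw [this]
  ring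

theorem hasDerivAt_area (h : FlowData f j u ρ) (ht : 0 < t) :
    HasDerivAt (fun t => ballInt fun z => Real.exp (2 * u z t))
      (2 * ballInt fun z => deriv (u z) t * Real.exp (2 * u z t)) t := by
  have := (h.smooth.timeC1.exp_const_mul 2).hasDerivAt_ballInt ht
  rw [← ballInt_const_mul]
  convert this using 3
  ring

theorem hasDerivAt_length (h : FlowData f j u ρ) (ht : 0 < t) :
    HasDerivAt (fun t => circInt fun z => Real.exp (u z t))
      (circInt fun z => deriv (u z) t * Real.exp (u z t)) t := by
  have := h.smooth.timeC1.exp.hasDerivAt_circInt ht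
  convert this using 3
  ring

/-- Half the area plus the length is conserved along the flow. -/
theorem exists_area_add_length (h : FlowData f j u ρ) :
    ∃ c : ℝ, 0 < c ∧ ∀ t : ℝ, 0 < t →
      (ballInt fun z => Real.exp (2 * u z t)) / 2 + (circInt fun z => Real.exp (u z t)) = c := by
  set g : ℝ → ℝ := fun t => (ballInt fun z => Real.exp (2 * u z t)) / 2 +
    circInt fun z => Real.exp (u z t) with hg
  have hd : ∀ t : ℝ, 0 < t → HasDerivAt g 0 t := fun t ht => by
    refine (((h.hasDerivAt_area ht).div_const 2).add (h.hasDerivAt_length ht)).congr_deriv ?_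
    have := h.wInt_deriv_eq_zero ht
    rw [wInt] at this
    linarith
  have hconst : ∀ t : ℝ, 0 < t → g t = g 1 := fun t ht =>
    isOpen_Ioi.is_const_of_deriv_eq_zero isPreconnected_Ioi
      (fun s hs => (hd s hs).differentiableAt.differentiableWithinAt)
      (fun s hs => (hd s hs).deriv) (mem_Ioi.2 ht) (mem_Ioi.2 one_pos)
  have hu := h.smooth.continuousOn_slice one_pos
  refine ⟨g 1, ?_, hconst⟩
  have h1 : 0 < ballInt fun z => Real.exp (2 * u z 1) :=
    _root_.ballInt_pos (by fun_prop) fun z _ => Real.exp_pos _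
  have h2 : 0 < circInt fun z => Real.exp (u z 1) :=
    _root_.circInt_pos (by fun_prop) fun z _ => Real.exp_pos _
  simp only [hg]
  positivity

end FlowData

namespace FlowData

variable {f j : ℂ → ℝ} {u : ℂ → ℝ → ℝ} {ρ : ℝ → ℝ} {t : ℝ}

theorem hasDerivAt_ballInt_mul_exp (h : FlowData f j u ρ) {g : ℂ → ℝ} (hg : ContinuousOn g cdisc)
    (ht : 0 < t) : HasDerivAt (fun t => ballInt fun z => g z * Real.exp (2 * u z t))
      (2 * ballInt fun z => g z * deriv (u z) t * Real.exp (2 * u z t)) t := by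
  refine (((TimeC1.of_continuousOn hg).mul (h.smooth.timeC1.exp_const_mul 2)).hasDerivAt_ballInt
    ht).congr_deriv ?_
  rw [← ballInt_const_mul]
  congr 1
  ext z
  ring

theorem hasDerivAt_circInt_mul_exp (h : FlowData f j u ρ) {g : ℂ → ℝ} (hg : ContinuousOn g cdisc)
    (ht : 0 < t) : HasDerivAt (fun t => circInt fun z => g z * Real.exp (u z t))
      (circInt fun z => g z * deriv (u z) t * Real.exp (u z t)) t := by
  refine (((TimeC1.of_continuousOn hg).mul h.smooth.timeC1.exp).hasDerivAt_circInt
    ht).congr_deriv ?_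
  congr 1
  ext z
  ring

/-- The average of the speed against the weighted area measure. -/
def avgB (f : ℂ → ℝ) (u : ℂ → ℝ → ℝ) (t : ℝ) : ℝ :=
  (ballInt fun z => f z * deriv (u z) t * Real.exp (2 * u z t)) /
    ballInt fun z => f z * Real.exp (2 * u z t)

/-- The average of the speed against the weighted length measure. -/
def avgC (j : ℂ → ℝ) (u : ℂ → ℝ → ℝ) (t : ℝ) : ℝ :=
  (circInt fun z => j z * deriv (u z) t * Real.exp (u z t)) /
    circInt fun z => j z * Real.exp (u z t)

/-- The speed of the parameter `ρ`. -/
def rsp (f j : ℂ → ℝ) (u : ℂ → ℝ → ℝ) (ρ : ℝ → ℝ) (t : ℝ) : ℝ :=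
  Real.log (betaC j u ρ t ^ 2 / alphaC f u ρ t)

/-- The speed of the conformal factor at a given time. -/
def vel (u : ℂ → ℝ → ℝ) (t : ℝ) (z : ℂ) : ℝ := deriv (u z) t

theorem rsp_eq (h : FlowData f j u ρ) (ht : 0 < t) :
    rsp f j u ρ t = 2 * Real.log (betaC j u ρ t) - Real.log (alphaC f u ρ t) := by
  rw [rsp, Real.log_div (pow_ne_zero _ (h.betaC_pos ht).ne') (h.alphaC_pos ht).ne', Real.log_pow]
  simp

theorem hasDerivAt_rho (h : FlowData f j u ρ) (ht : 0 < t) : HasDerivAt ρ (rsp f j u ρ t) t :=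
  h.rho_deriv t ht

theorem hasDerivAt_alphaC (h : FlowData f j u ρ) (ht : 0 < t) :
    HasDerivAt (alphaC f u ρ)
      (alphaC f u ρ t * (rsp f j u ρ t / ρ t - 2 * avgB f u t)) t := by
  have hP := h.ballInt_pos ht
  have hρ := (h.rho_mem t ht).1
  refine (((h.hasDerivAt_rho ht).const_mul 2).div (h.hasDerivAt_ballInt_mul_exp h.hf ht)
    hP.ne').congr_deriv ?_
  rw [alphaC, avgB]
  field_simp

theorem hasDerivAt_betaC (h : FlowData f j u ρ) (ht : 0 < t) :
    HasDerivAt (betaC j u ρ)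
      (betaC j u ρ t * (-(rsp f j u ρ t / (π - ρ t)) - avgC j u t)) t := by
  have hQ := h.circInt_pos ht
  have hρ := sub_pos.2 (h.rho_mem t ht).2
  refine ((((h.hasDerivAt_rho ht).const_sub π).const_mul 2).div (h.hasDerivAt_circInt_mul_exp h.hj ht)
    hQ.ne').congr_deriv ?_
  rw [betaC, avgC]
  field_simp

theorem hasDerivAt_rsp (h : FlowData f j u ρ) (ht : 0 < t) :
    HasDerivAt (rsp f j u ρ)
      (2 * (-(rsp f j u ρ t / (π - ρ t)) - avgC j u t) -
        (rsp f j u ρ t / ρ t - 2 * avgB f u t)) t := by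
  have ha := h.alphaC_pos ht
  have hb := h.betaC_pos ht
  have h1 := (((h.hasDerivAt_betaC ht).log hb.ne').const_mul 2).sub
    ((h.hasDerivAt_alphaC ht).log ha.ne')
  rw [mul_div_cancel_left₀ _ hb.ne', mul_div_cancel_left₀ _ ha.ne'] at h1
  refine h1.congr_of_eventuallyEq ?_
  filter_upwards [Ioi_mem_nhds ht] with s hs
  exact h.rsp_eq hs

theorem contDiffOn_vel (h : FlowData f j u ρ) (ht : 0 < t) : ContDiffOn ℝ 1 (vel u t) cdisc :=
  h.smooth.timeDeriv.slice_one ht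

theorem hasDerivAt_gdot (h : FlowData f j u ρ) {η : ℂ → ℝ} (hη : ContDiffOn ℝ 1 η cdisc)
    (ht : 0 < t) :
    HasDerivAt (fun t => gdot η fun z => u z t) (gdot η (vel u t)) t := by
  have hc := continuousOn_fderivWithin_cdisc hη
  have hη' : ∀ k : ℂ, ContinuousOn (fun z => fderivWithin ℝ η cdisc z k) cdisc := fun k =>
    hc.clm_apply continuousOn_const
  have key := ((TimeC1.of_continuousOn (hη' 1)).mul (h.smooth.timeC1_grad 1)).add
    ((TimeC1.of_continuousOn (hη' Complex.I)).mul (h.smooth.timeC1_grad Complex.I))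
  refine (key.hasDerivAt_ballInt ht).congr_deriv ?_
  simp only [zero_mul, zero_add]
  rfl

theorem hasDerivAt_liou (h : FlowData f j u ρ) (ht : 0 < t) :
    HasDerivAt (fun t => liou fun z => u z t)
      (gdot (vel u t) (fun z => u z t) + circInt (vel u t)) t := by
  have key := ((h.smooth.timeC1_grad 1).mul (h.smooth.timeC1_grad 1)).add
    ((h.smooth.timeC1_grad Complex.I).mul (h.smooth.timeC1_grad Complex.I))
  have h1 := ((key.hasDerivAt_ballInt ht).div_const 2).add (h.smooth.timeC1.hasDerivAt_circInt ht)
  refine (h1.congr_deriv ?_).congr_of_eventuallyEq (Eventually.of_forall fun s => ?_)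
  · rw [div_eq_inv_mul, ← ballInt_const_mul]
    refine congrArg₂ _ (congrArg ballInt (funext fun z => ?_)) rfl
    change _ = fderivWithin ℝ (fun x => deriv (u x) t) cdisc z 1 * _ +
      fderivWithin ℝ (fun x => deriv (u x) t) cdisc z Complex.I * _
    ring
  · change dirich (fun z => u z s) / 2 + _ = _
    rw [← gdot_self]
    rfl

end FlowData

namespace FlowData

variable {f j : ℂ → ℝ} {u : ℂ → ℝ → ℝ} {ρ : ℝ → ℝ} {t : ℝ}

/-- The energy that decreases along the flow. -/
def energy (f j : ℂ → ℝ) (u : ℂ → ℝ → ℝ) (ρ : ℝ → ℝ) (t : ℝ) : ℝ :=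
  (liou fun z => u z t) - ρ t * Real.log (ballInt fun z => f z * Real.exp (2 * u z t)) -
    2 * (π - ρ t) * Real.log (circInt fun z => j z * Real.exp (u z t)) +
    (ρ t * Real.log (ρ t) + 2 * (π - ρ t) * Real.log (π - ρ t) + (1 - Real.log 2) * ρ t)

/-- The squared `L²` norm of the speed of the conformal factor. -/
def vsq (u : ℂ → ℝ → ℝ) (t : ℝ) : ℝ := wInt (fun z => u z t) fun z => vel u t z ^ 2

/-- The curvature deficit, expressed through the speed of the flow. -/
def deficit (f j : ℂ → ℝ) (u : ℂ → ℝ → ℝ) (ρ : ℝ → ℝ) (t : ℝ) : ℝ :=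
  vsq u t + rsp f j u ρ t ^ 2

theorem vsq_nonneg (u : ℂ → ℝ → ℝ) (t : ℝ) : 0 ≤ vsq u t := wInt_nonneg fun _ _ => sq_nonneg _

theorem deficit_nonneg (f j : ℂ → ℝ) (u : ℂ → ℝ → ℝ) (ρ : ℝ → ℝ) (t : ℝ) :
    0 ≤ deficit f j u ρ t := add_nonneg (vsq_nonneg u t) (sq_nonneg _)

theorem vsq_le_deficit (f j : ℂ → ℝ) (u : ℂ → ℝ → ℝ) (ρ : ℝ → ℝ) (t : ℝ) :
    vsq u t ≤ deficit f j u ρ t := le_add_of_nonneg_right (sq_nonneg _)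

theorem avgB_mul (h : FlowData f j u ρ) (ht : 0 < t) :
    avgB f u t * (ballInt fun z => f z * Real.exp (2 * u z t)) =
      ballInt fun z => f z * deriv (u z) t * Real.exp (2 * u z t) :=
  div_mul_cancel₀ _ (h.ballInt_pos ht).ne'

theorem avgC_mul (h : FlowData f j u ρ) (ht : 0 < t) :
    avgC j u t * (circInt fun z => j z * Real.exp (u z t)) =
      circInt fun z => j z * deriv (u z) t * Real.exp (u z t) :=
  div_mul_cancel₀ _ (h.circInt_pos ht).ne'

theorem hasDerivAt_energy (h : FlowData f j u ρ) (ht : 0 < t) :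
    HasDerivAt (energy f j u ρ) (-deficit f j u ρ t) t := by
  have hP := h.ballInt_pos ht
  have hQ := h.circInt_pos ht
  obtain ⟨hρ, hρ'⟩ := h.rho_mem t ht
  have hπ := sub_pos.2 hρ'
  have dρ := h.hasDerivAt_rho ht
  have dπ := dρ.const_sub π
  have d1 := dρ.mul ((h.hasDerivAt_ballInt_mul_exp h.hf ht).log hP.ne')
  have d2 := (dπ.const_mul 2).mul ((h.hasDerivAt_circInt_mul_exp h.hj ht).log hQ.ne')
  have d3 := ((dρ.mul (dρ.log hρ.ne')).add ((dπ.const_mul 2).mul (dπ.log hπ.ne'))).add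
    (dρ.const_mul (1 - Real.log 2))
  refine ((((h.hasDerivAt_liou ht).sub d1).sub d2).add d3).congr_deriv ?_
  have hw := h.weak_eq ht (h.contDiffOn_vel ht)
  have hX : (ballInt fun z => f z * vel u t z * Real.exp (2 * u z t)) = _ := (h.avgB_mul ht).symm
  have hY : (circInt fun z => j z * vel u t z * Real.exp (u z t)) = _ := (h.avgC_mul ht).symm
  have hv : (wInt (fun z => u z t) fun z => deriv (u z) t * vel u t z) = vsq u t := by
    simp only [vsq, vel, sq]
  have hα := h.alphaC_mul ht
  have hβ := h.betaC_mul ht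
  rw [hv, hX, hY] at hw
  have hr : rsp f j u ρ t = 2 * (Real.log 2 + Real.log (π - ρ t) -
      Real.log (circInt fun z => j z * Real.exp (u z t))) - (Real.log 2 + Real.log (ρ t) -
      Real.log (ballInt fun z => f z * Real.exp (2 * u z t))) := by
    rw [h.rsp_eq ht, alphaC, betaC, Real.log_div (by positivity) hP.ne', Real.log_div (by positivity) hQ.ne',
      Real.log_mul two_ne_zero hρ.ne', Real.log_mul two_ne_zero hπ.ne']
  rw [← h.avgB_mul ht, ← h.avgC_mul ht, deficit]
  set P := ballInt fun z => f z * Real.exp (2 * u z t)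
  set Q := circInt fun z => j z * Real.exp (u z t)
  have e1 : ρ t * (2 * (avgB f u t * P) / P) = alphaC f u ρ t * (avgB f u t * P) := by
    rw [show alphaC f u ρ t * (avgB f u t * P) = (alphaC f u ρ t * P) * avgB f u t by ring, hα]
    field_simp
  have e2 : 2 * (π - ρ t) * (avgC j u t * Q / Q) = betaC j u ρ t * (avgC j u t * Q) := by
    rw [show betaC j u ρ t * (avgC j u t * Q) = (betaC j u ρ t * Q) * avgC j u t by ring, hβ]
    field_simp
  have e3 : ρ t * (rsp f j u ρ t / ρ t) = rsp f j u ρ t := by field_simp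
  have e4 : 2 * (π - ρ t) * (-rsp f j u ρ t / (π - ρ t)) = -2 * rsp f j u ρ t := by field_simp
  rw [e1, e2, e3, e4, hw]
  have e5 : rsp f j u ρ t ^ 2 = rsp f j u ρ t * (2 * (Real.log 2 + Real.log (π - ρ t) -
      Real.log Q) - (Real.log 2 + Real.log (ρ t) - Real.log P)) := by rw [← hr, sq]
  rw [e5]
  ring

/-- The differentiated weak formulation of the flow equation. -/
theorem weak_eq_deriv (h : FlowData f j u ρ) (ht : 0 < t) {η : ℂ → ℝ} (hη : ContDiffOn ℝ 1 η cdisc) :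
    (ballInt fun z => (deriv (vel u · z) t + 2 * vel u t z ^ 2) * η z * Real.exp (2 * u z t)) +
      (circInt fun z => (deriv (vel u · z) t + vel u t z ^ 2) * η z * Real.exp (u z t)) =
    alphaC f u ρ t * (rsp f j u ρ t / ρ t - 2 * avgB f u t) *
        (ballInt fun z => f z * η z * Real.exp (2 * u z t)) +
      2 * alphaC f u ρ t * (ballInt fun z => f z * η z * vel u t z * Real.exp (2 * u z t)) +
      betaC j u ρ t * (-(rsp f j u ρ t / (π - ρ t)) - avgC j u t) *
        (circInt fun z => j z * η z * Real.exp (u z t)) +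
      betaC j u ρ t * (circInt fun z => j z * η z * vel u t z * Real.exp (u z t)) -
      gdot η (vel u t) := by
  have hηc := hη.continuousOn
  have hv := h.smooth.timeDeriv.timeC1
  have l1 := ((hv.mul (TimeC1.of_continuousOn hηc)).mul
    (h.smooth.timeC1.exp_const_mul 2)).hasDerivAt_ballInt ht
  have l2 := ((hv.mul (TimeC1.of_continuousOn hηc)).mul h.smooth.timeC1.exp).hasDerivAt_circInt ht
  have r1 := (h.hasDerivAt_alphaC ht).mul (h.hasDerivAt_ballInt_mul_exp (h.hf.mul hηc) ht)
  have r2 := (h.hasDerivAt_betaC ht).mul (h.hasDerivAt_circInt_mul_exp (h.hj.mul hηc) ht)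
  have hr := ((r1.add r2).sub (h.hasDerivAt_gdot hη ht)).sub_const (circInt η)
  have hl := (l1.add l2).congr_of_eventuallyEq (f₁ := fun t =>
    alphaC f u ρ t * (ballInt fun z => f z * η z * Real.exp (2 * u z t)) +
      betaC j u ρ t * (circInt fun z => j z * η z * Real.exp (u z t)) -
      gdot η (fun z => u z t) - circInt η) (by
    filter_upwards [Ioi_mem_nhds ht] with s hs
    exact (h.weak_eq hs hη).symm)
  have key := hl.unique hr
  calc _ = _ := ?_
    _ = _ := key
    _ = _ := ?_
  · refine congrArg₂ _ (congrArg ballInt (funext fun z => ?_)) (congrArg circInt (funext fun z => ?_))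
    · simp only [vel]; ring
    · simp only [vel]; ring
  · simp only [Pi.mul_apply, vel]
    ring

theorem exists_hasDerivAt_deficit (h : FlowData f j u ρ) (ht : 0 < t) :
    ∃ d : ℝ, HasDerivAt (deficit f j u ρ) d t ∧
      d ≤ -2 * dirich (vel u t) +
        4 * alphaC f u ρ t * (ballInt fun z => f z * vel u t z ^ 2 * Real.exp (2 * u z t)) +
        2 * betaC j u ρ t * (circInt fun z => j z * vel u t z ^ 2 * Real.exp (u z t)) +
        2 * wInt (fun z => u z t) fun z => |vel u t z| ^ 3 := by
  have hv := h.smooth.timeDeriv.timeC1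
  have hvv := hv.mul hv
  have d1 := (hvv.mul (h.smooth.timeC1.exp_const_mul 2)).hasDerivAt_ballInt ht
  have d2 := (hvv.mul h.smooth.timeC1.exp).hasDerivAt_circInt ht
  have d3 := (h.hasDerivAt_rsp ht).mul (h.hasDerivAt_rsp ht)
  have hd := (d1.add d2).add d3
  have huc := h.smooth.continuousOn_slice ht
  have hvc : ContinuousOn (vel u t) cdisc := (h.contDiffOn_vel ht).continuousOn
  have hv'c : ContinuousOn (fun z => deriv (vel u · z) t) cdisc :=
    h.smooth.timeDeriv.timeDeriv.continuousOn_slice ht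
  have e1 : (ballInt fun z => (deriv (vel u · z) t * vel u t z + vel u t z * deriv (vel u · z) t) *
        Real.exp (2 * u z t) + vel u t z * vel u t z * (Real.exp (2 * u z t) * (2 * vel u t z))) =
      2 * (ballInt fun z => (deriv (vel u · z) t + 2 * vel u t z ^ 2) * vel u t z *
        Real.exp (2 * u z t)) + ballInt fun z => -2 * vel u t z ^ 3 * Real.exp (2 * u z t) := by
    rw [← ballInt_const_mul, ← ballInt_add (by fun_prop) (by fun_prop)]
    exact ballInt_congr fun z _ => by ring
  have e2 : (circInt fun z => (deriv (vel u · z) t * vel u t z + vel u t z * deriv (vel u · z) t) *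
        Real.exp (u z t) + vel u t z * vel u t z * (Real.exp (u z t) * vel u t z)) =
      2 * (circInt fun z => (deriv (vel u · z) t + vel u t z ^ 2) * vel u t z *
        Real.exp (u z t)) + circInt fun z => -1 * vel u t z ^ 3 * Real.exp (u z t) := by
    rw [← circInt_const_mul, ← circInt_add (by fun_prop) (by fun_prop)]
    exact circInt_congr fun z _ => by ring
  have hcube : ∀ x : ℝ, -x ^ 3 ≤ |x| ^ 3 := fun x => by
    rw [← abs_pow]; exact neg_le_abs _
  have b1 : (ballInt fun z => -2 * vel u t z ^ 3 * Real.exp (2 * u z t)) ≤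
      2 * ballInt fun z => |vel u t z| ^ 3 * Real.exp (2 * u z t) := by
    rw [← ballInt_const_mul]
    refine ballInt_mono (by fun_prop) (by fun_prop) fun z _ => ?_
    nlinarith [hcube (vel u t z), Real.exp_pos (2 * u z t)]
  have b2 : (circInt fun z => -1 * vel u t z ^ 3 * Real.exp (u z t)) ≤
      2 * circInt fun z => |vel u t z| ^ 3 * Real.exp (u z t) := by
    rw [← circInt_const_mul]
    refine circInt_mono (by fun_prop) (by fun_prop) fun z _ => ?_
    have : 0 ≤ |vel u t z| ^ 3 := by positivity
    nlinarith [hcube (vel u t z), Real.exp_pos (u z t)]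
  have hw := h.weak_eq_deriv ht (h.contDiffOn_vel ht)
  refine ⟨_, hd.congr_of_eventuallyEq (Eventually.of_forall fun s => ?_), ?_⟩
  · simp only [deficit, vsq, wInt, vel, sq, Pi.add_apply, Pi.mul_apply]
  · have hX : (ballInt fun z => f z * vel u t z * Real.exp (2 * u z t)) = _ := (h.avgB_mul ht).symm
    have hY : (circInt fun z => j z * vel u t z * Real.exp (u z t)) = _ := (h.avgC_mul ht).symm
    rw [hX, hY, gdot_self] at hw
    have hα := h.alphaC_mul ht
    have hβ := h.betaC_mul ht
    obtain ⟨hρ, hρ'⟩ := h.rho_mem t ht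
    have hπ := sub_pos.2 hρ'
    have hsq : ∀ g : ℂ → ℝ, ∀ z, g z * vel u t z * vel u t z = g z * vel u t z ^ 2 := fun g z => by ring
    simp only [hsq] at hw
    refine (le_of_eq (congrArg₂ _ (congrArg₂ _ e1 e2) rfl)).trans ?_
    rw [wInt]
    set P := ballInt fun z => f z * Real.exp (2 * u z t)
    set Q := circInt fun z => j z * Real.exp (u z t)
    set r := rsp f j u ρ t
    set a := avgB f u t
    set b := avgC j u t
    have c1 : alphaC f u ρ t * (r / ρ t - 2 * a) * (a * P) = 2 * r * a - 4 * ρ t * a ^ 2 := by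
      rw [show alphaC f u ρ t * (r / ρ t - 2 * a) * (a * P) =
        (alphaC f u ρ t * P) * (r / ρ t - 2 * a) * a by ring, hα]
      field_simp
      ring
    have c2 : betaC j u ρ t * (-(r / (π - ρ t)) - b) * (b * Q) =
        -2 * r * b - 2 * (π - ρ t) * b ^ 2 := by
      rw [show betaC j u ρ t * (-(r / (π - ρ t)) - b) * (b * Q) =
        (betaC j u ρ t * Q) * (-(r / (π - ρ t)) - b) * b by ring, hβ]
      field_simp
    have c3 : 8 * (r * a) ≤ 8 * ρ t * a ^ 2 + 2 * (r * (r / ρ t)) := by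
      have : 8 * ρ t * a ^ 2 + 2 * (r * (r / ρ t)) - 8 * (r * a) = 2 * (2 * ρ t * a - r) ^ 2 / ρ t := by
        field_simp
        ring
      have h0 : 0 ≤ 2 * (2 * ρ t * a - r) ^ 2 / ρ t := by positivity
      linarith
    have c4 : -8 * (r * b) ≤ 4 * (π - ρ t) * b ^ 2 + 4 * (r * (r / (π - ρ t))) := by
      have : 4 * (π - ρ t) * b ^ 2 + 4 * (r * (r / (π - ρ t))) + 8 * (r * b) =
          4 * ((π - ρ t) * b + r) ^ 2 / (π - ρ t) := by
        field_simp
        ring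
      have h0 : 0 ≤ 4 * ((π - ρ t) * b + r) ^ 2 / (π - ρ t) := by positivity
      linarith
    rw [c1, c2] at hw
    linarith only [hw, b1, b2, c3, c4]

end FlowData

/-- A function bounded below cannot decrease at a definite rate forever. -/
theorem exists_neg_lt_of_hasDerivAt {g g' : ℝ → ℝ} {t₀ lb κ : ℝ} (hκ : 0 < κ)
    (hg : ∀ t, t₀ ≤ t → HasDerivAt g (g' t) t) (hlb : ∀ t, t₀ ≤ t → lb ≤ g t) (s : ℝ) :
    ∃ t, s ≤ t ∧ t₀ ≤ t ∧ -κ < g' t := by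
  by_contra! hcon
  set r := max s t₀ with hr
  set t := r + (g r - lb + 1) / κ with ht
  have hgr := hlb r (le_max_right _ _)
  have hrt : r ≤ t := by
    have : 0 ≤ (g r - lb + 1) / κ := div_nonneg (by linarith) hκ.le
    linarith
  have hr0 : ∀ x ∈ Icc r t, t₀ ≤ x := fun x hx => (le_max_right s t₀).trans hx.1
  have h1 := (convex_Icc r t).image_sub_le_mul_sub_of_deriv_le (f := g) (C := -κ)
    (fun x hx => (hg x (hr0 x hx)).continuousAt.continuousWithinAt)
    (fun x hx => (hg x (hr0 x (interior_subset hx))).differentiableAt.differentiableWithinAt)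
    (fun x hx => by
      have hx := interior_subset hx
      rw [(hg x (hr0 x hx)).deriv]
      exact hcon x ((le_max_left s t₀).trans hx.1) (hr0 x hx))
    r (left_mem_Icc.2 hrt) t (right_mem_Icc.2 hrt) hrt
  have h2 := hlb t (hr0 t (right_mem_Icc.2 hrt))
  have h3 : -κ * (t - r) = -(g r - lb + 1) := by
    rw [ht]
    field_simp
    ring
  linarith

/-- If `z` returns below `m` again and again and grows above `m` at most at a rate controlled by the
dissipation of a bounded energy, then it eventually stays below any `m₂ > m`. -/
theorem eventually_le_of_dissipation {E F z z' : ℝ → ℝ} {t₀ lb m m₂ C : ℝ} (hC : 0 ≤ C) (hm : m < m₂)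
    (hE : ∀ t, t₀ ≤ t → HasDerivAt E (-F t) t) (hF : ∀ t, 0 ≤ F t) (hlb : ∀ t, t₀ ≤ t → lb ≤ E t)
    (hz : ∀ t, t₀ ≤ t → HasDerivAt z (z' t) t)
    (hz' : ∀ t, t₀ ≤ t → m ≤ z t → z t ≤ m₂ → z' t ≤ C * F t)
    (hfreq : ∀ s, ∃ t, s ≤ t ∧ t₀ ≤ t ∧ z t ≤ m) :
    ∃ T, ∀ t, T ≤ t → z t ≤ m₂ := by
  have hanti : AntitoneOn E (Ici t₀) := antitoneOn_of_deriv_nonpos (convex_Ici t₀)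
    (fun x hx => (hE x hx).continuousAt.continuousWithinAt)
    (fun x hx => (hE x (interior_subset hx)).differentiableAt.differentiableWithinAt)
    (fun x hx => by
      rw [(hE x (interior_subset hx)).deriv]
      linarith [hF x])
  set κ := (m₂ - m) / 2 with hκ
  have hκ0 : 0 < κ := by linarith
  have hne : (E '' Ici t₀).Nonempty := ⟨E t₀, t₀, self_mem_Ici, rfl⟩
  have hbdd : BddBelow (E '' Ici t₀) := ⟨lb, by rintro _ ⟨t, ht, rfl⟩; exact hlb t ht⟩
  obtain ⟨_, ⟨T₀, hT₀, rfl⟩, hlt⟩ := exists_lt_of_csInf_lt hne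
    (show sInf (E '' Ici t₀) < sInf (E '' Ici t₀) + κ / (C + 1) by
      linarith [div_pos hκ0 (by linarith : 0 < C + 1)])
  obtain ⟨s, hs, hs0, hzs⟩ := hfreq T₀
  have hdrop : ∀ t, s ≤ t → 0 ≤ C * (E s - E t) ∧ C * (E s - E t) ≤ κ := fun t ht => by
    have h1 := hanti hT₀ hs0 hs
    have h2 := hanti hs0 (hs0.trans ht) ht
    have h3 : sInf (E '' Ici t₀) ≤ E t := csInf_le hbdd (mem_image_of_mem E (hs0.trans ht))
    have h4 : E s - E t ≤ κ / (C + 1) := by linarith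
    refine ⟨mul_nonneg hC (by linarith), ?_⟩
    rw [le_div_iff₀ (by linarith)] at h4
    nlinarith
  set B : ℝ → ℝ := fun t => m + C * (E s - E t) + κ * (1 - Real.exp (-(t - s))) with hB
  set B' : ℝ → ℝ := fun t => C * F t + κ * Real.exp (-(t - s)) with hB'
  have hBd : ∀ t, t₀ ≤ t → HasDerivAt B (B' t) t := fun t ht => by
    have h1 := ((hE t ht).const_sub (E s)).const_mul C
    have h0 : HasDerivAt (fun t => -(t - s)) (-1) t := ((hasDerivAt_id t).sub_const s).neg
    have h2 := (h0.exp.const_sub 1).const_mul κ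
    refine ((h1.const_add m).add h2).congr_deriv ?_
    simp only [hB']
    ring
  have hBle : ∀ t, s ≤ t → m ≤ B t ∧ B t ≤ m₂ := fun t ht => by
    have h1 := hdrop t ht
    have h2 : Real.exp (-(t - s)) ≤ 1 := Real.exp_le_one_iff.2 (by linarith)
    have h3 := Real.exp_pos (-(t - s))
    simp only [hB]
    constructor <;> nlinarith
  refine ⟨s, fun t ht => le_trans ?_ (hBle t ht).2⟩
  refine image_le_of_deriv_right_lt_deriv_boundary' (f := z) (f' := z') (B := B) (B' := B') (a := s)
    (b := t) (fun x hx => (hz x (hs0.trans hx.1)).continuousAt.continuousWithinAt)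
    (fun x hx => (hz x (hs0.trans hx.1)).hasDerivWithinAt) ?_
    (fun x hx => (hBd x (hs0.trans hx.1)).continuousAt.continuousWithinAt)
    (fun x hx => (hBd x (hs0.trans hx.1)).hasDerivWithinAt) ?_ (right_mem_Icc.2 ht)
  · simpa [hB] using hzs
  · intro x hx hxB
    have h1 := hBle x hx.1
    have h2 := hz' x (hs0.trans hx.1) (hxB ▸ h1.1) (hxB ▸ h1.2)
    have h3 : 0 < κ * Real.exp (-(x - s)) := by positivity
    simp only [hB']
    linarith

theorem exists_pos_bounds_of_continuousOn {g : ℂ → ℝ} (hg : ContinuousOn g cdisc)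
    (hpos : ∀ z ∈ cdisc, 0 < g z) : ∃ m M : ℝ, 0 < m ∧ 0 < M ∧ ∀ z ∈ cdisc, m ≤ g z ∧ g z ≤ M := by
  have hne : cdisc.Nonempty := ⟨bpt 0, bpt_mem_cdisc 0⟩
  obtain ⟨x, hx, hmin⟩ := isCompact_cdisc.exists_isMinOn hne hg
  obtain ⟨y, hy, hmax⟩ := isCompact_cdisc.exists_isMaxOn hne hg
  exact ⟨g x, g y, hpos x hx, hpos y hy, fun z hz => ⟨hmin hz, hmax hz⟩⟩

theorem neg_one_le_mul_log {x : ℝ} (hx : 0 < x) : -1 ≤ x * Real.log x := by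
  have h1 := mul_le_mul_of_nonneg_left (Real.one_sub_inv_le_log_of_pos hx) hx.le
  have h2 : x * (1 - x⁻¹) = x - 1 := by field_simp
  linarith

theorem mul_log_le_of_le {r b P X : ℝ} (hr : 0 ≤ r) (hrb : r ≤ b) (hP : 0 < P) (hPX : P ≤ X) :
    r * Real.log P ≤ b * |Real.log X| :=
  (mul_le_mul_of_nonneg_left ((Real.log_le_log hP hPX).trans (le_abs_self _)) hr).trans
    (mul_le_mul_of_nonneg_right hrb (abs_nonneg _))

namespace FlowData

variable {f j : ℂ → ℝ} {u : ℂ → ℝ → ℝ} {ρ : ℝ → ℝ} {t fm fM jm jM c : ℝ}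

theorem ballInt_exp_pos (h : FlowData f j u ρ) (ht : 0 < t) :
    0 < ballInt fun z => Real.exp (2 * u z t) := by
  have huc := h.smooth.continuousOn_slice ht
  exact _root_.ballInt_pos (by fun_prop) fun z _ => Real.exp_pos _

theorem circInt_exp_pos (h : FlowData f j u ρ) (ht : 0 < t) :
    0 < circInt fun z => Real.exp (u z t) := by
  have huc := h.smooth.continuousOn_slice ht
  exact _root_.circInt_pos (by fun_prop) fun z _ => Real.exp_pos _

theorem ballInt_bounds (h : FlowData f j u ρ) (ht : 0 < t)
    (hb : ∀ z ∈ cdisc, fm ≤ f z ∧ f z ≤ fM) :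
    fm * (ballInt fun z => Real.exp (2 * u z t)) ≤ (ballInt fun z => f z * Real.exp (2 * u z t)) ∧
      (ballInt fun z => f z * Real.exp (2 * u z t)) ≤
        fM * ballInt fun z => Real.exp (2 * u z t) := by
  have huc := h.smooth.continuousOn_slice ht
  have hf := h.hf
  rw [← ballInt_const_mul, ← ballInt_const_mul]
  exact ⟨ballInt_mono (by fun_prop) (by fun_prop) fun z hz =>
      mul_le_mul_of_nonneg_right (hb z hz).1 (Real.exp_pos _).le,
    ballInt_mono (by fun_prop) (by fun_prop) fun z hz =>
      mul_le_mul_of_nonneg_right (hb z hz).2 (Real.exp_pos _).le⟩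

theorem circInt_bounds (h : FlowData f j u ρ) (ht : 0 < t)
    (hb : ∀ z ∈ cdisc, jm ≤ j z ∧ j z ≤ jM) :
    jm * (circInt fun z => Real.exp (u z t)) ≤ (circInt fun z => j z * Real.exp (u z t)) ∧
      (circInt fun z => j z * Real.exp (u z t)) ≤ jM * circInt fun z => Real.exp (u z t) := by
  have huc := h.smooth.continuousOn_slice ht
  have hj := h.hj
  rw [← circInt_const_mul, ← circInt_const_mul]
  exact ⟨circInt_mono (by fun_prop) (by fun_prop) fun z hz =>
      mul_le_mul_of_nonneg_right (hb z hz).1 (Real.exp_pos _).le,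
    circInt_mono (by fun_prop) (by fun_prop) fun z hz =>
      mul_le_mul_of_nonneg_right (hb z hz).2 (Real.exp_pos _).le⟩

theorem ballInt_mul_vel_sq_le (h : FlowData f j u ρ) (ht : 0 < t)
    (hb : ∀ z ∈ cdisc, f z ≤ fM) (hM : 0 ≤ fM) :
    (ballInt fun z => f z * vel u t z ^ 2 * Real.exp (2 * u z t)) ≤ fM * vsq u t := by
  have huc := h.smooth.continuousOn_slice ht
  have hvc : ContinuousOn (vel u t) cdisc := (h.contDiffOn_vel ht).continuousOn
  have hf := h.hf
  have h1 : (ballInt fun z => f z * vel u t z ^ 2 * Real.exp (2 * u z t)) ≤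
      fM * ballInt fun z => vel u t z ^ 2 * Real.exp (2 * u z t) := by
    rw [← ballInt_const_mul]
    refine ballInt_mono (by fun_prop) (by fun_prop) fun z hz => ?_
    rw [mul_assoc]
    exact mul_le_mul_of_nonneg_right (hb z hz) (by positivity)
  refine h1.trans (mul_le_mul_of_nonneg_left ?_ hM)
  exact le_add_of_nonneg_right (circInt_nonneg fun z _ => by positivity)

theorem circInt_mul_vel_sq_le (h : FlowData f j u ρ) (ht : 0 < t)
    (hb : ∀ z ∈ cdisc, j z ≤ jM) (hM : 0 ≤ jM) :
    (circInt fun z => j z * vel u t z ^ 2 * Real.exp (u z t)) ≤ jM * vsq u t := by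
  have huc := h.smooth.continuousOn_slice ht
  have hvc : ContinuousOn (vel u t) cdisc := (h.contDiffOn_vel ht).continuousOn
  have hj := h.hj
  have h1 : (circInt fun z => j z * vel u t z ^ 2 * Real.exp (u z t)) ≤
      jM * circInt fun z => vel u t z ^ 2 * Real.exp (u z t) := by
    rw [← circInt_const_mul]
    refine circInt_mono (by fun_prop) (by fun_prop) fun z hz => ?_
    rw [mul_assoc]
    exact mul_le_mul_of_nonneg_right (hb z hz) (by positivity)
  refine h1.trans (mul_le_mul_of_nonneg_left ?_ hM)
  exact le_add_of_nonneg_left (ballInt_nonneg fun z _ => by positivity)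

theorem mul_avgB_sq_le (h : FlowData f j u ρ) (ht : 0 < t)
    (hb : ∀ z ∈ cdisc, f z ≤ fM) (hM : 0 ≤ fM) :
    2 * ρ t * avgB f u t ^ 2 ≤ alphaC f u ρ t * (fM * deficit f j u ρ t) := by
  have huc := h.smooth.continuousOn_slice ht
  have hvc : ContinuousOn (vel u t) cdisc := (h.contDiffOn_vel ht).continuousOn
  have hf := h.hf
  set a := avgB f u t
  have h0 : 0 ≤ ballInt fun z => f z * (vel u t z - a) ^ 2 * Real.exp (2 * u z t) :=
    ballInt_nonneg fun z hz => mul_nonneg (mul_nonneg (h.fpos z hz).le (sq_nonneg _))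
      (Real.exp_pos _).le
  have h1 : (ballInt fun z => f z * (vel u t z - a) ^ 2 * Real.exp (2 * u z t)) =
      (ballInt fun z => f z * vel u t z ^ 2 * Real.exp (2 * u z t)) +
        (-2 * a * (ballInt fun z => f z * vel u t z * Real.exp (2 * u z t)) +
          a ^ 2 * ballInt fun z => f z * Real.exp (2 * u z t)) := by
    rw [← ballInt_const_mul, ← ballInt_const_mul, ← ballInt_add (by fun_prop) (by fun_prop),
      ← ballInt_add (by fun_prop) (by fun_prop)]
    exact ballInt_congr fun z _ => by ring
  have h2 : (ballInt fun z => f z * vel u t z * Real.exp (2 * u z t)) = _ := (h.avgB_mul ht).symm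
  have h3 := h.ballInt_mul_vel_sq_le ht hb hM
  have h4 := mul_le_mul_of_nonneg_left (vsq_le_deficit f j u ρ t) hM
  rw [h2] at h1
  have h5 : a ^ 2 * (ballInt fun z => f z * Real.exp (2 * u z t)) ≤ fM * deficit f j u ρ t := by
    nlinarith only [h0, h1, h3, h4]
  calc 2 * ρ t * a ^ 2 = alphaC f u ρ t * (a ^ 2 * ballInt fun z => f z * Real.exp (2 * u z t)) := by
        rw [← h.alphaC_mul ht]; ring
    _ ≤ _ := mul_le_mul_of_nonneg_left h5 (h.alphaC_pos ht).le

theorem mul_avgC_sq_le (h : FlowData f j u ρ) (ht : 0 < t)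
    (hb : ∀ z ∈ cdisc, j z ≤ jM) (hM : 0 ≤ jM) :
    2 * (π - ρ t) * avgC j u t ^ 2 ≤ betaC j u ρ t * (jM * deficit f j u ρ t) := by
  have huc := h.smooth.continuousOn_slice ht
  have hvc : ContinuousOn (vel u t) cdisc := (h.contDiffOn_vel ht).continuousOn
  have hj := h.hj
  set a := avgC j u t
  have h0 : 0 ≤ circInt fun z => j z * (vel u t z - a) ^ 2 * Real.exp (u z t) :=
    circInt_nonneg fun z hz => mul_nonneg (mul_nonneg (h.jpos z hz).le (sq_nonneg _))
      (Real.exp_pos _).le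
  have h1 : (circInt fun z => j z * (vel u t z - a) ^ 2 * Real.exp (u z t)) =
      (circInt fun z => j z * vel u t z ^ 2 * Real.exp (u z t)) +
        (-2 * a * (circInt fun z => j z * vel u t z * Real.exp (u z t)) +
          a ^ 2 * circInt fun z => j z * Real.exp (u z t)) := by
    rw [← circInt_const_mul, ← circInt_const_mul, ← circInt_add (by fun_prop) (by fun_prop),
      ← circInt_add (by fun_prop) (by fun_prop)]
    exact circInt_congr fun z _ => by ring
  have h2 : (circInt fun z => j z * vel u t z * Real.exp (u z t)) = _ := (h.avgC_mul ht).symm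
  have h3 := h.circInt_mul_vel_sq_le ht hb hM
  have h4 := mul_le_mul_of_nonneg_left (vsq_le_deficit f j u ρ t) hM
  rw [h2] at h1
  have h5 : a ^ 2 * (circInt fun z => j z * Real.exp (u z t)) ≤ jM * deficit f j u ρ t := by
    nlinarith only [h0, h1, h3, h4]
  calc 2 * (π - ρ t) * a ^ 2 = betaC j u ρ t * (a ^ 2 * circInt fun z => j z * Real.exp (u z t)) := by
        rw [← h.betaC_mul ht]; ring
    _ ≤ _ := mul_le_mul_of_nonneg_left h5 (h.betaC_pos ht).le

theorem antitoneOn_energy (h : FlowData f j u ρ) : AntitoneOn (energy f j u ρ) (Ioi 0) :=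
  antitoneOn_of_deriv_nonpos (convex_Ioi 0)
    (fun x hx => (h.hasDerivAt_energy hx).continuousAt.continuousWithinAt)
    (fun x hx => (h.hasDerivAt_energy (interior_subset hx)).differentiableAt.differentiableWithinAt)
    (fun x hx => by
      rw [(h.hasDerivAt_energy (interior_subset hx)).deriv]
      linarith [deficit_nonneg f j u ρ x])

theorem exists_liou_le_energy_add (h : FlowData f j u ρ) :
    ∃ K, ∀ t, 0 < t → (liou fun z => u z t) ≤ energy f j u ρ t + K := by
  obtain ⟨c, hc, hac⟩ := h.exists_area_add_length
  obtain ⟨fm, fM, -, hfM, hfb⟩ := exists_pos_bounds_of_continuousOn h.hf h.fpos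
  obtain ⟨jm, jM, -, hjM, hjb⟩ := exists_pos_bounds_of_continuousOn h.hj h.jpos
  refine ⟨π * |Real.log (fM * (2 * c))| + 2 * π * |Real.log (jM * c)| + 3, fun t ht => ?_⟩
  have hA := h.ballInt_exp_pos ht
  have hL := h.circInt_exp_pos ht
  have hac := hac t ht
  obtain ⟨hρ, hρ'⟩ := h.rho_mem t ht
  have hπ := sub_pos.2 hρ'
  have h1 := mul_log_le_of_le hρ.le hρ'.le (h.ballInt_pos ht)
    ((h.ballInt_bounds ht hfb).2.trans (mul_le_mul_of_nonneg_left
      (show (ballInt fun z => Real.exp (2 * u z t)) ≤ 2 * c by linarith) hfM.le))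
  have h2 := mul_log_le_of_le (r := 2 * (π - ρ t)) (b := 2 * π) (by linarith) (by linarith)
    (h.circInt_pos ht) ((h.circInt_bounds ht hjb).2.trans
      (mul_le_mul_of_nonneg_left
        (show (circInt fun z => Real.exp (u z t)) ≤ c by linarith) hjM.le))
  have h3 := neg_one_le_mul_log hρ
  have h4 := neg_one_le_mul_log hπ
  have h5 : 0 ≤ (1 - Real.log 2) * ρ t := mul_nonneg (by linarith [Real.log_two_lt_d9]) hρ.le
  rw [energy]
  linarith

/-- The energy is bounded below, and the speed obeys a uniform cubic interpolation inequality. -/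
theorem exists_energy_bound_and_cubic_bound (h : FlowData f j u ρ) :
    ∃ lb C, 0 ≤ C ∧ ∀ t, 1 ≤ t → lb ≤ energy f j u ρ t ∧
      (wInt (fun z => u z t) fun z => |vel u t z| ^ 3) ≤
        C * √(vsq u t) * (dirich (vel u t) + vsq u t) := by
  obtain ⟨c, hc, hac⟩ := h.exists_area_add_length
  obtain ⟨K, hK⟩ := h.exists_liou_le_energy_add
  obtain ⟨C, hC, hM⟩ := exists_liou_lower_bound_and_cubic_bound (2 * c) (energy f j u ρ 1 + K) hc
  refine ⟨-C - K, C, hC, fun t ht => ?_⟩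
  have ht0 : 0 < t := one_pos.trans_le ht
  have hA := h.ballInt_exp_pos ht0
  have hL := h.circInt_exp_pos ht0
  have hac := hac t ht0
  have hKt := hK t ht0
  have hanti := h.antitoneOn_energy (mem_Ioi.2 one_pos) (mem_Ioi.2 ht0) ht
  obtain ⟨h1, h2⟩ := hM (fun z => u z t) (h.smooth.slice_one ht0) (by rw [mass]; linarith)
    (by rw [mass]; linarith) (by linarith)
  exact ⟨by linarith, h2 (vel u t) (h.contDiffOn_vel ht0)⟩

end FlowData

namespace FlowData

variable {f j : ℂ → ℝ} {u : ℂ → ℝ → ℝ} {ρ : ℝ → ℝ} {t : ℝ}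

/-- Lower bounds for the area and the length bound the coefficients of the flow. -/
theorem exists_coeff_bounds (h : FlowData f j u ρ) :
    ∃ a b c : ℝ, 0 < a ∧ 0 < b ∧ 0 < c ∧ ∀ t, 0 < t →
      ∃ A L : ℝ, 0 < A ∧ 0 < L ∧ A / 2 + L = c ∧ alphaC f u ρ t * A ≤ a ∧ betaC j u ρ t * L ≤ b := by
  obtain ⟨c, hc, hac⟩ := h.exists_area_add_length
  obtain ⟨fm, fM, hfm, -, hfb⟩ := exists_pos_bounds_of_continuousOn h.hf h.fpos
  obtain ⟨jm, jM, hjm, -, hjb⟩ := exists_pos_bounds_of_continuousOn h.hj h.jpos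
  refine ⟨2 * π / fm, 2 * π / jm, c, by positivity, by positivity, hc, fun t ht =>
    ⟨_, _, h.ballInt_exp_pos ht, h.circInt_exp_pos ht, hac t ht, ?_, ?_⟩⟩
  · have h1 := mul_le_mul_of_nonneg_left (h.ballInt_bounds ht hfb).1 (h.alphaC_pos ht).le
    rw [h.alphaC_mul ht] at h1
    rw [le_div_iff₀ hfm]
    linarith [(h.rho_mem t ht).2]
  · have h1 := mul_le_mul_of_nonneg_left (h.circInt_bounds ht hjb).1 (h.betaC_pos ht).le
    rw [h.betaC_mul ht] at h1
    rw [le_div_iff₀ hjm]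
    linarith [(h.rho_mem t ht).1]

theorem exists_rsp_le_neg_one (h : FlowData f j u ρ) :
    ∃ M, 0 < M ∧ ∀ t, 0 < t → M ≤ alphaC f u ρ t → rsp f j u ρ t ≤ -1 := by
  obtain ⟨a, b, c, ha, hb, hc, H⟩ := h.exists_coeff_bounds
  refine ⟨max (a / c) ((2 * b / c) ^ 2 * Real.exp 1), by positivity, fun t ht hM => ?_⟩
  obtain ⟨A, L, hA, hL, hAL, h1, h2⟩ := H t ht
  have hα := h.alphaC_pos ht
  have hβ := h.betaC_pos ht
  have h3 : a ≤ alphaC f u ρ t * c := (div_le_iff₀ hc).1 ((le_max_left _ _).trans hM)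
  have h4 : A ≤ c := le_of_mul_le_mul_left (h1.trans h3) hα
  have h5 : betaC j u ρ t ≤ 2 * b / c := by
    rw [le_div_iff₀ hc]
    nlinarith
  rw [rsp, Real.log_le_iff_le_exp (by positivity), div_le_iff₀ hα]
  calc betaC j u ρ t ^ 2 ≤ (2 * b / c) ^ 2 := by gcongr
    _ = Real.exp (-1) * ((2 * b / c) ^ 2 * Real.exp 1) := by
      rw [mul_left_comm, ← Real.exp_add]; simp
    _ ≤ _ := mul_le_mul_of_nonneg_left ((le_max_right _ _).trans hM) (Real.exp_pos _).le

theorem exists_one_le_rsp (h : FlowData f j u ρ) :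
    ∃ M, 0 < M ∧ ∀ t, 0 < t → M ≤ betaC j u ρ t → 1 ≤ rsp f j u ρ t := by
  obtain ⟨a, b, c, ha, hb, hc, H⟩ := h.exists_coeff_bounds
  refine ⟨max (2 * b / c) (max 1 (a / c * Real.exp 1)), by positivity, fun t ht hM => ?_⟩
  obtain ⟨A, L, hA, hL, hAL, h1, h2⟩ := H t ht
  have hα := h.alphaC_pos ht
  have hβ := h.betaC_pos ht
  have h3 : 2 * b ≤ betaC j u ρ t * c := (div_le_iff₀ hc).1 ((le_max_left _ _).trans hM)
  have h4 : L ≤ c / 2 := le_of_mul_le_mul_left (by linarith) hβ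
  have h5 : alphaC f u ρ t ≤ a / c := by
    rw [le_div_iff₀ hc]
    nlinarith
  have h6 : 1 ≤ betaC j u ρ t := (le_max_left _ _).trans ((le_max_right _ _).trans hM)
  have h7 : a / c * Real.exp 1 ≤ betaC j u ρ t := (le_max_right _ _).trans ((le_max_right _ _).trans hM)
  rw [rsp, Real.le_log_iff_exp_le (by positivity), le_div_iff₀ hα]
  calc Real.exp 1 * alphaC f u ρ t ≤ a / c * Real.exp 1 := by
        rw [mul_comm]; exact mul_le_mul_of_nonneg_right h5 (Real.exp_pos _).le
    _ ≤ betaC j u ρ t := h7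
    _ ≤ _ := by nlinarith

theorem exists_alphaC_le (h : FlowData f j u ρ) :
    ∃ T M, 0 < M ∧ ∀ t, T ≤ t → 0 < t → alphaC f u ρ t ≤ M := by
  obtain ⟨lb, _, -, hlb⟩ := h.exists_energy_bound_and_cubic_bound
  obtain ⟨M, hM, hr⟩ := h.exists_rsp_le_neg_one
  obtain ⟨fm, fM, hfm, hfM, hfb⟩ := exists_pos_bounds_of_continuousOn h.hf h.fpos
  have hpos : ∀ {t : ℝ}, 1 ≤ t → 0 < t := fun ht => one_pos.trans_le ht
  have hz : ∀ t, 1 ≤ t → HasDerivAt (fun t => -(alphaC f u ρ t)⁻¹)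
      ((rsp f j u ρ t / ρ t - 2 * avgB f u t) / alphaC f u ρ t) t := fun t ht => by
    have hα := (h.alphaC_pos (hpos ht)).ne'
    refine ((h.hasDerivAt_alphaC (hpos ht)).inv hα).neg.congr_deriv ?_
    field_simp
  have key : ∃ T, ∀ t, T ≤ t → -(alphaC f u ρ t)⁻¹ ≤ -(2 * M)⁻¹ := by
    refine eventually_le_of_dissipation (E := energy f j u ρ) (F := deficit f j u ρ)
      (t₀ := 1) (lb := lb) (m := -M⁻¹) (m₂ := -(2 * M)⁻¹) (C := fM / 2) (by positivity)
      (neg_lt_neg (inv_strictAnti₀ hM (by linarith)))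
      (fun t ht => h.hasDerivAt_energy (hpos ht)) (deficit_nonneg f j u ρ) (fun t ht => (hlb t ht).1)
      hz ?_ ?_
    · intro t ht hm _
      have ht0 := hpos ht
      have hα := h.alphaC_pos ht0
      obtain ⟨hρ, -⟩ := h.rho_mem t ht0
      have h1 := hr t ht0 ((inv_le_inv₀ hα hM).1 (neg_le_neg_iff.1 hm))
      have h2 := h.mul_avgB_sq_le ht0 (fun z hz => (hfb z hz).2) hfM.le
      rw [div_le_iff₀ hα]
      have h3 : rsp f j u ρ t / ρ t ≤ -1 / ρ t := div_le_div_of_nonneg_right h1 hρ.le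
      have h4 : 0 ≤ (1 + ρ t * avgB f u t) ^ 2 / ρ t := by positivity
      have h5 : (1 + ρ t * avgB f u t) ^ 2 / ρ t =
          -(-1 / ρ t) + 2 * avgB f u t + ρ t * avgB f u t ^ 2 := by
        field_simp
        ring
      linarith
    · intro s
      obtain ⟨t, hst, ht, h1⟩ := exists_neg_lt_of_hasDerivAt (g := ρ) (lb := 0) one_pos
        (fun t ht => h.hasDerivAt_rho (hpos ht)) (fun t ht => (h.rho_mem t (hpos ht)).1.le) s
      refine ⟨t, hst, ht, neg_le_neg (inv_anti₀ (h.alphaC_pos (hpos ht)) ?_)⟩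
      by_contra! hlt
      linarith [hr t (hpos ht) hlt.le]
  obtain ⟨T, hT⟩ := key
  refine ⟨T, 2 * M, by positivity, fun t ht ht0 => ?_⟩
  exact (inv_le_inv₀ (by positivity) (h.alphaC_pos ht0)).1 (neg_le_neg_iff.1 (hT t ht))

theorem exists_betaC_le (h : FlowData f j u ρ) :
    ∃ T M, 0 < M ∧ ∀ t, T ≤ t → 0 < t → betaC j u ρ t ≤ M := by
  obtain ⟨lb, _, -, hlb⟩ := h.exists_energy_bound_and_cubic_bound
  obtain ⟨M, hM, hr⟩ := h.exists_one_le_rsp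
  obtain ⟨jm, jM, hjm, hjM, hjb⟩ := exists_pos_bounds_of_continuousOn h.hj h.jpos
  have hpos : ∀ {t : ℝ}, 1 ≤ t → 0 < t := fun ht => one_pos.trans_le ht
  have hz : ∀ t, 1 ≤ t → HasDerivAt (fun t => -(betaC j u ρ t)⁻¹)
      ((-(rsp f j u ρ t / (π - ρ t)) - avgC j u t) / betaC j u ρ t) t := fun t ht => by
    have hβ := (h.betaC_pos (hpos ht)).ne'
    refine ((h.hasDerivAt_betaC (hpos ht)).inv hβ).neg.congr_deriv ?_
    field_simp
  have key : ∃ T, ∀ t, T ≤ t → -(betaC j u ρ t)⁻¹ ≤ -(2 * M)⁻¹ := by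
    refine eventually_le_of_dissipation (E := energy f j u ρ) (F := deficit f j u ρ)
      (t₀ := 1) (lb := lb) (m := -M⁻¹) (m₂ := -(2 * M)⁻¹) (C := jM / 8) (by positivity)
      (neg_lt_neg (inv_strictAnti₀ hM (by linarith)))
      (fun t ht => h.hasDerivAt_energy (hpos ht)) (deficit_nonneg f j u ρ) (fun t ht => (hlb t ht).1)
      hz ?_ ?_
    · intro t ht hm _
      have ht0 := hpos ht
      have hβ := h.betaC_pos ht0
      have hπ := sub_pos.2 (h.rho_mem t ht0).2
      have h1 := hr t ht0 ((inv_le_inv₀ hβ hM).1 (neg_le_neg_iff.1 hm))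
      have h2 := h.mul_avgC_sq_le ht0 (fun z hz => (hjb z hz).2) hjM.le
      rw [div_le_iff₀ hβ]
      have h3 : 1 / (π - ρ t) ≤ rsp f j u ρ t / (π - ρ t) := div_le_div_of_nonneg_right h1 hπ.le
      have h4 : 0 ≤ (1 + (π - ρ t) * avgC j u t / 2) ^ 2 / (π - ρ t) := by positivity
      have h5 : (1 + (π - ρ t) * avgC j u t / 2) ^ 2 / (π - ρ t) =
          1 / (π - ρ t) + avgC j u t + (π - ρ t) * avgC j u t ^ 2 / 4 := by
        field_simp
        ring
      linarith
    · intro s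
      obtain ⟨t, hst, ht, h1⟩ := exists_neg_lt_of_hasDerivAt (g := fun t => -ρ t) (lb := -π) one_pos
        (fun t ht => (h.hasDerivAt_rho (hpos ht)).neg)
        (fun t ht => neg_le_neg (h.rho_mem t (hpos ht)).2.le) s
      refine ⟨t, hst, ht, neg_le_neg (inv_anti₀ (h.betaC_pos (hpos ht)) ?_)⟩
      by_contra! hlt
      linarith [hr t (hpos ht) hlt.le]
  obtain ⟨T, hT⟩ := key
  refine ⟨T, 2 * M, by positivity, fun t ht ht0 => ?_⟩
  exact (inv_le_inv₀ (by positivity) (h.betaC_pos ht0)).1 (neg_le_neg_iff.1 (hT t ht))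

theorem tendsto_deficit (h : FlowData f j u ρ) : Tendsto (deficit f j u ρ) atTop (𝓝 0) := by
  obtain ⟨lb, C, hC, hlb⟩ := h.exists_energy_bound_and_cubic_bound
  obtain ⟨T₁, a, ha, hα⟩ := h.exists_alphaC_le
  obtain ⟨T₂, b, hb, hβ⟩ := h.exists_betaC_le
  obtain ⟨fm, fM, hfm, hfM, hfb⟩ := exists_pos_bounds_of_continuousOn h.hf h.fpos
  obtain ⟨jm, jM, hjm, hjM, hjb⟩ := exists_pos_bounds_of_continuousOn h.hj h.jpos
  set t₀ := max 1 (max T₁ T₂) with ht₀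
  have h1t : ∀ {t : ℝ}, t₀ ≤ t → 1 ≤ t := fun ht => (le_max_left _ _).trans ht
  have hpos : ∀ {t : ℝ}, t₀ ≤ t → 0 < t := fun ht => one_pos.trans_le (h1t ht)
  have hF := deficit_nonneg f j u ρ
  have hdiff : ∀ t, t₀ ≤ t → deficit f j u ρ t ≤ 1 / (C + 1) ^ 2 →
      deriv (deficit f j u ρ) t ≤ (4 * a * fM + 2 * b * jM + 2) * deficit f j u ρ t := by
    intro t ht hsmall
    have ht0 := hpos ht
    obtain ⟨d, hd, hle⟩ := h.exists_hasDerivAt_deficit ht0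
    rw [hd.deriv]
    have hv := vsq_nonneg u t
    have hvF := vsq_le_deficit f j u ρ t
    have hD := dirich_nonneg (vel u t)
    have hcub := (hlb t (h1t ht)).2
    have hsq : C * √(vsq u t) ≤ 1 := by
      have h1 : √(vsq u t) ≤ 1 / (C + 1) := by
        rw [Real.sqrt_le_left (by positivity), one_div_pow]
        exact hvF.trans hsmall
      calc C * √(vsq u t) ≤ C * (1 / (C + 1)) := by gcongr
        _ ≤ 1 := by rw [mul_one_div, div_le_one (by linarith)]; linarith
    have h2 : C * √(vsq u t) * (dirich (vel u t) + vsq u t) ≤ dirich (vel u t) + vsq u t :=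
      mul_le_of_le_one_left (add_nonneg hD hv) hsq
    have h3 : alphaC f u ρ t * (ballInt fun z => f z * vel u t z ^ 2 * Real.exp (2 * u z t)) ≤
        a * (fM * vsq u t) :=
      (mul_le_mul_of_nonneg_left (h.ballInt_mul_vel_sq_le ht0 (fun z hz => (hfb z hz).2) hfM.le)
        (h.alphaC_pos ht0).le).trans (mul_le_mul_of_nonneg_right
          (hα t ((le_max_left _ _).trans ((le_max_right _ _).trans ht)) ht0) (by positivity))
    have h4 : betaC j u ρ t * (circInt fun z => j z * vel u t z ^ 2 * Real.exp (u z t)) ≤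
        b * (jM * vsq u t) :=
      (mul_le_mul_of_nonneg_left (h.circInt_mul_vel_sq_le ht0 (fun z hz => (hjb z hz).2) hjM.le)
        (h.betaC_pos ht0).le).trans (mul_le_mul_of_nonneg_right
          (hβ t ((le_max_right _ _).trans ((le_max_right _ _).trans ht)) ht0) (by positivity))
    have h5 := mul_le_mul_of_nonneg_left hvF
      (show 0 ≤ 4 * a * fM + 2 * b * jM + 2 by positivity)
    linarith only [hle, hcub, h2, h3, h4, h5]
  rw [Metric.tendsto_atTop]
  intro ε hε
  set m₂ := min (ε / 2) (1 / (C + 1) ^ 2) with hm₂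
  have hm₂0 : 0 < m₂ := lt_min (by linarith) (by positivity)
  obtain ⟨T, hT⟩ := eventually_le_of_dissipation (E := energy f j u ρ) (F := deficit f j u ρ)
    (z := deficit f j u ρ) (z' := deriv (deficit f j u ρ)) (t₀ := t₀) (lb := lb) (m := m₂ / 2)
    (m₂ := m₂) (C := 4 * a * fM + 2 * b * jM + 2) (by positivity) (by linarith)
    (fun t ht => h.hasDerivAt_energy (hpos ht)) hF (fun t ht => (hlb t (h1t ht)).1)
    (fun t ht => (h.exists_hasDerivAt_deficit (hpos ht)).elim fun d hd =>
      hd.1.differentiableAt.hasDerivAt)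
    (fun t ht _ hm => hdiff t ht (hm.trans (min_le_right _ _)))
    (fun s => by
      obtain ⟨t, hst, ht, h1⟩ := exists_neg_lt_of_hasDerivAt (half_pos hm₂0)
        (fun t ht => h.hasDerivAt_energy (hpos ht)) (fun t ht => (hlb t (h1t ht)).1) s
      exact ⟨t, hst, ht, (neg_lt_neg_iff.1 h1).le⟩)
  refine ⟨T, fun t ht => ?_⟩
  rw [Real.dist_eq, sub_zero, abs_of_nonneg (hF t)]
  linarith [hT t ht, min_le_left (ε / 2) (1 / (C + 1) ^ 2)]

end FlowData

theorem mem_flowDom_top {t : ℝ} (ht : 0 ≤ t) : t ∈ flowDom ⊤ := ⟨ht, ENNReal.ofReal_lt_top⟩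

theorem betaC_congr {j₁ j₂ : ℂ → ℝ} (hj : ∀ z ∈ bdry, j₁ z = j₂ z) (u : ℂ → ℝ → ℝ) (ρ : ℝ → ℝ)
    (t : ℝ) : betaC j₁ u ρ t = betaC j₂ u ρ t := by
  rw [betaC, betaC, circInt_congr fun z hz => by rw [hj z hz]]

/-- Positive boundary data extend to positive continuous functions. -/
theorem exists_pos_extension {j : ℂ → ℝ} (hj : ContinuousOn j bdry) (hpos : ∀ z ∈ bdry, 0 < j z) :
    ∃ g : ℂ → ℝ, Continuous g ∧ (∀ z, 0 < g z) ∧ ∀ z ∈ bdry, j z = g z := by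
  obtain ⟨g, hg⟩ := ContinuousMap.exists_restrict_eq (isClosed_sphere : IsClosed bdry)
    ⟨fun z : bdry => Real.log (j z),
      (continuousOn_iff_continuous_domRestrict.1 hj).log fun z => (hpos z z.2).ne'⟩
  refine ⟨fun z => Real.exp (g z), by fun_prop, fun z => Real.exp_pos _, fun z hz => ?_⟩
  have h1 : g z = Real.log (j z) := DFunLike.congr_fun hg ⟨z, hz⟩
  simp only [h1, Real.exp_log (hpos z hz)]

theorem IsFlow.flowData {f j g : ℂ → ℝ} {u : ℂ → ℝ → ℝ} {ρ : ℝ → ℝ} (h : IsFlow f j ⊤ u ρ)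
    (hf : ContinuousOn f cdisc) (hfpos : ∀ z ∈ cdisc, 0 < f z) (hg : Continuous g)
    (hgpos : ∀ z, 0 < g z) (hjg : ∀ z ∈ bdry, j z = g z) : FlowData f g u ρ := by
  obtain ⟨hu, hρ, hmem, h_int, hbd, hode⟩ := h
  refine ⟨hf, hfpos, hg.continuousOn, fun z _ => hgpos z,
    hu.mono (prod_mono_right fun t ht => mem_flowDom_top (le_of_lt ht)),
    fun t ht => hmem t (mem_flowDom_top ht.le), fun t ht => ?_,
    fun t ht z hz => h_int t (mem_flowDom_top ht.le) ht z hz, fun t ht z hz => ?_⟩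
  · have hd : DifferentiableAt ℝ ρ t := (hρ.contDiffAt (mem_of_superset (Ioi_mem_nhds ht)
      fun s hs => mem_flowDom_top (le_of_lt hs))).differentiableAt one_ne_zero
    rw [← betaC_congr hjg, ← hode t (mem_flowDom_top ht.le) ht]
    exact hd.hasDerivAt
  · rw [← betaC_congr hjg, ← hjg z hz]
    exact hbd t (mem_flowDom_top ht.le) ht z hz

/-- Unconditional decay of the curvature deficit:
`F(t) = ∫_B (αf − K)² dμ_g + ∫_{∂B} (βj − k)² ds_g + ρ'(t)² → 0` as `t → ∞`
for a global solution of the flow. -/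
theorem flow_curvature_deficit_tendsto_zero (f j : ℂ → ℝ)
    (hf : ContDiffOn ℝ (⊤ : ℕ∞) f cdisc) (hfpos : ∀ z ∈ cdisc, 0 < f z)
    (hj : ContDiffOn ℝ (⊤ : ℕ∞) j bdry) (hjpos : ∀ z ∈ bdry, 0 < j z)
    (u : ℂ → ℝ → ℝ) (ρ : ℝ → ℝ) (hflow : IsFlow f j ⊤ u ρ) :
    Filter.Tendsto
      (fun t : ℝ =>
        ballInt (fun z => (alphaC f u ρ t * f z - Kcur u t z) ^ 2 * Real.exp (2 * u z t)) +
        circInt (fun z => (betaC j u ρ t * j z - kcur u t z) ^ 2 * Real.exp (u z t)) +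
        (deriv ρ t) ^ 2)
      Filter.atTop (nhds 0) := by
  obtain ⟨g, hg, hgpos, hjg⟩ := exists_pos_extension hj.continuousOn hjpos
  have h := hflow.flowData hf.continuousOn hfpos hg hgpos hjg
  refine h.tendsto_deficit.congr' ?_
  filter_upwards [eventually_gt_atTop 0] with t ht
  rw [FlowData.deficit, FlowData.vsq, wInt, (h.hasDerivAt_rho ht).deriv]
  congr 2
  · refine ballInt_congr fun z hz => ?_
    rw [FlowData.vel, h.interior_eq t ht z hz, Kcur]
    ring
  · refine circInt_congr fun z hz => ?_
    rw [FlowData.vel, h.boundary_eq t ht z hz, kcur, betaC_congr hjg, hjg z hz]
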